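/- There exists a function ε : (0,∞) → (0,∞) with the property that for every α ∈ (0, 1/6), ε(δ)/δ^{1/6−α} → 0 as δ → 0⁺, such that the following holds for every n ≥ 1 and every δ > 0: if H₁ and H₂ are Hermitian n×n complex matrices with ‖H₁‖ ≤ 1, ‖H₂‖ ≤ 1 and ‖[H₁, H₂]‖ ≤ δ, then there exist Hermitian n×n matrices K₁, K₂ with ‖K₁‖ ≤ 1, ‖K₂‖ ≤ 1, K₁K₂ = K₂K₁, and ‖H₁ − K₁‖ ≤ ε(δ), ‖H₂ − K₂‖ ≤ ε(δ). The function ε does not depend on the dimension n. -/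

import Mathlib

open Matrix

noncomputable section

namespace AC

variable {m : Type*} [Fintype m] [DecidableEq m]

/-- The ℓ² operator norm of a complex matrix. -/
def opNorm (A : Matrix m m ℂ) : ℝ :=
  ‖Matrix.toEuclideanCLM (𝕜 := ℂ) A‖

/-- `(H₁, H₂, H₃)` is a δ-representation of the sphere: each `Hᵣ` is Hermitian, all
commutators have ℓ²-operator norm at most `δ`, and `‖H₁² + H₂² + H₃² − I‖ ≤ δ`. -/
def IsSphereRep (δ : ℝ) (H₁ H₂ H₃ : Matrix m m ℂ) : Prop :=
  H₁.IsHermitian ∧ H₂.IsHermitian ∧ H₃.IsHermitian ∧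
  opNorm (H₁ * H₂ - H₂ * H₁) ≤ δ ∧
  opNorm (H₁ * H₃ - H₃ * H₁) ≤ δ ∧
  opNorm (H₂ * H₃ - H₃ * H₂) ≤ δ ∧
  opNorm (H₁ ^ 2 + H₂ ^ 2 + H₃ ^ 2 - 1) ≤ δ

/-- The 2n×2n Hermitian block matrix `S(H₁,H₂,H₃) = [[H₃, H₁ − iH₂], [H₁ + iH₂, −H₃]]`. -/
def sphS (H₁ H₂ H₃ : Matrix m m ℂ) : Matrix (m ⊕ m) (m ⊕ m) ℂ :=
  Matrix.fromBlocks H₃ (H₁ - Complex.I • H₂) (H₁ + Complex.I • H₂) (-H₃)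

open Classical in
/-- The Bott index: the number of positive eigenvalues (with multiplicity) of
`S(H₁,H₂,H₃)` minus `n`.  (Junk value `0` if `S(H₁,H₂,H₃)` is not Hermitian.) -/
def bott (H₁ H₂ H₃ : Matrix m m ℂ) : ℤ :=
  if h : (sphS H₁ H₂ H₃).IsHermitian then
    ((Finset.univ.filter fun i => 0 < h.eigenvalues i).card : ℤ) - Fintype.card m
  else 0

end AC

open Filter Topology
open scoped ENNReal

section SeqQuot

set_option linter.unusedSectionVars false

variable (E : ℕ → Type) [∀ k, CStarAlgebra (E k)] [∀ k, Nontrivial (E k)]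

instance instCStarAlgebraLpInfty : CStarAlgebra (lp E ∞) where

/-- The C*-algebra of bounded sequences. -/
def BddSeq : Type := lp E ∞

namespace BddSeq

instance : CStarAlgebra (BddSeq E) :=
  inferInstanceAs (CStarAlgebra (lp E ∞))

/-- Evaluation at an index, as a star homomorphism. -/
def eval (k : ℕ) : BddSeq E →⋆ₐ[ℂ] E k where
  toFun x := (show lp E ∞ from x) k
  map_one' := rfl
  map_mul' _ _ := rfl
  map_zero' := rfl
  map_add' _ _ := rfl
  commutes' _ := rfl
  map_star' _ := rfl

variable {E}

theorem ext {x y : BddSeq E} (h : ∀ k, eval E k x = eval E k y) : x = y :=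
  lp.ext (E := E) (funext h)

theorem norm_eval_le (x : BddSeq E) (k : ℕ) : ‖eval E k x‖ ≤ ‖x‖ :=
  lp.norm_apply_le_norm (E := E) (by simp) x k

theorem norm_le_of_forall {x : BddSeq E} {c : ℝ} (hc : 0 ≤ c) (h : ∀ k, ‖eval E k x‖ ≤ c) :
    ‖x‖ ≤ c := lp.norm_le_of_forall_le (E := E) hc h

theorem continuous_eval (k : ℕ) : Continuous (eval E k) :=
  AddMonoidHomClass.continuous_of_bound _ 1 fun x => by simpa using norm_eval_le x k

/-- The bounded sequence with given terms. -/
def ofBound (f : ∀ k, E k) (C : ℝ) (h : ∀ k, ‖f k‖ ≤ C) : BddSeq E :=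
  (⟨f, memℓp_infty ⟨C, by rintro _ ⟨k, rfl⟩; exact h k⟩⟩ : lp E ∞)

@[simp] theorem eval_ofBound (f : ∀ k, E k) (C : ℝ) (h : ∀ k, ‖f k‖ ≤ C) (k : ℕ) :
    eval E k (ofBound f C h) = f k := rfl

end BddSeq

open BddSeq

/-- The ideal of bounded sequences tending to zero. -/
def nullIdeal : Ideal (BddSeq E) where
  carrier := {x | Tendsto (fun k => ‖eval E k x‖) atTop (𝓝 0)}
  zero_mem' := by simp
  add_mem' := by
    intro a b ha hb
    refine squeeze_zero (fun k => norm_nonneg _) (fun k => ?_) (by simpa using ha.add hb)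
    simpa using norm_add_le (eval E k a) (eval E k b)
  smul_mem' := by
    intro c x hx
    refine squeeze_zero (fun k => norm_nonneg _) (fun k => ?_)
      (by simpa using hx.const_mul ‖c‖)
    rw [smul_eq_mul, map_mul]
    exact (norm_mul_le _ _).trans
      (mul_le_mul_of_nonneg_right (norm_eval_le c k) (norm_nonneg _))

variable {E} in
theorem mem_nullIdeal {x : BddSeq E} :
    x ∈ nullIdeal E ↔ Tendsto (fun k => ‖eval E k x‖) atTop (𝓝 0) := Iff.rfl

instance : (nullIdeal E).IsTwoSided where
  mul_mem_of_left := by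
    intro x c hx
    rw [mem_nullIdeal] at *
    refine squeeze_zero (fun k => norm_nonneg _) (fun k => ?_)
      (by simpa using hx.mul_const ‖c‖)
    rw [map_mul]
    exact (norm_mul_le _ _).trans
      (mul_le_mul_of_nonneg_left (norm_eval_le c k) (norm_nonneg _))

instance : IsClosed (nullIdeal E : Set (BddSeq E)) := by
  refine isClosed_of_closure_subset fun x hx => ?_
  rw [SetLike.mem_coe, mem_nullIdeal, Metric.tendsto_atTop]
  intro ε hε
  obtain ⟨y, hy, hxy⟩ := Metric.mem_closure_iff.1 hx (ε / 2) (half_pos hε)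
  rw [SetLike.mem_coe, mem_nullIdeal, Metric.tendsto_atTop] at hy
  obtain ⟨N, hN⟩ := hy (ε / 2) (half_pos hε)
  refine ⟨N, fun k hk => ?_⟩
  have h1 := hN k hk
  simp only [dist_zero_right, norm_norm] at h1 ⊢
  have h2 : ‖eval E k (x - y)‖ ≤ ‖x - y‖ := norm_eval_le _ k
  rw [dist_eq_norm] at hxy
  have h3 : eval E k x = eval E k (x - y) + eval E k y := by simp
  rw [h3]
  linarith [norm_add_le (eval E k (x - y)) (eval E k y)]

/-- Bounded sequences modulo null sequences. -/
def SeqQuot : Type := BddSeq E ⧸ nullIdeal E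

namespace SeqQuot

instance : Ring (SeqQuot E) := inferInstanceAs (Ring (BddSeq E ⧸ nullIdeal E))
instance : Algebra ℂ (SeqQuot E) := inferInstanceAs (Algebra ℂ (BddSeq E ⧸ nullIdeal E))
instance : NormedAddCommGroup (SeqQuot E) :=
  inferInstanceAs (NormedAddCommGroup (BddSeq E ⧸ nullIdeal E))
instance : CompleteSpace (SeqQuot E) :=
  inferInstanceAs (CompleteSpace (BddSeq E ⧸ nullIdeal E))

/-- The quotient map. -/
def mkHom : BddSeq E →ₐ[ℂ] SeqQuot E := Ideal.Quotient.mkₐ ℂ (nullIdeal E)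

variable {E}

theorem mkHom_surjective : Function.Surjective (mkHom E) := Ideal.Quotient.mkₐ_surjective ℂ _

theorem mkHom_eq_iff {x y : BddSeq E} :
    mkHom E x = mkHom E y ↔ Tendsto (fun k => ‖eval E k x - eval E k y‖) atTop (𝓝 0) := by
  have : mkHom E x = mkHom E y ↔ x - y ∈ nullIdeal E := Ideal.Quotient.mk_eq_mk_iff_sub_mem x y
  rw [this, mem_nullIdeal]
  simp only [map_sub]

theorem norm_mkHom_le (x : BddSeq E) : ‖mkHom E x‖ ≤ ‖x‖ := Submodule.Quotient.norm_mk_le _ x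

theorem exists_mkHom_eq_norm_lt (z : SeqQuot E) {c : ℝ} (hc : ‖z‖ < c) :
    ∃ x, mkHom E x = z ∧ ‖x‖ < c := by
  obtain ⟨x, hx, hx'⟩ := Submodule.Quotient.norm_mk_lt (S := nullIdeal E) z (sub_pos.2 hc)
  exact ⟨x, hx, hx'.trans_eq (add_sub_cancel _ _)⟩

theorem eventually_norm_lt {x : BddSeq E} {c : ℝ} (hc : ‖mkHom E x‖ < c) :
    ∀ᶠ k in atTop, ‖eval E k x‖ < c := by
  obtain ⟨y, hy, hyc⟩ := exists_mkHom_eq_norm_lt _ hc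
  have h := mkHom_eq_iff.1 hy
  filter_upwards [h.eventually (gt_mem_nhds (sub_pos.2 hyc))] with k hk
  have h2 : ‖eval E k y‖ ≤ ‖y‖ := norm_eval_le _ k
  have h3 := norm_sub_norm_le (eval E k x) (eval E k y)
  rw [norm_sub_rev] at h3
  linarith

theorem norm_mkHom_le_of_eventually {x : BddSeq E} {c : ℝ} (hc : 0 ≤ c)
    (h : ∀ᶠ k in atTop, ‖eval E k x‖ ≤ c) : ‖mkHom E x‖ ≤ c := by
  obtain ⟨N, hN⟩ := eventually_atTop.1 h
  let y : BddSeq E := ofBound (fun k => if k < N then 0 else eval E k x) c (fun k => by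
    split_ifs with hk
    · simpa using hc
    · exact hN k (not_lt.1 hk))
  have hy : mkHom E x = mkHom E y := by
    rw [mkHom_eq_iff]
    refine tendsto_const_nhds.congr' ?_
    filter_upwards [eventually_ge_atTop N] with k hk
    simp [y, not_lt.2 hk]
  rw [hy]
  refine (norm_mkHom_le y).trans (norm_le_of_forall hc fun k => ?_)
  simp only [y, eval_ofBound]
  split_ifs with hk
  · simpa using hc
  · exact hN k (not_lt.1 hk)

theorem norm_mul_le' (a b : SeqQuot E) : ‖a * b‖ ≤ ‖a‖ * ‖b‖ := by
  obtain ⟨x, rfl⟩ := mkHom_surjective a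
  obtain ⟨y, rfl⟩ := mkHom_surjective b
  have key : ∀ᶠ t in 𝓝[>] (0 : ℝ),
      ‖mkHom E x * mkHom E y‖ ≤ (‖mkHom E x‖ + t) * (‖mkHom E y‖ + t) := by
    filter_upwards [self_mem_nhdsWithin] with t ht
    rw [Set.mem_Ioi] at ht
    rw [← map_mul]
    refine norm_mkHom_le_of_eventually (by positivity) ?_
    filter_upwards [eventually_norm_lt (lt_add_of_pos_right ‖mkHom E x‖ ht),
      eventually_norm_lt (lt_add_of_pos_right ‖mkHom E y‖ ht)] with k h1 h2
    rw [map_mul]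
    exact (norm_mul_le _ _).trans (mul_le_mul h1.le h2.le (norm_nonneg _) (by positivity))
  refine ge_of_tendsto ?_ key
  have : Continuous fun t : ℝ => (‖mkHom E x‖ + t) * (‖mkHom E y‖ + t) := by fun_prop
  simpa using (this.tendsto 0).mono_left nhdsWithin_le_nhds

instance : NormedRing (SeqQuot E) where
  dist_eq := dist_eq_norm_neg_add
  norm_mul_le := norm_mul_le'

instance : NormedAlgebra ℂ (SeqQuot E) where
  norm_smul_le := fun c x =>
    (norm_smul_le (α := ℂ) (β := BddSeq E ⧸ nullIdeal E) c x : _)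

instance : StarRing (SeqQuot E) where
  star := Quotient.map' star (by
    intro a b h
    rw [Submodule.quotientRel_def, mem_nullIdeal] at h ⊢
    rw [← star_sub]
    simpa only [map_star, norm_star] using h)
  star_involutive := by
    rintro ⟨x⟩
    exact congrArg (mkHom E) (star_star x)
  star_mul := by
    rintro ⟨x⟩ ⟨y⟩
    exact congrArg (mkHom E) (star_mul x y)
  star_add := by
    rintro ⟨x⟩ ⟨y⟩
    exact congrArg (mkHom E) (star_add x y)

theorem star_mkHom (x : BddSeq E) : star (mkHom E x) = mkHom E (star x) := rfl

instance : StarModule ℂ (SeqQuot E) where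
  star_smul := by
    intro c z
    obtain ⟨x, rfl⟩ := mkHom_surjective z
    rw [← map_smul, star_mkHom, star_mkHom, ← map_smul, star_smul]

instance : CStarRing (SeqQuot E) where
  norm_mul_self_le := by
    intro z
    obtain ⟨x, rfl⟩ := mkHom_surjective z
    have key : ∀ᶠ t in 𝓝[>] (0 : ℝ), ‖mkHom E x‖ ≤ √(‖star (mkHom E x) * mkHom E x‖ + t) := by
      filter_upwards [self_mem_nhdsWithin] with t ht
      rw [Set.mem_Ioi] at ht
      rw [star_mkHom, ← map_mul]
      refine norm_mkHom_le_of_eventually (by positivity) ?_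
      filter_upwards [eventually_norm_lt (lt_add_of_pos_right ‖mkHom E (star x * x)‖ ht)] with k h1
      rw [map_mul, map_star,
        CStarRing.norm_star_mul_self] at h1
      exact Real.le_sqrt_of_sq_le (by nlinarith)
    have h2 : ‖mkHom E x‖ ≤ √(‖star (mkHom E x) * mkHom E x‖) := by
      refine ge_of_tendsto ?_ key
      have : Continuous fun t : ℝ => √(‖star (mkHom E x) * mkHom E x‖ + t) := by fun_prop
      simpa using (this.tendsto 0).mono_left nhdsWithin_le_nhds
    nlinarith [Real.sq_sqrt (norm_nonneg (star (mkHom E x) * mkHom E x)), norm_nonneg (mkHom E x),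
      Real.sqrt_nonneg ‖star (mkHom E x) * mkHom E x‖]

instance : CStarAlgebra (SeqQuot E) where

variable (E) in
/-- The quotient map as a star homomorphism. -/
def mkStar : BddSeq E →⋆ₐ[ℂ] SeqQuot E := { mkHom E with map_star' := fun _ => rfl }

end SeqQuot
end SeqQuot

section FiniteSpectrum
variable {A : Type*} [CStarAlgebra A]

theorem spectrum_complex_finite [FiniteDimensional ℂ A] (a : A) : (spectrum ℂ a).Finite := by
  have hinteg : IsIntegral ℂ a := Algebra.IsIntegral.isIntegral a
  refine ((minpoly ℂ a).roots.toFinset.finite_toSet).subset fun k hk => ?_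
  have h := spectrum.subset_polynomial_aeval a (minpoly ℂ a) ⟨k, hk, rfl⟩
  rw [minpoly.aeval] at h
  rcases subsingleton_or_nontrivial A with hA | hA
  · simp [spectrum.of_subsingleton] at hk
  · rw [spectrum.zero_eq, Set.mem_singleton_iff] at h
    simpa [minpoly.ne_zero hinteg] using h

theorem spectrum_real_finite [FiniteDimensional ℂ A] (a : A) : (spectrum ℝ a).Finite := by
  rw [← spectrum.preimage_algebraMap ℂ]
  exact (spectrum_complex_finite a).preimage (Complex.ofReal_injective.injOn)

theorem continuousOn_spectrum_real [FiniteDimensional ℂ A] (a : A) (f : ℝ → ℝ) :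
    ContinuousOn f (spectrum ℝ a) := (spectrum_real_finite a).continuousOn f

theorem continuousOn_spectrum_complex [FiniteDimensional ℂ A] (a : A) (f : ℂ → ℂ) :
    ContinuousOn f (spectrum ℂ a) := (spectrum_complex_finite a).continuousOn f

end FiniteSpectrum

section Polar
variable {A : Type*} [CStarAlgebra A]

theorem cfc_sqrt_mul_self (Z : A) :
    cfc Real.sqrt (star Z * Z) * cfc Real.sqrt (star Z * Z) = star Z * Z := by
  rw [← cfc_mul ..]
  conv_rhs => rw [← cfc_id' ℝ (star Z * Z)]
  refine cfc_congr fun x hx => ?_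
  exact Real.mul_self_sqrt (spectrum_star_mul_self_nonneg x hx)

theorem exists_polar_of_isUnit {Z : A} (hZ : IsUnit Z) :
    ∃ W ∈ unitary A, Z = W * cfc Real.sqrt (star Z * Z) := by
  set h := cfc Real.sqrt (star Z * Z) with hh
  have hsa : IsSelfAdjoint h := cfc_predicate _ _
  have hmul : h * h = star Z * Z := cfc_sqrt_mul_self Z
  have hu : IsUnit h := by
    have h2 : IsUnit (h * h) := hmul ▸ hZ.star.mul hZ
    exact ((Commute.refl h).isUnit_mul_iff.1 h2).1
  obtain ⟨u, hu'⟩ := hu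
  have hus : star (↑u⁻¹ : A) = ↑u⁻¹ := by
    have : star u = u := Units.ext (by rw [Units.coe_star, hu']; exact hsa)
    rw [← Units.coe_star, star_inv, this]
  have h1 : star (Z * ↑u⁻¹) * (Z * ↑u⁻¹) = 1 := by
    rw [star_mul, hus, mul_assoc, ← mul_assoc (star Z), ← hmul, ← hu']
    simp [mul_assoc]
  have hWu : IsUnit (Z * (↑u⁻¹ : A)) := hZ.mul u⁻¹.isUnit
  refine ⟨Z * ↑u⁻¹, ?_, ?_⟩
  · rw [Unitary.mem_iff]
    refine ⟨h1, ?_⟩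
    obtain ⟨w, hw⟩ := hWu
    rw [← hw] at h1 ⊢
    have : star (w : A) = ↑w⁻¹ := by rw [← Units.mul_eq_one_iff_eq_inv]; exact h1
    rw [this]; simp
  · rw [← hu']; simp [mul_assoc]

theorem exists_small_isUnit_add [FiniteDimensional ℂ A] (Z : A) {ε : ℝ} (hε : 0 < ε) :
    ∃ t : ℝ, 0 < t ∧ t < ε ∧ IsUnit (Z + algebraMap ℂ A t) := by
  have hfin : ((fun t : ℝ => (-(t : ℂ))) ⁻¹' spectrum ℂ Z).Finite :=
    (spectrum_complex_finite Z).preimage (fun x _ y _ h => by simpa using h)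
  obtain ⟨t, ht, ht'⟩ := (Set.Ioo_infinite hε).exists_notMem_finite hfin
  refine ⟨t, ht.1, ht.2, ?_⟩
  have := spectrum.notMem_iff.1 ht'
  rw [← IsUnit.neg_iff] at this
  convert this using 1
  simp

end Polar

namespace SeqQuot
open BddSeq
variable {E : ℕ → Type} [∀ k, CStarAlgebra (E k)] [∀ k, Nontrivial (E k)]

theorem mkStar_surjective : Function.Surjective (mkStar E) := mkHom_surjective

theorem continuous_mkStar : Continuous (mkStar E) :=
  AddMonoidHomClass.continuous_of_bound _ 1 fun x => by
    rw [one_mul]; exact norm_mkHom_le x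

theorem eval_star_mul_self (k : ℕ) (x : BddSeq E) :
    eval E k (star x * x) = star (eval E k x) * eval E k x := by
  rw [map_mul, map_star]

variable [∀ k, FiniteDimensional ℂ (E k)]

theorem exists_lift_polar (z : SeqQuot E) :
    ∃ Z W : BddSeq E, mkStar E Z = z ∧ W ∈ unitary (BddSeq E) ∧
      Z = W * cfc Real.sqrt (star Z * Z) := by
  obtain ⟨Y, rfl⟩ := mkStar_surjective z
  have h1 : ∀ k : ℕ, ∃ t : ℝ, 0 < t ∧ t < 1 / ((k : ℝ) + 1) ∧
      IsUnit (eval E k Y + algebraMap ℂ (E k) t) :=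
    fun k => exists_small_isUnit_add (eval E k Y) (by positivity)
  choose t ht0 ht1 htu using h1
  have hb : ∀ k, ‖eval E k Y + algebraMap ℂ (E k) (t k)‖ ≤ ‖Y‖ + 1 := fun k => by
    refine (norm_add_le _ _).trans (add_le_add (norm_eval_le _ k) ?_)
    rw [norm_algebraMap', Complex.norm_real, Real.norm_of_nonneg (ht0 k).le]
    refine (ht1 k).le.trans ?_
    rw [div_le_one (by positivity)]
    linarith [(Nat.cast_nonneg k : (0 : ℝ) ≤ k)]
  let Z : BddSeq E := ofBound _ _ hb
  choose W hWu hW using fun k => exists_polar_of_isUnit (htu k)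
  let W' : BddSeq E := ofBound W 1 (fun k => CStarRing.norm_of_mem_unitary (hWu k) |>.le)
  refine ⟨Z, W', ?_, ?_, ?_⟩
  · refine mkHom_eq_iff.2 ?_
    refine squeeze_zero (fun k => norm_nonneg _) (fun k => ?_) tendsto_one_div_add_atTop_nhds_zero_nat
    simp only [Z, eval_ofBound, add_sub_cancel_left]
    rw [norm_algebraMap', Complex.norm_real, Real.norm_of_nonneg (ht0 k).le]
    exact (ht1 k).le
  · rw [Unitary.mem_iff]
    constructor
    · refine BddSeq.ext fun k => ?_
      rw [map_mul, map_star, map_one]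
      exact (Unitary.mem_iff.1 (hWu k)).1
    · refine BddSeq.ext fun k => ?_
      rw [map_mul, map_star, map_one]
      exact (Unitary.mem_iff.1 (hWu k)).2
  · refine BddSeq.ext fun k => ?_
    rw [map_mul, StarAlgHom.map_cfc (S := ℂ) (eval E k) Real.sqrt (star Z * Z)
      (Real.continuous_sqrt.continuousOn) (continuous_eval k) (.star_mul_self Z)
      (by rw [eval_star_mul_self]; exact .star_mul_self _), eval_star_mul_self]
    exact hW k

theorem exists_polar (z : SeqQuot E) :
    ∃ w ∈ unitary (SeqQuot E), z = w * cfc Real.sqrt (star z * z) := by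
  obtain ⟨Z, W, rfl, hW, hZ⟩ := exists_lift_polar z
  refine ⟨mkStar E W, Unitary.map_mem _ hW, ?_⟩
  have := congrArg (mkStar E) hZ
  rwa [map_mul, StarAlgHom.map_cfc (S := ℂ) (mkStar E) Real.sqrt (star Z * Z)
      (Real.continuous_sqrt.continuousOn) continuous_mkStar (.star_mul_self Z)
      (by rw [map_mul, map_star]; exact .star_mul_self _), map_mul, map_star] at this

theorem exists_unitary_lift {v : SeqQuot E} (hv : v ∈ unitary (SeqQuot E)) :
    ∃ W ∈ unitary (BddSeq E), mkStar E W = v := by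
  obtain ⟨Z, W, rfl, hW, hZ⟩ := exists_lift_polar v
  refine ⟨W, hW, ?_⟩
  have := congrArg (mkStar E) hZ
  rw [map_mul, StarAlgHom.map_cfc (S := ℂ) (mkStar E) Real.sqrt (star Z * Z)
      (Real.continuous_sqrt.continuousOn) continuous_mkStar (.star_mul_self Z)
      (by rw [map_mul, map_star]; exact .star_mul_self _), map_mul, map_star,
      (Unitary.mem_iff.1 hv).1, cfc_apply_one] at this
  simpa using this.symm

theorem exists_spectral_projection {v : SeqQuot E} (hv : v ∈ unitary (SeqQuot E)) (χ : ℂ → ℂ)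
    (hχ : ∀ z, χ z = 0 ∨ χ z = 1) :
    ∃ p : SeqQuot E, IsStarProjection p ∧ ∀ f : ℂ → ℂ, Continuous f → Commute (cfc f v) p ∧
      (ContinuousOn (fun z => f z * χ z) (Metric.sphere 0 1) →
        cfc f v * p = cfc (fun z => f z * χ z) v) := by
  obtain ⟨W, hW, rfl⟩ := exists_unitary_lift hv
  have hWk : ∀ k, eval E k W ∈ unitary (E k) := fun k => Unitary.map_mem _ hW
  have hn : ∀ k, IsStarNormal (eval E k W) := fun k => isStarNormal_of_mem_unitary (hWk k)
  have hWn : IsStarNormal W := isStarNormal_of_mem_unitary hW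
  have hvn : IsStarNormal (mkStar E W) := isStarNormal_of_mem_unitary hv
  have hc : ∀ k (f : ℂ → ℂ), ContinuousOn f (spectrum ℂ (eval E k W)) :=
    fun k f => continuousOn_spectrum_complex _ f
  let P : BddSeq E := ofBound (fun k => cfc χ (eval E k W)) 1 (fun k => by
    refine norm_cfc_le zero_le_one fun z _ => ?_
    rcases hχ z with h | h <;> simp [h])
  have hP : ∀ k, eval E k P = cfc χ (eval E k W) := fun k => rfl
  have hPP : P * P = P := BddSeq.ext fun k => by
    rw [map_mul, hP, ← cfc_mul _ _ _ (hc k _) (hc k _)]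
    refine cfc_congr fun z _ => ?_
    rcases hχ z with h | h <;> simp [h]
  have hPs : star P = P := BddSeq.ext fun k => by
    rw [map_star, hP, ← cfc_star]
    refine cfc_congr fun z _ => ?_
    rcases hχ z with h | h <;> simp [h]
  refine ⟨mkStar E P, ⟨?_, ?_⟩, fun f hf => ?_⟩
  · rw [IsIdempotentElem, ← map_mul, hPP]
  · rw [IsSelfAdjoint, ← map_star, hPs]
  have hfe : ∀ g : ℂ → ℂ, ContinuousOn g (Metric.sphere 0 1) → ∀ k,
      eval E k (cfc g W) = cfc g (eval E k W) := fun g hg k =>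
    StarAlgHom.map_cfc (S := ℂ) (eval E k) g W
      (hg.mono (spectrum.subset_circle_of_unitary hW)) (continuous_eval k) hWn (hn k)
  have hfm : ∀ g : ℂ → ℂ, ContinuousOn g (Metric.sphere 0 1) →
      mkStar E (cfc g W) = cfc g (mkStar E W) := fun g hg =>
    StarAlgHom.map_cfc (S := ℂ) (mkStar E) g W
      (hg.mono (spectrum.subset_circle_of_unitary hW)) continuous_mkStar hWn hvn
  have hfc : Commute (cfc f W) P := BddSeq.ext fun k => by
    rw [map_mul, map_mul, hP, hfe f hf.continuousOn]
    exact cfc_commute_cfc f χ _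
  refine ⟨?_, fun hfχ => ?_⟩
  · rw [← hfm _ hf.continuousOn]
    exact hfc.map (mkStar E)
  have hf1 : cfc f W * P = cfc (fun z => f z * χ z) W := BddSeq.ext fun k => by
    rw [map_mul, hP, hfe f hf.continuousOn, hfe _ hfχ, ← cfc_mul _ _ _ (hc k _) (hc k _)]
  rw [← hfm _ hf.continuousOn, ← hfm _ hfχ, ← map_mul, hf1]

theorem exists_projection_lift {q : SeqQuot E} (hq : IsStarProjection q) :
    ∃ Q : BddSeq E, IsStarProjection Q ∧ mkStar E Q = q := by
  obtain ⟨R₀, hR₀⟩ := mkStar_surjective q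
  let R : BddSeq E := (2⁻¹ : ℂ) • (R₀ + star R₀)
  have hR : mkStar E R = q := by
    simp only [R, map_smul, map_add, map_star, hR₀, hq.isSelfAdjoint.star_eq, ← two_smul ℂ q,
      smul_smul]
    norm_num
  have hRs : IsSelfAdjoint R := by
    simp [R, IsSelfAdjoint, star_smul, add_comm]
  have hRk : ∀ k, IsSelfAdjoint (eval E k R) := fun k => hRs.map _
  let χ : ℝ → ℝ := fun x => if 1 / 2 < x then 1 else 0
  have hχ : ∀ x, χ x = 0 ∨ χ x = 1 := fun x => by dsimp only [χ]; split_ifs <;> simp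
  have hc : ∀ k (f : ℝ → ℝ), ContinuousOn f (spectrum ℝ (eval E k R)) :=
    fun k f => continuousOn_spectrum_real _ f
  let P : BddSeq E := ofBound (fun k => cfc χ (eval E k R)) 1 (fun k => by
    refine norm_cfc_le zero_le_one fun z _ => ?_
    rcases hχ z with h | h <;> simp [h])
  have hP : ∀ k, eval E k P = cfc χ (eval E k R) := fun k => rfl
  refine ⟨P, ⟨?_, ?_⟩, ?_⟩
  · refine BddSeq.ext fun k => ?_
    rw [map_mul, hP, ← cfc_mul _ _ _ (hc k _) (hc k _)]
    refine cfc_congr fun z _ => ?_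
    rcases hχ z with h | h <;> simp [h]
  · refine BddSeq.ext fun k => ?_
    rw [map_star, hP]
    exact (cfc_predicate χ (eval E k R) : IsSelfAdjoint _)
  · rw [← hR]
    refine mkHom_eq_iff.2 ?_
    have h1 : mkHom E (R * R) = mkHom E R := by
      rw [map_mul]
      change mkStar E R * mkStar E R = mkStar E R
      rw [hR, hq.isIdempotentElem]
    have h2 := (mkHom_eq_iff.1 h1).const_mul 2
    rw [mul_zero] at h2
    refine squeeze_zero (fun k => norm_nonneg _) (fun k => ?_) h2
    change ‖cfc χ (eval E k R) - eval E k R‖ ≤ 2 * ‖eval E k (R * R) - eval E k R‖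
    have e1 : cfc χ (eval E k R) - eval E k R = cfc (fun x => χ x - x) (eval E k R) := by
      rw [cfc_sub _ _ _ (hc k _) (hc k _), cfc_id' ℝ (eval E k R) (hRk k)]
    have e2 : eval E k (R * R) - eval E k R = cfc (fun x : ℝ => x * x - x) (eval E k R) := by
      rw [cfc_sub _ _ _ (hc k _) (hc k _), cfc_mul _ _ _ (hc k _) (hc k _),
        cfc_id' ℝ (eval E k R) (hRk k), map_mul]
    rw [e1, e2]
    refine norm_cfc_le (by positivity) fun x hx => ?_
    have h3 := norm_apply_le_norm_cfc (fun x : ℝ => x * x - x) (eval E k R) hx (hc k _) (hRk k)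
    refine le_trans ?_ (mul_le_mul_of_nonneg_left h3 zero_le_two)
    simp only [Real.norm_eq_abs, χ]
    split_ifs with h
    · have : x * x - x = x * (x - 1) := by ring
      rw [this, abs_mul, abs_sub_comm, abs_of_pos (show 0 < x by linarith)]
      nlinarith [abs_nonneg (x - 1)]
    · have : x * x - x = x * (x - 1) := by ring
      rw [this, abs_mul, abs_sub_comm x 1, abs_of_pos (show 0 < 1 - x by linarith), zero_sub,
        abs_neg]
      nlinarith [abs_nonneg x]

end SeqQuot

theorem exists_strip_functions (σ : Set ℂ) (R : ℕ) (hb : ∀ z ∈ σ, |z.im| ≤ R)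
    (hΛ : ∀ z ∈ σ, ∀ m ∈ Finset.Icc (-(R + 1 : ℤ)) (R + 1), z ≠ ⟨1 / 2, m + 1 / 2⟩) :
    ∃ (S : ℂ → ℝ) (χ : ℤ → ℂ → ℝ), ContinuousOn S σ ∧ (∀ z, 0 ≤ S z ∧ S z ≤ 1) ∧
      (∀ j, ContinuousOn (χ j) σ) ∧ (∀ j z, 0 ≤ χ j z ∧ χ j z ≤ 1) ∧
      (∀ j k z, j ≠ k → χ j z = 0 ∨ χ k z = 0) ∧
      (∀ j z, χ j z ≠ 0 → |z.im - j| ≤ 1 / 2) ∧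
      (∀ z ∈ σ, 0 < S z → S z < 1 → ∃ j ∈ Finset.Icc (-(R + 1 : ℤ)) (R + 1), χ j z = 1) ∧
      (∀ z, 3 / 4 ≤ z.re → S z = 1) ∧ (∀ z, z.re ≤ 1 / 4 → S z = 0) := by
  let d : ℝ → ℝ := fun y => 1 - 2 * |y - round y|
  have hd : Continuous d := by
    have : d = fun y : ℝ => 1 - 2 * ‖(y : UnitAddCircle)‖ := by
      funext y; rw [UnitAddCircle.norm_eq]
    rw [this]
    have h2 : Continuous fun y : ℝ => (y : UnitAddCircle) := AddCircle.continuous_mk' 1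
    fun_prop
  have hd0 : ∀ y, 0 ≤ d y := fun y => by simp only [d]; linarith [abs_sub_round y]
  have hd1 : ∀ y, d y ≤ 1 := fun y => by simp only [d]; linarith [abs_nonneg (y - round y)]
  let den : ℂ → ℝ := fun z => |z.re - 1 / 2| + d z.im
  have hdenc : Continuous den := by fun_prop
  have hden0 : ∀ z, 0 ≤ den z := fun z => add_nonneg (abs_nonneg _) (hd0 _)
  have hround : ∀ z ∈ σ, |(round z.im : ℝ)| ≤ R + 1 / 2 := fun z hz => by
    have h1 := abs_le.1 (hb z hz)
    have h2 := abs_le.1 (abs_sub_round z.im)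
    rw [abs_le]; constructor <;> linarith
  have hmemJ : ∀ m : ℤ, (-(R + 1 : ℝ) ≤ m) → ((m : ℝ) ≤ R + 1) →
      m ∈ Finset.Icc (-(R + 1 : ℤ)) (R + 1) := fun m h1 h2 => by
    rw [Finset.mem_Icc]; constructor
    · exact_mod_cast h1
    · exact_mod_cast h2
  have hden : ∀ z ∈ σ, 0 < den z := fun z hz => by
    refine lt_of_le_of_ne (hden0 z) fun h => ?_
    have h1 : |z.re - 1 / 2| = 0 := by
      have := hd0 z.im; have := abs_nonneg (z.re - 1 / 2); simp only [den] at h; linarith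
    have h2 : d z.im = 0 := by
      have := hd0 z.im; have := abs_nonneg (z.re - 1 / 2); simp only [den] at h; linarith
    have h3 : |z.im - round z.im| = 1 / 2 := by simp only [d] at h2; linarith
    have h4 : z.re = 1 / 2 := by linarith [abs_eq_zero.1 h1]
    have h5 := abs_le.1 (hround z hz)
    have h6 := abs_le.1 (hb z hz)
    rcases abs_eq (by norm_num : (0 : ℝ) ≤ 1 / 2) |>.1 h3 with h | h
    · exact hΛ z hz (round z.im) (hmemJ _ (by linarith) (by linarith))
        (Complex.ext h4 (by simp only; linarith))
    · refine hΛ z hz (round z.im - 1) (hmemJ _ ?_ ?_) (Complex.ext h4 ?_) <;> push_cast <;> linarith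
  let dj : ℤ → ℝ → ℝ := fun j y => max 0 (1 - 2 * |y - j|)
  have hdj0 : ∀ j y, 0 ≤ dj j y := fun j y => le_max_left _ _
  have hdjpos : ∀ j y, dj j y ≠ 0 → |y - j| ≤ 1 / 2 := fun j y h => by
    by_contra h'
    exact h (max_eq_left (by linarith))
  have hdjpos' : ∀ j y, dj j y ≠ 0 → |y - j| < 1 / 2 := fun j y h => by
    by_contra h'
    exact h (max_eq_left (by linarith))
  refine ⟨fun z => max 0 (min 1 (1 / 2 + 5 * (z.re - 1 / 2) / (2 * den z))),
    fun j z => min 1 (2 * dj j z.im / den z), ?_, ?_, ?_, ?_, ?_, ?_, ?_, ?_, ?_⟩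
  · have : ContinuousOn (fun z : ℂ => 5 * (z.re - 1 / 2) / (2 * den z)) σ := by
      refine ContinuousOn.div (by fun_prop) (by fun_prop) fun z hz => ?_
      have := hden z hz; positivity
    fun_prop
  · intro z
    exact ⟨le_max_left _ _, max_le zero_le_one (min_le_left _ _)⟩
  · intro j
    have : ContinuousOn (fun z : ℂ => 2 * dj j z.im / den z) σ := by
      refine ContinuousOn.div (by fun_prop) (by fun_prop) fun z hz => ?_
      have := hden z hz; positivity
    fun_prop
  · intro j z
    exact ⟨le_min zero_le_one (div_nonneg (mul_nonneg zero_le_two (hdj0 _ _)) (hden0 z)),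
      min_le_left _ _⟩
  · intro j k z hjk
    by_contra! h
    have h1 := hdjpos' j z.im (fun h' => h.1 (by simp [h']))
    have h2 := hdjpos' k z.im (fun h' => h.2 (by simp [h']))
    rw [abs_lt] at h1 h2
    apply hjk
    have h3 : (j : ℝ) < k + 1 := by linarith
    have h4 : (k : ℝ) < j + 1 := by linarith
    have h3' : j < k + 1 := by exact_mod_cast h3
    have h4' : k < j + 1 := by exact_mod_cast h4
    omega
  · intro j z h
    exact hdjpos j z.im (fun h' => h (by simp [h']))
  · intro z hz h0 h1
    have hdz := hden z hz
    have a0 : 0 < 1 / 2 + 5 * (z.re - 1 / 2) / (2 * den z) := by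
      by_contra! h
      exact h0.ne' (max_eq_left ((min_le_right _ _).trans h))
    have a1 : 1 / 2 + 5 * (z.re - 1 / 2) / (2 * den z) < 1 := by
      by_contra! h
      exact h1.ne (by simp only; rw [min_eq_left h]; simp)
    have b0 : -(den z) < 5 * (z.re - 1 / 2) := by
      have : -(1 / 2) < 5 * (z.re - 1 / 2) / (2 * den z) := by linarith
      rw [lt_div_iff₀ (by positivity)] at this
      linarith
    have b1 : 5 * (z.re - 1 / 2) < den z := by
      have : 5 * (z.re - 1 / 2) / (2 * den z) < 1 / 2 := by linarith
      rw [div_lt_iff₀ (by positivity)] at this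
      linarith
    have b2 : |5 * (z.re - 1 / 2)| < den z := abs_lt.2 ⟨b0, b1⟩
    rw [abs_mul, abs_of_pos (by norm_num : (0 : ℝ) < 5)] at b2
    have h5 := abs_le.1 (hround z hz)
    refine ⟨round z.im, hmemJ _ (by linarith) (by linarith), min_eq_left ?_⟩
    rw [le_div_iff₀ hdz, one_mul]
    have : dj (round z.im) z.im = d z.im := max_eq_right (hd0 z.im)
    rw [this]
    simp only [den] at b2 ⊢
    linarith
  · intro z hz
    have h1 : 1 ≤ 1 / 2 + 5 * (z.re - 1 / 2) / (2 * den z) := by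
      have hp : 0 < den z := by
        have := hd0 z.im
        simp only [den]; rw [abs_of_pos (by linarith)]; linarith
      have : 1 / 2 ≤ 5 * (z.re - 1 / 2) / (2 * den z) := by
        rw [le_div_iff₀ (by positivity)]
        have := hd1 z.im
        simp only [den]; rw [abs_of_pos (by linarith)]; linarith
      linarith
    simp only
    rw [min_eq_left h1]; simp
  · intro z hz
    have h1 : 1 / 2 + 5 * (z.re - 1 / 2) / (2 * den z) ≤ 0 := by
      have hp : 0 < den z := by
        have := hd0 z.im
        simp only [den]; rw [abs_of_neg (by linarith)]; linarith
      have : 5 * (z.re - 1 / 2) / (2 * den z) ≤ -(1 / 2) := by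
        rw [div_le_iff₀ (by positivity)]
        have := hd1 z.im
        simp only [den]; rw [abs_of_neg (by linarith)]; linarith
      linarith
    exact max_eq_left ((min_le_right _ _).trans h1)

/-- A cutoff function on the circle supported in the left half plane. -/
def leftCutoff (v : ℂ) : ℝ := max 0 (min 1 (-2 * v.re))

theorem continuous_leftCutoff : Continuous leftCutoff := by
  unfold leftCutoff; fun_prop

theorem leftCutoff_one : leftCutoff 1 = 0 := by norm_num [leftCutoff]

theorem leftCutoff_neg_one : leftCutoff (-1) = 1 := by norm_num [leftCutoff]

/-- The indicator function of the open lower half plane. -/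
def lowerIndicator (v : ℂ) : ℝ := if v.im < 0 then 1 else 0

theorem continuousOn_leftCutoff_mul_lowerIndicator :
    ContinuousOn (fun v => (leftCutoff v - leftCutoff v ^ 2) * lowerIndicator v)
      (Metric.sphere 0 1) := by
  rw [continuousOn_iff_continuous_domRestrict]
  have : (Metric.sphere (0 : ℂ) 1).domRestrict
      (fun v => (leftCutoff v - leftCutoff v ^ 2) * lowerIndicator v) =
      fun v : Metric.sphere (0 : ℂ) 1 =>
        if 0 ≤ (v : ℂ).im then 0 else leftCutoff v - leftCutoff v ^ 2 := by
    funext v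
    simp only [Set.domRestrict_apply, lowerIndicator]
    by_cases h : 0 ≤ (v : ℂ).im
    · simp [h, not_lt.2 h]
    · simp [h, not_le.1 h]
  rw [this]
  refine Continuous.if_le continuous_const ?_ continuous_const
    (Complex.continuous_im.comp continuous_subtype_val) ?_
  · have := continuous_leftCutoff.comp (continuous_subtype_val (p := (· ∈ Metric.sphere (0 : ℂ) 1)))
    exact this.sub (this.pow 2)
  · rintro ⟨v, hv⟩ h
    simp only at h ⊢
    have h1 : v.re * v.re + v.im * v.im = 1 := by
      have h2 := Complex.normSq_eq_norm_sq v
      rw [mem_sphere_zero_iff_norm.1 hv, Complex.normSq_apply] at h2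
      linarith
    rw [← h] at h1
    have h3 : v.re = 1 ∨ v.re = -1 := by
      rw [← mul_self_eq_one_iff]; linarith
    rcases h3 with h3 | h3
    · norm_num [leftCutoff, h3]
    · norm_num [leftCutoff, h3]

/-- The standard loop around the circle. -/
def circleLoop (s : ℝ) : ℂ := Complex.exp (2 * Real.pi * s * Complex.I)

theorem circleLoop_eq (s : ℝ) : circleLoop s = Complex.exp ((2 * Real.pi * s : ℝ) * Complex.I) := by
  simp [circleLoop]

theorem continuous_circleLoop : Continuous circleLoop := by unfold circleLoop; fun_prop

theorem circleLoop_im (s : ℝ) : (circleLoop s).im = Real.sin (2 * Real.pi * s) := by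
  rw [circleLoop_eq, Complex.exp_ofReal_mul_I_im]

theorem norm_circleLoop (s : ℝ) : ‖circleLoop s‖ = 1 := by
  rw [circleLoop_eq, Complex.norm_exp_ofReal_mul_I]

theorem circleLoop_zero : circleLoop 0 = 1 := by simp [circleLoop]

theorem circleLoop_one : circleLoop 1 = 1 := by
  simp [circleLoop]

theorem circleLoop_half : circleLoop (1 / 2) = -1 := by
  rw [circleLoop_eq, show (2 * Real.pi * (1 / 2) : ℝ) = Real.pi by ring, Complex.exp_pi_mul_I]

theorem lowerIndicator_circleLoop {s : ℝ} (h0 : 0 < s) (h1 : s < 1) :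
    lowerIndicator (circleLoop s) = if s ≤ 1 / 2 then 0 else 1 := by
  rw [lowerIndicator, circleLoop_im]
  have hpi := Real.pi_pos
  split_ifs with h h' h'
  · exact absurd h (not_lt.2 (Real.sin_nonneg_of_nonneg_of_le_pi (by positivity) (by nlinarith)))
  · rfl
  · rfl
  · refine absurd ?_ h
    have : 2 * Real.pi * s = (2 * Real.pi * s - 2 * Real.pi) + 2 * Real.pi := by ring
    rw [this, Real.sin_add_two_pi]
    exact Real.sin_neg_of_neg_of_neg_pi_lt (by nlinarith) (by nlinarith)

/-- The complementary cutoff on the second half of the loop. -/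
def upperPart (s : ℝ) : ℝ := if s ≤ 1 / 2 then 0 else 1 - leftCutoff (circleLoop s)

theorem continuous_upperPart : Continuous upperPart := by
  unfold upperPart
  refine Continuous.if_le continuous_const ?_ continuous_id continuous_const ?_
  · exact continuous_const.sub (continuous_leftCutoff.comp continuous_circleLoop)
  · intro s hs
    change s = 1 / 2 at hs
    rw [hs, circleLoop_half, leftCutoff_neg_one, sub_self]

theorem exists_loop_functions (σ : Set ℂ) (R : ℕ) (hb : ∀ z ∈ σ, |z.im| ≤ R)
    (hΛ : ∀ z ∈ σ, ∀ m ∈ Finset.Icc (-(R + 1 : ℤ)) (R + 1), z ≠ ⟨1 / 2, m + 1 / 2⟩) :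
    ∃ (V : ℤ → ℂ → ℂ) (Φ γ : ℂ → ℝ), (∀ j, ContinuousOn (V j) σ) ∧
      (∀ j, ∀ z ∈ σ, ‖V j z‖ = 1) ∧ ContinuousOn Φ σ ∧ ContinuousOn γ σ ∧
      (∀ j, ∀ z ∈ σ, (leftCutoff (V j z) - leftCutoff (V j z) ^ 2) * lowerIndicator (V j z) =
        Φ z * leftCutoff (V j z)) ∧
      (∀ z ∈ σ, Φ z ^ 2 +
        ∑ j ∈ Finset.Icc (-(R + 1 : ℤ)) (R + 1), Φ z * leftCutoff (V j z) = Φ z) ∧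
      (∀ j k, j ≠ k → ∀ z ∈ σ, leftCutoff (V j z) * leftCutoff (V k z) = 0) ∧
      (∀ z ∈ σ, |γ z - z.im| ≤ 1 / 2) ∧
      (∀ j ∈ Finset.Icc (-(R + 1 : ℤ)) (R + 1), ∀ z ∈ σ,
        γ z * leftCutoff (V j z) = j * leftCutoff (V j z)) ∧
      (∀ z ∈ σ, 3 / 4 ≤ z.re → Φ z = 1 ∧ ∀ j, leftCutoff (V j z) = 0) ∧
      (∀ z ∈ σ, z.re ≤ 1 / 4 → Φ z = 0 ∧ ∀ j, leftCutoff (V j z) = 0) := by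
  obtain ⟨S, χ, hSc, hS01, hχc, hχ01, hχd, hχs, hex, hS1, hS0⟩ := exists_strip_functions σ R hb hΛ
  set J := Finset.Icc (-(R + 1 : ℤ)) (R + 1) with hJ
  let V : ℤ → ℂ → ℂ := fun j z => 1 + (circleLoop (S z) - 1) * χ j z
  have hends : ∀ z, S z = 0 ∨ S z = 1 → circleLoop (S z) = 1 := by
    rintro z (h | h) <;> rw [h]
    · exact circleLoop_zero
    · exact circleLoop_one
  have hVends : ∀ z, S z = 0 ∨ S z = 1 → ∀ j, V j z = 1 := fun z h j => by
    simp [V, hends z h]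
  have hZends : ∀ z, S z = 0 ∨ S z = 1 → ∀ j, leftCutoff (V j z) = 0 := fun z h j => by
    rw [hVends z h j, leftCutoff_one]
  have hcases : ∀ z ∈ σ, (S z = 0 ∨ S z = 1) ∨ (0 < S z ∧ S z < 1 ∧ ∃ j ∈ J, χ j z = 1 ∧
      V j z = circleLoop (S z) ∧ ∀ k, k ≠ j → χ k z = 0 ∧ V k z = 1) := fun z hz => by
    rcases (hS01 z).1.eq_or_lt with h0 | h0
    · exact .inl (.inl h0.symm)
    rcases (hS01 z).2.eq_or_lt with h1 | h1
    · exact .inl (.inr h1)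
    obtain ⟨j, hj, hj1⟩ := hex z hz h0 h1
    refine .inr ⟨h0, h1, j, hj, hj1, by simp [V, hj1], fun k hk => ?_⟩
    have : χ k z = 0 := (hχd k j z hk).resolve_right (by rw [hj1]; exact one_ne_zero)
    exact ⟨this, by simp [V, this]⟩
  refine ⟨V, fun z => upperPart (S z), fun z => z.im + ∑ j ∈ J, (j - z.im) * χ j z,
    ?_, ?_, ?_, ?_, ?_, ?_, ?_, ?_, ?_, ?_, ?_⟩
  · intro j
    have h1 : ContinuousOn (fun z => circleLoop (S z)) σ := continuous_circleLoop.comp_continuousOn hSc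
    have h2 : ContinuousOn (fun z => (χ j z : ℂ)) σ :=
      Complex.continuous_ofReal.comp_continuousOn (hχc j)
    exact continuousOn_const.add ((h1.sub continuousOn_const).mul h2)
  · intro j z hz
    rcases hcases z hz with h | ⟨-, -, i, -, -, hV, hk⟩
    · rw [hVends z h, norm_one]
    · by_cases hji : j = i
      · rw [hji, hV, norm_circleLoop]
      · rw [(hk j hji).2, norm_one]
  · exact continuous_upperPart.comp_continuousOn hSc
  · refine Complex.continuous_im.continuousOn.add (continuousOn_finsetSum _ fun j _ => ?_)
    exact (continuousOn_const.sub Complex.continuous_im.continuousOn).mul (hχc j)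
  · intro j z hz
    rcases hcases z hz with h | ⟨h0, h1, i, -, -, hV, hk⟩
    · simp [hZends z h]
    · by_cases hji : j = i
      · beta_reduce
        rw [hji, hV, lowerIndicator_circleLoop h0 h1, upperPart]
        split_ifs
        · ring
        · ring
      · simp [(hk j hji).2, leftCutoff_one]
  · intro z hz
    rcases hcases z hz with h | ⟨h0, h1, i, hi, -, hV, hk⟩
    · simp only [hZends z h, mul_zero, Finset.sum_const_zero, add_zero]
      rcases h with h | h
      · rw [h]; norm_num [upperPart]
      · rw [h]; norm_num [upperPart, circleLoop_one, leftCutoff_one]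
    · beta_reduce
      rw [Finset.sum_eq_single i, hV, upperPart]
      · split_ifs
        · ring
        · ring
      · intro k _ hki
        rw [(hk k hki).2, leftCutoff_one, mul_zero]
      · exact fun h => absurd hi h
  · intro j k hjk z hz
    rcases hcases z hz with h | ⟨-, -, i, -, -, hV, hk⟩
    · simp [hZends z h]
    · by_cases hji : j = i
      · rw [(hk k (by rintro rfl; exact hjk hji)).2, leftCutoff_one, mul_zero]
      · rw [(hk j hji).2, leftCutoff_one, zero_mul]
  · intro z hz
    rw [add_sub_cancel_left]
    by_cases h : ∃ i ∈ J, χ i z ≠ 0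
    · obtain ⟨i, hi, hi0⟩ := h
      rw [Finset.sum_eq_single i]
      · rw [abs_mul, abs_of_nonneg (hχ01 i z).1, abs_sub_comm]
        nlinarith [hχs i z hi0, (hχ01 i z).1, (hχ01 i z).2, abs_nonneg (z.im - i)]
      · intro k _ hki
        rw [(hχd k i z hki).resolve_right hi0, mul_zero]
      · exact fun h => absurd hi h
    · push Not at h
      rw [Finset.sum_eq_zero fun i hi => by rw [h i hi, mul_zero]]
      norm_num
  · intro j hj z hz
    rcases hcases z hz with h | ⟨-, -, i, hi, hi1, hV, hk⟩
    · simp [hZends z h]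
    · by_cases hji : j = i
      · subst hji
        beta_reduce
        rw [Finset.sum_eq_single j, hi1]
        · ring
        · intro k _ hki
          rw [(hk k hki).1, mul_zero]
        · exact fun h => absurd hi h
      · simp [(hk j hji).2, leftCutoff_one]
  · intro z hz h
    refine ⟨?_, hZends z (.inr (hS1 z h))⟩
    simp only [hS1 z h]
    norm_num [upperPart, circleLoop_one, leftCutoff_one]
  · intro z hz h
    refine ⟨?_, hZends z (.inl (hS0 z h))⟩
    simp only [hS0 z h]
    norm_num [upperPart]

section Perturbation
variable {A : Type*} [CStarAlgebra A]

/-- Every element factors as a unitary times its absolute value. -/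
def HasPolarDecompositions (A : Type*) [CStarAlgebra A] : Prop :=
  ∀ z : A, ∃ w ∈ unitary A, z = w * cfc Real.sqrt (star z * z)

/-- Unitaries have projections playing the role of discontinuous functional calculus. -/
def HasSpectralProjections (A : Type*) [CStarAlgebra A] : Prop :=
  ∀ v ∈ unitary A, ∀ χ : ℂ → ℂ, (∀ z, χ z = 0 ∨ χ z = 1) →
    ∃ p : A, IsStarProjection p ∧ ∀ f : ℂ → ℂ, Continuous f → Commute (cfc f v) p ∧
      (ContinuousOn (fun z => f z * χ z) (Metric.sphere 0 1) →
        cfc f v * p = cfc (fun z => f z * χ z) v)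

theorem HasPolarDecompositions.exists_notMem_spectrum (hpol : HasPolarDecompositions A) (t : A)
    [ht : IsStarNormal t] (μ : ℂ) {r : ℝ} (hr : 0 < r) :
    ∃ t' : A, IsStarNormal t' ∧ ‖t' - t‖ ≤ r * ‖(1 : A)‖ ∧ μ ∉ spectrum ℂ t' := by
  set x : A := t - algebraMap ℂ A μ with hx
  have hxn : star x * x = x * star x := by
    have h1 : Commute t (algebraMap ℂ A (star μ)) := Algebra.commute_algebraMap_right _ _
    have h2 : Commute (star t) (algebraMap ℂ A μ) := Algebra.commute_algebraMap_right _ _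
    have h3 : Commute (algebraMap ℂ A μ) (algebraMap ℂ A (star μ)) :=
      Algebra.commute_algebraMap_right _ _
    rw [hx, star_sub, ← algebraMap_star_comm, sub_mul, mul_sub, mul_sub, sub_mul, mul_sub, mul_sub,
      ht.star_comm_self.eq, h1.eq, h2.eq, h3.eq]
    abel
  obtain ⟨w, hw, hxw⟩ := hpol x
  set h := cfc Real.sqrt (star x * x) with hh
  have hsa : IsSelfAdjoint h := cfc_predicate _ _
  have hmul : h * h = star x * x := cfc_sqrt_mul_self x
  have hwx : Commute (star x * x) w := by
    have h1 : x * star x = w * (h * h) * star w := by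
      conv_lhs => rw [hxw, star_mul, hsa.star_eq]
      simp only [mul_assoc]
    have h2 := (Unitary.mem_iff.1 hw).1
    calc star x * x * w = w * (h * h) * star w * w := by rw [hxn, h1]
      _ = w * (star x * x) := by rw [mul_assoc, h2, mul_one, hmul]
  have hwh : Commute h w := IsSelfAdjoint.commute_cfc (IsSelfAdjoint.star_mul_self x) hwx _
  have hwh' : Commute h (star w) := by
    have := hwh.star_star
    rwa [hsa.star_eq] at this
  set h' : A := h + algebraMap ℝ A r with hh'
  have hcomm : Commute h' w := hwh.add_left (Algebra.commute_algebraMap_left _ _)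
  have hsa' : IsSelfAdjoint h' := hsa.add (IsSelfAdjoint.algebraMap A (.all r))
  have hcomm' : Commute h' (star w) := by
    have := hcomm.star_star
    rwa [hsa'.star_eq] at this
  have hu : IsUnit h' := by
    have : h' = cfc (fun s => Real.sqrt s + r) (star x * x) := by
      rw [cfc_add_const r Real.sqrt (star x * x) Real.continuous_sqrt.continuousOn
        (IsSelfAdjoint.star_mul_self x)]
    rw [this, isUnit_cfc_iff _ _ (by fun_prop) (IsSelfAdjoint.star_mul_self x)]
    intro s _
    positivity
  have hww := Unitary.mem_iff.1 hw
  have huw : IsUnit w := ⟨⟨w, star w, hww.2, hww.1⟩, rfl⟩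
  refine ⟨algebraMap ℂ A μ + w * h', ⟨?_⟩, ?_, ?_⟩
  · have h1 : Commute (star (w * h')) (w * h') := by
      show star (w * h') * (w * h') = w * h' * star (w * h')
      rw [star_mul, hsa'.star_eq]
      calc h' * star w * (w * h') = h' * (star w * w) * h' := by simp only [mul_assoc]
        _ = h' * h' := by rw [hww.1, mul_one]
        _ = h' * h' * (w * star w) := by rw [hww.2, mul_one]
        _ = w * h' * (h' * star w) := by
            rw [← mul_assoc, mul_assoc h', hcomm.eq, ← mul_assoc h', hcomm.eq]
            simp only [mul_assoc]
    rw [star_add, ← algebraMap_star_comm]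
    exact ((Algebra.commute_algebraMap_left _ _).add_right (Algebra.commute_algebraMap_left _ _)).add_left
      ((Algebra.commute_algebraMap_right _ _).add_right h1)
  · have : algebraMap ℂ A μ + w * h' - t = w * algebraMap ℝ A r := by
      have : t = algebraMap ℂ A μ + w * h := by rw [← hxw, hx]; abel
      rw [this, hh', mul_add]; abel
    rw [this, CStarRing.norm_mem_unitary_mul _ hw, norm_algebraMap, Real.norm_of_nonneg hr.le]
  · rw [spectrum.notMem_iff, sub_add_cancel_left]
    exact (huw.mul hu).neg

theorem HasPolarDecompositions.exists_forall_notMem_spectrum (hpol : HasPolarDecompositions A)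
    (t : A) [ht : IsStarNormal t] (Λ : Finset ℂ) {ε : ℝ} (hε : 0 < ε) :
    ∃ t' : A, IsStarNormal t' ∧ ‖t' - t‖ < ε ∧ ∀ μ ∈ Λ, μ ∉ spectrum ℂ t' := by
  induction Λ using Finset.induction_on generalizing ε with
  | empty => exact ⟨t, ht, by simpa using hε, by simp⟩
  | insert ν Λ _ ih =>
    obtain ⟨t₁, hn, ht₁, hΛ⟩ := ih (half_pos hε)
    have hopen : IsOpen (⋂ μ ∈ Λ, {u : A | IsUnit (algebraMap ℂ A μ - u)}) :=
      isOpen_biInter_finset fun μ _ => Units.isOpen.preimage (continuous_const.sub continuous_id)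
    have hmem : t₁ ∈ ⋂ μ ∈ Λ, {u : A | IsUnit (algebraMap ℂ A μ - u)} := by
      simp only [Set.mem_iInter]
      exact fun μ hμ => spectrum.notMem_iff.1 (hΛ μ hμ)
    obtain ⟨d, hd, hball⟩ := Metric.isOpen_iff.1 hopen t₁ hmem
    set N := ‖(1 : A)‖ with hN
    have hN0 : 0 ≤ N := norm_nonneg _
    set m := min (ε / 2) d with hm
    have hm0 : 0 < m := lt_min (half_pos hε) hd
    obtain ⟨t₂, hn₂, ht₂, hν⟩ := hpol.exists_notMem_spectrum t₁ ν (r := m / (N + 1)) (by positivity)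
    have hlt : ‖t₂ - t₁‖ < m := by
      refine ht₂.trans_lt ?_
      rw [div_mul_eq_mul_div, div_lt_iff₀ (by positivity)]
      nlinarith
    refine ⟨t₂, hn₂, ?_, ?_⟩
    · calc ‖t₂ - t‖ ≤ ‖t₂ - t₁‖ + ‖t₁ - t‖ := norm_sub_le_norm_sub_add_norm_sub _ _ _
        _ < ε / 2 + ε / 2 := add_lt_add (hlt.trans_le (min_le_left _ _)) ht₁
        _ = ε := by ring
    · intro μ hμ
      rcases Finset.mem_insert.1 hμ with rfl | hμ
      · exact hν
      · have : t₂ ∈ Metric.ball t₁ d := by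
          rw [mem_ball_iff_norm]; exact hlt.trans_le (min_le_right _ _)
        have := hball this
        simp only [Set.mem_iInter] at this
        exact spectrum.notMem_iff.2 (this μ hμ)
end Perturbation

section CommutingProjection
variable {A : Type*} [CStarAlgebra A]

/-- Continuous functional calculus of a normal element, for real functions of a complex variable. -/
def rcfc (f : ℂ → ℝ) (t : A) : A := cfc (fun z => (f z : ℂ)) t

theorem rcfc_isSelfAdjoint (f : ℂ → ℝ) (t : A) : IsSelfAdjoint (rcfc f t) := by
  rw [IsSelfAdjoint, rcfc, ← cfc_star]
  simp

theorem rcfc_commute (f g : ℂ → ℝ) (t : A) : Commute (rcfc f t) (rcfc g t) := cfc_commute_cfc _ _ _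

theorem rcfc_congr {f g : ℂ → ℝ} {t : A} (h : ∀ z ∈ spectrum ℂ t, f z = g z) :
    rcfc f t = rcfc g t := cfc_congr fun z hz => by simp [h z hz]

theorem continuousOn_ofReal {f : ℂ → ℝ} {s : Set ℂ} (h : ContinuousOn f s) :
    ContinuousOn (fun z => (f z : ℂ)) s := Complex.continuous_ofReal.comp_continuousOn h

theorem rcfc_mul {f g : ℂ → ℝ} {t : A} (hf : ContinuousOn f (spectrum ℂ t))
    (hg : ContinuousOn g (spectrum ℂ t)) : rcfc (fun z => f z * g z) t = rcfc f t * rcfc g t := by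
  simp only [rcfc, Complex.ofReal_mul]
  exact cfc_mul _ _ t (continuousOn_ofReal hf) (continuousOn_ofReal hg)

theorem rcfc_add {f g : ℂ → ℝ} {t : A} (hf : ContinuousOn f (spectrum ℂ t))
    (hg : ContinuousOn g (spectrum ℂ t)) : rcfc (fun z => f z + g z) t = rcfc f t + rcfc g t := by
  simp only [rcfc, Complex.ofReal_add]
  exact cfc_add (p := IsStarNormal) t _ _ (continuousOn_ofReal hf) (continuousOn_ofReal hg)

theorem rcfc_sub {f g : ℂ → ℝ} {t : A} (hf : ContinuousOn f (spectrum ℂ t))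
    (hg : ContinuousOn g (spectrum ℂ t)) : rcfc (fun z => f z - g z) t = rcfc f t - rcfc g t := by
  simp only [rcfc, Complex.ofReal_sub]
  exact cfc_sub (p := IsStarNormal) _ _ t (continuousOn_ofReal hf) (continuousOn_ofReal hg)

theorem rcfc_one (t : A) [IsStarNormal t] : rcfc (fun _ => 1) t = 1 := by
  simp only [rcfc, Complex.ofReal_one]
  exact cfc_const_one ℂ t

theorem rcfc_zero (t : A) : rcfc (fun _ => 0) t = 0 := by
  simp only [rcfc, Complex.ofReal_zero]
  exact cfc_const_zero ℂ t

theorem rcfc_const_mul (c : ℝ) {f : ℂ → ℝ} {t : A} (hf : ContinuousOn f (spectrum ℂ t)) :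
    rcfc (fun z => c * f z) t = (c : ℂ) • rcfc f t := by
  simp only [rcfc, Complex.ofReal_mul]
  exact cfc_const_mul _ _ t (continuousOn_ofReal hf)

theorem norm_rcfc_le {f : ℂ → ℝ} {t : A} {c : ℝ} (hc : 0 ≤ c)
    (h : ∀ z ∈ spectrum ℂ t, |f z| ≤ c) : ‖rcfc f t‖ ≤ c :=
  norm_cfc_le hc fun z hz => by simpa using h z hz

theorem rcfc_re (t : A) [IsStarNormal t] :
    rcfc Complex.re t = (1 / 2 : ℂ) • (t + star t) := by
  have h : ∀ z : ℂ, ((z.re : ℝ) : ℂ) = (1 / 2 : ℂ) * (z + star z) := fun z => by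
    rw [Complex.re_eq_add_conj]; simp; ring
  simp only [rcfc, h]
  rw [cfc_const_mul (1 / 2 : ℂ) (fun z : ℂ => z + star z) t (by fun_prop),
    cfc_add (p := IsStarNormal) t (fun z : ℂ => z) (fun z : ℂ => star z) (by fun_prop) (by fun_prop),
    cfc_star, cfc_id' ℂ t]

theorem rcfc_im (t : A) [IsStarNormal t] :
    rcfc Complex.im t = (-Complex.I / 2 : ℂ) • (t - star t) := by
  have h : ∀ z : ℂ, ((z.im : ℝ) : ℂ) = (-Complex.I / 2 : ℂ) * (z - star z) := fun z => by
    rw [Complex.im_eq_sub_conj]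
    simp only [RCLike.star_def]
    field_simp
    rw [Complex.I_sq]; ring
  simp only [rcfc, h]
  rw [cfc_const_mul (-Complex.I / 2 : ℂ) (fun z : ℂ => z - star z) t (by fun_prop),
    cfc_sub (p := IsStarNormal) (fun z : ℂ => z) (fun z : ℂ => star z) t (by fun_prop) (by fun_prop),
    cfc_star, cfc_id' ℂ t]

theorem norm_rcfc_re_sub_le {a g t : A} [IsStarNormal t] (ha : IsSelfAdjoint a)
    (hg : IsSelfAdjoint g) : ‖rcfc Complex.re t - a‖ ≤ ‖t - (a + Complex.I • g)‖ := by
  set d := t - (a + Complex.I • g) with hd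
  have ht : t = d + (a + Complex.I • g) := by rw [hd]; abel
  have h : rcfc Complex.re t - a = (1 / 2 : ℂ) • (d + star d) := by
    rw [rcfc_re, ht]
    simp only [star_add, star_smul, ha.star_eq, hg.star_eq, RCLike.star_def, Complex.conj_I]
    module
  rw [h, norm_smul]
  have := norm_add_le d (star d)
  rw [norm_star] at this
  norm_num
  linarith

theorem norm_rcfc_im_sub_le {a g t : A} [IsStarNormal t] (ha : IsSelfAdjoint a)
    (hg : IsSelfAdjoint g) : ‖rcfc Complex.im t - g‖ ≤ ‖t - (a + Complex.I • g)‖ := by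
  set d := t - (a + Complex.I • g) with hd
  have ht : t = d + (a + Complex.I • g) := by rw [hd]; abel
  have h : rcfc Complex.im t - g = (-Complex.I / 2 : ℂ) • (d - star d) := by
    rw [rcfc_im, ht]
    simp only [star_add, star_smul, ha.star_eq, hg.star_eq, RCLike.star_def, Complex.conj_I]
    match_scalars <;> (ring_nf; try norm_num [Complex.I_sq])
  rw [h, norm_smul]
  have := norm_sub_le d (star d)
  rw [norm_star] at this
  norm_num
  linarith

theorem isStarProjection_add_sum {ι : Type*} {J : Finset ι} {φ : A} {ζ p : ι → A}
    (hφ : IsSelfAdjoint φ) (hζ : ∀ j, IsSelfAdjoint (ζ j)) (hp : ∀ j, IsStarProjection (p j))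
    (hζp : ∀ j, Commute (ζ j) (p j)) (hφζ : ∀ j, Commute φ (ζ j))
    (hcut : ∀ j, (ζ j - ζ j * ζ j) * p j = φ * ζ j) (hort : ∀ j k, j ≠ k → ζ j * ζ k = 0)
    (hsum : φ * φ + ∑ j ∈ J, φ * ζ j = φ) :
    IsStarProjection (φ + ∑ j ∈ J, ζ j * p j) := by
  classical
  have hpp : ∀ j, p j * p j = p j := fun j => (hp j).isIdempotentElem
  have h1 : ∀ j, φ * (ζ j * p j) = φ * ζ j := fun j => by
    rw [← mul_assoc, ← hcut, mul_assoc, hpp]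
  have h2 : ∀ j, ζ j * p j * φ = φ * ζ j := fun j => by
    have hc : Commute (ζ j - ζ j * ζ j) (p j) := (hζp j).sub_left ((hζp j).mul_left (hζp j))
    rw [(hζp j).eq, mul_assoc, ← (hφζ j).eq, ← hcut, ← mul_assoc, ← hc.eq, mul_assoc, hpp]
  have h3 : ∀ j k, j ≠ k → ζ j * p j * (ζ k * p k) = 0 := fun j k hjk => by
    rw [(hζp j).eq, mul_assoc, ← mul_assoc (ζ j), hort j k hjk, zero_mul, mul_zero]
  have h4 : ∀ j, ζ j * p j * (ζ j * p j) = ζ j * p j - φ * ζ j := fun j => by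
    rw [← hcut, sub_mul, sub_sub_cancel, mul_assoc, ← mul_assoc (p j), ← (hζp j).eq, mul_assoc, hpp,
      mul_assoc]
  have h5 : (∑ j ∈ J, ζ j * p j) * (∑ j ∈ J, ζ j * p j) =
      ∑ j ∈ J, ζ j * p j - ∑ j ∈ J, φ * ζ j := by
    rw [Finset.sum_mul_sum, ← Finset.sum_sub_distrib]
    refine Finset.sum_congr rfl fun j hj => ?_
    rw [Finset.sum_eq_single_of_mem j hj fun k _ hk => h3 j k hk.symm, h4]
  refine ⟨?_, ?_⟩
  · show (φ + ∑ j ∈ J, ζ j * p j) * (φ + ∑ j ∈ J, ζ j * p j) = φ + ∑ j ∈ J, ζ j * p j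
    rw [mul_add, add_mul, add_mul, h5, Finset.sum_mul, Finset.mul_sum, Finset.sum_congr rfl fun j _ => h1 j,
      Finset.sum_congr rfl fun j _ => h2 j]
    conv_rhs => rw [← hsum]
    abel
  · rw [IsSelfAdjoint, star_add, star_sum, hφ.star_eq]
    congr 1
    refine Finset.sum_congr rfl fun j _ => ?_
    rw [star_mul, (hζ j).star_eq, (hp j).isSelfAdjoint.star_eq, (hζp j).eq]

/-- The distance to `1` relative to a cutoff at `3 / 4`. -/
def upperWeight (x : ℝ) : ℝ := 1 / max (1 - x) (1 / 4)

theorem continuous_upperWeight : Continuous upperWeight := by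
  refine continuous_const.div (by fun_prop) fun x => ?_
  have : (1 / 4 : ℝ) ≤ max (1 - x) (1 / 4) := le_max_right _ _
  linarith

theorem abs_upperWeight_le (x : ℝ) : |upperWeight x| ≤ 4 := by
  have : (1 / 4 : ℝ) ≤ max (1 - x) (1 / 4) := le_max_right _ _
  rw [upperWeight, abs_of_nonneg (by positivity), div_le_iff₀ (by linarith)]
  linarith

theorem upperWeight_mul {x : ℝ} (hx : x ≤ 3 / 4) : 1 - upperWeight x * (1 - x) = 0 := by
  rw [upperWeight, max_eq_left (by linarith)]
  have : 1 - x ≠ 0 := by linarith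
  field_simp
  ring

theorem norm_commutator_le_of_commute {q g y : A} (hq : ‖q‖ ≤ 1) (h : Commute q y) :
    ‖q * g - g * q‖ ≤ 2 * ‖g - y‖ := by
  have : q * g - g * q = q * (g - y) - (g - y) * q := by
    rw [mul_sub, sub_mul, h.eq]; abel
  rw [this]
  refine (norm_sub_le _ _).trans ?_
  have h1 := norm_mul_le q (g - y)
  have h2 := norm_mul_le (g - y) q
  nlinarith [norm_nonneg (g - y)]

theorem exists_projection_of_commute (hpol : HasPolarDecompositions A)
    (hproj : HasSpectralProjections A) {a g : A} (ha : IsSelfAdjoint a) (hg : IsSelfAdjoint g)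
    (hag : Commute a g) {ε : ℝ} (hε : 0 < ε) (hε1 : ε ≤ 1) :
    ∃ q : A, IsStarProjection q ∧ ‖q * g - g * q‖ ≤ 1 + 2 * ε ∧
      (∀ e : A, ‖e‖ ≤ 1 → a * e = e → ‖(1 - q) * e‖ ≤ 4 * ε) ∧
      (∀ e : A, ‖e‖ ≤ 1 → a * e = 0 → ‖q * e‖ ≤ 4 * ε) := by
  have htn : IsStarNormal (a + Complex.I • g) := by
    constructor
    have h1 : Commute g a := hag.symm
    rw [star_add, star_smul, ha.star_eq, hg.star_eq]
    exact ((Commute.refl a).add_right (hag.smul_right _)).add_left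
      ((h1.smul_left _).add_right (((Commute.refl g).smul_left _).smul_right _))
  obtain ⟨R, hR⟩ := exists_nat_ge ((‖a + Complex.I • g‖ + 1) * ‖(1 : A)‖)
  obtain ⟨t, ht, htε, htΛ⟩ := hpol.exists_forall_notMem_spectrum (a + Complex.I • g)
    ((Finset.Icc (-(R + 1 : ℤ)) (R + 1)).image fun m : ℤ => (⟨1 / 2, m + 1 / 2⟩ : ℂ)) hε
  have hb : ∀ z ∈ spectrum ℂ t, |z.im| ≤ R := fun z hz => by
    have h1 := spectrum.norm_le_norm_mul_of_mem hz
    have h2 : ‖t‖ ≤ ‖a + Complex.I • g‖ + 1 := by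
      have := norm_le_norm_add_norm_sub' t (a + Complex.I • g)
      linarith
    exact (Complex.abs_im_le_norm z).trans (h1.trans
      ((mul_le_mul_of_nonneg_right h2 (norm_nonneg _)).trans hR))
  have hΛ : ∀ z ∈ spectrum ℂ t, ∀ m ∈ Finset.Icc (-(R + 1 : ℤ)) (R + 1),
      z ≠ ⟨1 / 2, m + 1 / 2⟩ := by
    rintro z hz m hm rfl
    exact htΛ _ (Finset.mem_image_of_mem _ hm) hz
  obtain ⟨V, Φ, γ, hVc, hV1, hΦc, hγc, hcut, hsum, hort, hγ, hγV, hup, hlow⟩ :=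
    exists_loop_functions (spectrum ℂ t) R hb hΛ
  set J := Finset.Icc (-(R + 1 : ℤ)) (R + 1)
  have hv : ∀ j, cfc (V j) t ∈ unitary A := fun j => by
    rw [cfc_unitary_iff _ _ ht (hVc j)]
    intro z hz
    rw [RCLike.star_def, mul_comm, Complex.mul_conj, Complex.normSq_eq_norm_sq, hV1 j z hz]
    simp
  choose p hp hpf using fun j => hproj (cfc (V j) t) (hv j) (fun z => lowerIndicator z) (fun z => by
    simp only [lowerIndicator]; split_ifs <;> simp)
  let L : ℤ → ℂ → ℝ := fun j z => leftCutoff (V j z)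
  have hLc : ∀ j, ContinuousOn (L j) (spectrum ℂ t) := fun j =>
    continuous_leftCutoff.comp_continuousOn (hVc j)
  have hcomp : ∀ (f : ℂ → ℂ) (j), ContinuousOn f (Metric.sphere 0 1) →
      cfc f (cfc (V j) t) = cfc (fun z => f (V j z)) t := fun f j hf => by
    refine (cfc_comp' f (V j) t (hf.mono ?_) (hVc j) ht).symm
    rintro _ ⟨z, hz, rfl⟩
    simpa using hV1 j z hz
  have hlc : Continuous fun z : ℂ => (leftCutoff z : ℂ) :=
    Complex.continuous_ofReal.comp continuous_leftCutoff
  have hζp : ∀ j, Commute (rcfc (L j) t) (p j) := fun j => by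
    have := (hpf j _ hlc).1
    rwa [hcomp _ j hlc.continuousOn] at this
  have hLL : ∀ j, rcfc (L j) t - rcfc (L j) t * rcfc (L j) t =
      cfc (fun z => (leftCutoff z - leftCutoff z ^ 2 : ℂ)) (cfc (V j) t) := fun j => by
    rw [hcomp _ j (hlc.fun_sub (hlc.fun_pow 2)).continuousOn, ← rcfc_mul (hLc j) (hLc j),
      ← rcfc_sub (hLc j) ((hLc j).fun_mul (hLc j)), rcfc]
    congr 1
    funext z
    simp only [L]; push_cast; ring
  have hcutA : ∀ j, (rcfc (L j) t - rcfc (L j) t * rcfc (L j) t) * p j =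
      rcfc Φ t * rcfc (L j) t := fun j => by
    have hcc : ContinuousOn (fun z : ℂ => (leftCutoff z - leftCutoff z ^ 2 : ℂ) * lowerIndicator z)
        (Metric.sphere 0 1) := by
      refine (continuousOn_ofReal continuousOn_leftCutoff_mul_lowerIndicator).congr fun z _ => ?_
      push_cast; ring
    rw [hLL, (hpf j _ (hlc.fun_sub (hlc.fun_pow 2))).2 hcc, hcomp _ j hcc, ← rcfc_mul hΦc (hLc j)]
    refine cfc_congr fun z hz => ?_
    simp only [L]
    rw [← hcut j z hz]
    push_cast; ring
  have hortA : ∀ j k, j ≠ k → rcfc (L j) t * rcfc (L k) t = 0 := fun j k hjk => by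
    rw [← rcfc_mul (hLc j) (hLc k), ← rcfc_zero t]
    exact rcfc_congr fun z hz => hort j k hjk z hz
  have hsumfun : ∀ s : Finset ℤ, ContinuousOn (fun z => ∑ j ∈ s, Φ z * L j z) (spectrum ℂ t) ∧
      rcfc (fun z => ∑ j ∈ s, Φ z * L j z) t = ∑ j ∈ s, rcfc Φ t * rcfc (L j) t := fun s => by
    refine ⟨continuousOn_finsetSum _ fun j _ => hΦc.fun_mul (hLc j), ?_⟩
    induction s using Finset.induction_on with
    | empty => simpa using rcfc_zero t
    | insert i s hi ih =>
      simp only [Finset.sum_insert hi]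
      rw [rcfc_add (hΦc.fun_mul (hLc i)) (continuousOn_finsetSum _ fun j _ => hΦc.fun_mul (hLc j)), ih,
        rcfc_mul hΦc (hLc i)]
  have hsumA : rcfc Φ t * rcfc Φ t + ∑ j ∈ J, rcfc Φ t * rcfc (L j) t = rcfc Φ t := by
    rw [← (hsumfun J).2, ← rcfc_mul hΦc hΦc, ← rcfc_add (hΦc.fun_mul hΦc) (hsumfun J).1]
    refine rcfc_congr fun z hz => ?_
    rw [← hsum z hz, hsum z hz, ← sq]
    exact hsum z hz
  have hq : IsStarProjection (rcfc Φ t + ∑ j ∈ J, rcfc (L j) t * p j) :=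
    isStarProjection_add_sum (rcfc_isSelfAdjoint _ _) (fun j => rcfc_isSelfAdjoint _ _) hp hζp
      (fun j => rcfc_commute _ _ _) hcutA hortA hsumA
  set q := rcfc Φ t + ∑ j ∈ J, rcfc (L j) t * p j with hqdef
  have hq1 : ‖q‖ ≤ 1 := IsStarProjection.norm_le q hq
  have hq1' : ‖1 - q‖ ≤ 1 := IsStarProjection.norm_le _ hq.one_sub
  have hqγ : Commute q (rcfc γ t) := by
    refine (rcfc_commute _ _ _).add_left (Commute.sum_left _ _ _ fun j hj => ?_)
    have h1 : rcfc γ t * rcfc (L j) t = ((j : ℝ) : ℂ) • rcfc (L j) t := by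
      rw [← rcfc_mul hγc (hLc j), ← rcfc_const_mul _ (hLc j)]
      exact rcfc_congr fun z hz => hγV j hj z hz
    show rcfc (L j) t * p j * rcfc γ t = rcfc γ t * (rcfc (L j) t * p j)
    rw [← mul_assoc, h1, (hζp j).eq, mul_assoc, (rcfc_commute (L j) γ t).eq, h1, mul_smul_comm,
      smul_mul_assoc, (hζp j).eq]
  have hrec : Continuous Complex.re := Complex.continuous_re
  have hqK : ∀ k : ℝ → ℝ, Continuous k → ∀ c : ℝ, (∀ z ∈ spectrum ℂ t, Φ z * k z.re = c * k z.re) →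
      (∀ z ∈ spectrum ℂ t, ∀ j, L j z * k z.re = 0) →
      q * rcfc (fun z => k z.re) t = (c : ℂ) • rcfc (fun z => k z.re) t := by
    intro k hk c h1 h2
    have hkc : ContinuousOn (fun z : ℂ => k z.re) (spectrum ℂ t) := (hk.comp hrec).continuousOn
    rw [hqdef, add_mul, ← rcfc_mul hΦc hkc, rcfc_congr h1, rcfc_const_mul _ hkc, Finset.sum_mul,
      Finset.sum_eq_zero, add_zero]
    intro j _
    rw [(hζp j).eq, mul_assoc, ← rcfc_mul (hLc j) hkc, rcfc_congr fun z hz => h2 z hz j, rcfc_zero,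
      mul_zero]
  have hre : ‖rcfc Complex.re t - a‖ ≤ ε := (norm_rcfc_re_sub_le ha hg).trans htε.le
  have hw := continuous_upperWeight
  refine ⟨q, hq, ?_, ?_, ?_⟩
  · refine (norm_commutator_le_of_commute hq1 hqγ).trans ?_
    have h1 : ‖rcfc γ t - rcfc Complex.im t‖ ≤ 1 / 2 := by
      rw [← rcfc_sub hγc Complex.continuous_im.continuousOn]
      exact norm_rcfc_le (by norm_num) hγ
    have h2 : ‖rcfc Complex.im t - g‖ ≤ ε := (norm_rcfc_im_sub_le ha hg).trans htε.le
    have h3 := norm_sub_le_norm_sub_add_norm_sub (rcfc γ t) (rcfc Complex.im t) g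
    rw [norm_sub_rev g]
    linarith
  · intro e he hae
    let k : ℝ → ℝ := fun x => 1 - upperWeight x * (1 - x)
    have hk : Continuous k := by fun_prop
    have hk0 : ∀ x, x ≤ 3 / 4 → k x = 0 := fun x => upperWeight_mul
    have h1 := hqK k hk 1 (fun z hz => by
      rcases le_total z.re (3 / 4) with h | h
      · simp [hk0 _ h]
      · simp [(hup z hz h).1]) (fun z hz j => by
      rcases le_total z.re (3 / 4) with h | h
      · simp [hk0 _ h]
      · simp [L, (hup z hz h).2 j])
    have h2 : rcfc (fun z => k z.re) t =
        1 - rcfc (fun z => upperWeight z.re) t * (1 - rcfc Complex.re t) := by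
      have hc1 : ContinuousOn (fun z : ℂ => upperWeight z.re) (spectrum ℂ t) := by fun_prop
      have hc2 : ContinuousOn (fun z : ℂ => 1 - z.re) (spectrum ℂ t) := by fun_prop
      have hc3 : ContinuousOn (fun z : ℂ => z.re) (spectrum ℂ t) := by fun_prop
      simp only [k]
      rw [rcfc_sub continuousOn_const (hc1.fun_mul hc2), rcfc_mul hc1 hc2,
        rcfc_sub continuousOn_const hc3, rcfc_one]
    have h3 : (1 - q) * e =
        (1 - q) * (rcfc (fun z => upperWeight z.re) t * ((a - rcfc Complex.re t) * e)) := by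
      have h4 : (1 - q) * rcfc (fun z => k z.re) t = 0 := by
        rw [sub_mul, h1]; simp
      have h5 : (a - rcfc Complex.re t) * e = (1 - rcfc Complex.re t) * e := by
        rw [sub_mul, sub_mul, hae, one_mul]
      rw [h5, ← mul_assoc (rcfc _ t)]
      have h6 : rcfc (fun z => upperWeight z.re) t * (1 - rcfc Complex.re t) =
          1 - rcfc (fun z => k z.re) t := by rw [h2]; abel
      rw [h6, sub_mul 1 (rcfc _ t) e, mul_sub (1 - q), ← mul_assoc _ (rcfc _ t), h4, one_mul, zero_mul, sub_zero]
    rw [h3]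
    calc _ ≤ ‖1 - q‖ * (‖rcfc (fun z => upperWeight z.re) t‖ * (‖a - rcfc Complex.re t‖ * ‖e‖)) := by
          refine (norm_mul_le _ _).trans ?_
          gcongr
          refine (norm_mul_le _ _).trans ?_
          gcongr
          exact norm_mul_le _ _
      _ ≤ 1 * (4 * (ε * 1)) := by
          gcongr
          · exact norm_rcfc_le (by norm_num) fun z _ => abs_upperWeight_le _
          · rwa [norm_sub_rev]
      _ = 4 * ε := by ring
  · intro e he hae
    let k : ℝ → ℝ := fun x => 1 - upperWeight (1 - x) * (1 - (1 - x))
    have hk : Continuous k := by fun_prop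
    have hk0 : ∀ x, 1 / 4 ≤ x → k x = 0 := fun x hx => upperWeight_mul (by linarith)
    have h1 := hqK k hk 0 (fun z hz => by
      rcases le_total (1 / 4) z.re with h | h
      · simp [hk0 _ h]
      · simp [(hlow z hz h).1]) (fun z hz j => by
      rcases le_total (1 / 4) z.re with h | h
      · simp [hk0 _ h]
      · simp [L, (hlow z hz h).2 j])
    have h2 : rcfc (fun z => k z.re) t =
        1 - rcfc (fun z => upperWeight (1 - z.re)) t * rcfc Complex.re t := by
      have hc1 : ContinuousOn (fun z : ℂ => upperWeight (1 - z.re)) (spectrum ℂ t) := by fun_prop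
      have hc3 : ContinuousOn (fun z : ℂ => z.re) (spectrum ℂ t) := by fun_prop
      simp only [k, sub_sub_cancel]
      rw [rcfc_sub continuousOn_const (hc1.fun_mul hc3), rcfc_mul hc1 hc3, rcfc_one]
    have h3 : q * e =
        q * (rcfc (fun z => upperWeight (1 - z.re)) t * ((rcfc Complex.re t - a) * e)) := by
      have h4 : q * rcfc (fun z => k z.re) t = 0 := by
        rw [h1]; simp
      have h5 : (rcfc Complex.re t - a) * e = rcfc Complex.re t * e := by
        rw [sub_mul, hae, sub_zero]
      rw [h5, ← mul_assoc (rcfc _ t)]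
      have h6 : rcfc (fun z => upperWeight (1 - z.re)) t * rcfc Complex.re t =
          1 - rcfc (fun z => k z.re) t := by rw [h2]; abel
      rw [h6, sub_mul 1 (rcfc _ t) e, mul_sub q, ← mul_assoc _ (rcfc _ t), h4, one_mul, zero_mul, sub_zero]
    rw [h3]
    calc _ ≤ ‖q‖ * (‖rcfc (fun z => upperWeight (1 - z.re)) t‖ *
            (‖rcfc Complex.re t - a‖ * ‖e‖)) := by
          refine (norm_mul_le _ _).trans ?_
          gcongr
          refine (norm_mul_le _ _).trans ?_
          gcongr
          exact norm_mul_le _ _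
      _ ≤ 1 * (4 * (ε * 1)) := by
          gcongr
          exact norm_rcfc_le (by norm_num) fun z _ => abs_upperWeight_le _
      _ = 4 * ε := by ring

end CommutingProjection

section SequenceArgument
open BddSeq SeqQuot

theorem SeqQuot.mkStar_eq_of_tendsto {E : ℕ → Type} [∀ k, CStarAlgebra (E k)]
    [∀ k, Nontrivial (E k)] {x y : BddSeq E} {u : ℕ → ℝ} (hu : Tendsto u atTop (𝓝 0))
    (h : ∀ k, ‖eval E k x - eval E k y‖ ≤ u k) : mkStar E x = mkStar E y :=
  mkHom_eq_iff.2 (squeeze_zero (fun _ => norm_nonneg _) h hu)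

/-- A projection almost commuting with `Y` and separating the spectral values `0` and `1` of `X`,
whenever `X` and `Y` almost commute. -/
theorem exists_projection_of_almost_commute {c : ℝ} (hc : 0 < c) (B : ℝ) :
    ∃ η > 0, ∀ (M : Type) [CStarAlgebra M] [Nontrivial M] [FiniteDimensional ℂ M]
      (X Y e₁ e₀ : M), IsSelfAdjoint X → IsSelfAdjoint Y → ‖X‖ ≤ B → ‖Y‖ ≤ B → ‖e₁‖ ≤ 1 →
      ‖e₀‖ ≤ 1 → X * e₁ = e₁ → X * e₀ = 0 → ‖X * Y - Y * X‖ ≤ η →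
      ∃ q : M, IsStarProjection q ∧ ‖q * Y - Y * q‖ ≤ c ∧ ‖(1 - q) * e₁‖ ≤ c ∧ ‖q * e₀‖ ≤ c := by
  by_contra hcon
  have hk : ∀ k : ℕ, ∃ (M : Type) (_ : CStarAlgebra M) (_ : Nontrivial M)
      (_ : FiniteDimensional ℂ M) (X Y e₁ e₀ : M), IsSelfAdjoint X ∧ IsSelfAdjoint Y ∧ ‖X‖ ≤ B ∧
      ‖Y‖ ≤ B ∧ ‖e₁‖ ≤ 1 ∧ ‖e₀‖ ≤ 1 ∧ X * e₁ = e₁ ∧ X * e₀ = 0 ∧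
      ‖X * Y - Y * X‖ ≤ 1 / ((k : ℝ) + 1) ∧ ∀ q : M, IsStarProjection q → ‖q * Y - Y * q‖ ≤ c →
      ‖(1 - q) * e₁‖ ≤ c → ¬ ‖q * e₀‖ ≤ c := by
    intro k
    by_contra h
    refine hcon ⟨1 / ((k : ℝ) + 1), by positivity, ?_⟩
    intro M i₁ i₂ i₃ X Y e₁ e₀ h1 h2 h3 h4 h5 h6 h7 h8 h9
    by_contra hq
    refine h ⟨M, i₁, i₂, i₃, X, Y, e₁, e₀, h1, h2, h3, h4, h5, h6, h7, h8, h9, ?_⟩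
    exact fun q q1 q2 q3 q4 => hq ⟨q, q1, q2, q3, q4⟩
  choose E i₁ i₂ i₃ X Y e₁ e₀ h1 h2 h3 h4 h5 h6 h7 h8 h9 h10 using hk
  let X' : BddSeq E := ofBound X B h3
  let Y' : BddSeq E := ofBound Y B h4
  let f₁ : BddSeq E := ofBound e₁ 1 h5
  let f₀ : BddSeq E := ofBound e₀ 1 h6
  have hX : IsSelfAdjoint (mkStar E X') := by
    rw [IsSelfAdjoint, ← map_star]
    exact congrArg _ (BddSeq.ext fun k => (map_star (eval E k) X').trans (h1 k))
  have hY : IsSelfAdjoint (mkStar E Y') := by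
    rw [IsSelfAdjoint, ← map_star]
    exact congrArg _ (BddSeq.ext fun k => (map_star (eval E k) Y').trans (h2 k))
  have hXY : mkStar E X' * mkStar E Y' = mkStar E Y' * mkStar E X' := by
    rw [← map_mul, ← map_mul]
    refine mkStar_eq_of_tendsto tendsto_one_div_add_atTop_nhds_zero_nat fun k => ?_
    rw [map_mul, map_mul]
    exact h9 k
  have hf₁ : mkStar E X' * mkStar E f₁ = mkStar E f₁ := by
    rw [← map_mul]
    exact congrArg _ (BddSeq.ext fun k => (map_mul (eval E k) X' f₁).trans (h7 k))
  have hf₀ : mkStar E X' * mkStar E f₀ = 0 := by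
    rw [← map_mul, ← map_zero (mkStar E)]
    exact congrArg _ (BddSeq.ext fun k => (map_mul (eval E k) X' f₀).trans
      ((h8 k).trans (map_zero (eval E k)).symm))
  have hf₁n : ‖mkStar E f₁‖ ≤ 1 :=
    norm_mkHom_le_of_eventually zero_le_one (Eventually.of_forall h5)
  have hf₀n : ‖mkStar E f₀‖ ≤ 1 :=
    norm_mkHom_le_of_eventually zero_le_one (Eventually.of_forall h6)
  set ε := min 1 (c / 8) with hε
  have hε0 : 0 < ε := lt_min one_pos (by positivity)
  have hε1 : ε ≤ 1 := min_le_left _ _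
  have hε2 : ε ≤ c / 8 := min_le_right _ _
  set s : ℝ := 4 / c with hs
  have hs0 : 0 < s := by positivity
  have hYs : IsSelfAdjoint ((s : ℂ) • mkStar E Y') := by
    rw [IsSelfAdjoint, star_smul, hY.star_eq]; simp
  obtain ⟨q, hq, hqY, hq1, hq0⟩ := exists_projection_of_commute (A := SeqQuot E)
    exists_polar (fun v hv χ hχ => exists_spectral_projection hv χ hχ) hX hYs
    (show Commute (mkStar E X') _ from Commute.smul_right hXY _) hε0 hε1
  have hqY' : ‖q * mkStar E Y' - mkStar E Y' * q‖ < c := by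
    rw [mul_smul_comm, smul_mul_assoc, ← smul_sub, norm_smul, Complex.norm_real,
      Real.norm_of_nonneg hs0.le, hs] at hqY
    have : 4 / c * ‖q * mkStar E Y' - mkStar E Y' * q‖ < 4 := by linarith
    rwa [div_mul_eq_mul_div, div_lt_iff₀ hc, mul_lt_mul_iff_right₀ (by norm_num)] at this
  have hq1' := (hq1 _ hf₁n hf₁).trans_lt (show 4 * ε < c by linarith)
  have hq0' := (hq0 _ hf₀n hf₀).trans_lt (show 4 * ε < c by linarith)
  obtain ⟨Q, hQ, rfl⟩ := exists_projection_lift hq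
  rw [← map_mul, ← map_mul, ← map_sub] at hqY'
  rw [← map_one (mkStar E), ← map_sub, ← map_mul] at hq1'
  rw [← map_mul] at hq0'
  obtain ⟨k, hk1, hk2, hk3⟩ := ((eventually_norm_lt hqY').and
    ((eventually_norm_lt hq1').and (eventually_norm_lt hq0'))).exists
  rw [map_sub, map_mul, map_mul] at hk1
  rw [map_mul, map_sub, map_one] at hk2
  rw [map_mul] at hk3
  refine h10 k (eval E k Q) ⟨?_, ?_⟩ hk1.le hk2.le hk3.le
  · show eval E k Q * eval E k Q = eval E k Q
    rw [← map_mul, hQ.isIdempotentElem.eq]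
  · rw [IsSelfAdjoint, ← map_star, hQ.isSelfAdjoint.star_eq]

end SequenceArgument

section SpectralDecomposition

variable {M : Type*} [CStarAlgebra M] [FiniteDimensional ℂ M]

theorem cfc_mul_cfc (f g : ℝ → ℝ) (B : M) : cfc f B * cfc g B = cfc (fun x => f x * g x) B :=
  (cfc_mul f g B (continuousOn_spectrum_real B f) (continuousOn_spectrum_real B g)).symm

theorem cfc_sub_cfc (f g : ℝ → ℝ) (B : M) : cfc f B - cfc g B = cfc (fun x => f x - g x) B :=
  (cfc_sub f g B (continuousOn_spectrum_real B f) (continuousOn_spectrum_real B g)).symm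

omit [FiniteDimensional ℂ M] in
theorem cfc_isSelfAdjoint (f : ℝ → ℝ) (B : M) : IsSelfAdjoint (cfc f B) := cfc_predicate f B

/-- The finite real spectrum of an element of a finite-dimensional algebra. -/
def specSet (B : M) : Finset ℝ := (spectrum_real_finite B).toFinset

theorem mem_specSet {B : M} {x : ℝ} : x ∈ specSet B ↔ x ∈ spectrum ℝ B :=
  Set.Finite.mem_toFinset _

/-- The spectral projection of `B` at the single point `x`. -/
def eigenProj (B : M) (x : ℝ) : M := cfc (Set.indicator {x} (fun _ => (1 : ℝ))) B

omit [FiniteDimensional ℂ M] in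
theorem eigenProj_isSelfAdjoint (B : M) (x : ℝ) : IsSelfAdjoint (eigenProj B x) :=
  cfc_predicate _ _

theorem cfc_mul_eigenProj (f : ℝ → ℝ) (B : M) (x : ℝ) :
    cfc f B * eigenProj B x = (f x : ℂ) • eigenProj B x := by
  rw [eigenProj, cfc_mul_cfc, Complex.coe_smul, ← cfc_smul (f x) _ B (continuousOn_spectrum_real B _)]
  congr 1
  ext y
  by_cases h : y = x <;> simp [h]

theorem eigenProj_mul_cfc (f : ℝ → ℝ) (B : M) (x : ℝ) :
    eigenProj B x * cfc f B = (f x : ℂ) • eigenProj B x := by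
  rw [← cfc_mul_eigenProj]
  exact cfc_commute_cfc _ _ _

theorem eigenProj_mul_eigenProj (B : M) (x y : ℝ) :
    eigenProj B x * eigenProj B y = if x = y then eigenProj B y else 0 := by
  rw [eigenProj, cfc_mul_eigenProj]
  by_cases h : x = y
  · simp [h]
  · rw [if_neg h, Set.indicator_of_notMem (by simpa using Ne.symm h)]
    simp

theorem cfc_eq_sum (f : ℝ → ℝ) (B : M) :
    cfc f B = ∑ x ∈ specSet B, (f x : ℂ) • eigenProj B x := by
  have : cfc f B = cfc (∑ x ∈ specSet B, fun y => f x * Set.indicator {x} (fun _ => (1 : ℝ)) y) B := by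
    refine cfc_congr fun y hy => ?_
    rw [Finset.sum_apply, Finset.sum_eq_single y]
    · simp
    · intro x _ hxy
      simp [Set.indicator_of_notMem (by simpa using hxy.symm : y ∉ ({x} : Set ℝ))]
    · exact fun h => absurd (mem_specSet.2 hy) h
  rw [this, cfc_sum _ B _ fun x _ => continuousOn_spectrum_real B _]
  refine Finset.sum_congr rfl fun x _ => ?_
  rw [cfc_const_mul (f x) _ B (continuousOn_spectrum_real B _), Complex.coe_smul]
  rfl

theorem sum_eigenProj {B : M} (hB : IsSelfAdjoint B) : ∑ x ∈ specSet B, eigenProj B x = 1 := by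
  have := cfc_eq_sum (fun _ => 1) B
  rw [cfc_const_one ℝ B] at this
  simpa using this.symm

theorem eigenProj_ext {B : M} (hB : IsSelfAdjoint B) {X Y : M}
    (h : ∀ x ∈ specSet B, ∀ y ∈ specSet B,
      eigenProj B x * X * eigenProj B y = eigenProj B x * Y * eigenProj B y) : X = Y := by
  have key : ∀ Z : M, Z = ∑ x ∈ specSet B, ∑ y ∈ specSet B, eigenProj B x * Z * eigenProj B y := by
    intro Z
    calc Z = (∑ x ∈ specSet B, eigenProj B x) * Z * ∑ y ∈ specSet B, eigenProj B y := by
          rw [sum_eigenProj hB, one_mul, mul_one]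
      _ = _ := by
          simp only [Finset.sum_mul, Finset.mul_sum]
          exact Finset.sum_comm
  rw [key X, key Y]
  exact Finset.sum_congr rfl fun x hx => Finset.sum_congr rfl fun y hy => h x hx y hy

/-- Complex-valued functional calculus of a self-adjoint element. -/
def complexCalc (h : ℝ → ℂ) (B : M) : M := ∑ x ∈ specSet B, h x • eigenProj B x

theorem complexCalc_mul_eigenProj (h : ℝ → ℂ) {B : M} {x : ℝ} (hx : x ∈ specSet B) :
    complexCalc h B * eigenProj B x = h x • eigenProj B x := by
  simp [complexCalc, Finset.sum_mul, eigenProj_mul_eigenProj, hx]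

theorem eigenProj_mul_complexCalc (h : ℝ → ℂ) {B : M} {x : ℝ} (hx : x ∈ specSet B) :
    eigenProj B x * complexCalc h B = h x • eigenProj B x := by
  simp only [complexCalc, Finset.mul_sum, mul_smul_comm, eigenProj_mul_eigenProj]
  rw [Finset.sum_eq_single x] <;> simp +contextual [hx, eq_comm]

theorem complexCalc_mul (h g : ℝ → ℂ) (B : M) :
    complexCalc h B * complexCalc g B = complexCalc (fun x => h x * g x) B := by
  conv_lhs => rw [complexCalc, Finset.sum_mul]
  refine Finset.sum_congr rfl fun x hx => ?_
  rw [smul_mul_assoc, eigenProj_mul_complexCalc g hx, smul_smul]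

theorem star_complexCalc (h : ℝ → ℂ) (B : M) :
    star (complexCalc h B) = complexCalc (fun x => star (h x)) B := by
  simp only [complexCalc, star_sum, star_smul, (eigenProj_isSelfAdjoint B _).star_eq]

theorem complexCalc_one {B : M} (hB : IsSelfAdjoint B) : complexCalc (fun _ => 1) B = 1 := by
  simp [complexCalc, sum_eigenProj hB]

/-- The one-parameter unitary group `exp (2 π i t B)`. -/
def phaseGroup (B : M) (t : ℝ) : M :=
  complexCalc (fun x => Complex.exp ((2 * Real.pi * (t * x) : ℝ) * Complex.I)) B

theorem star_phaseGroup (B : M) (t : ℝ) : star (phaseGroup B t) = phaseGroup B (-t) := by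
  rw [phaseGroup, star_complexCalc, phaseGroup]
  congr 1
  ext x
  rw [Complex.star_def, ← Complex.exp_conj]
  congr 1
  rw [map_mul, Complex.conj_ofReal, Complex.conj_I]
  push_cast
  ring

theorem phaseGroup_mul (B : M) (s t : ℝ) :
    phaseGroup B s * phaseGroup B t = phaseGroup B (s + t) := by
  rw [phaseGroup, phaseGroup, complexCalc_mul, phaseGroup]
  congr 1
  ext x
  rw [← Complex.exp_add]
  congr 1
  push_cast
  ring

theorem phaseGroup_zero {B : M} (hB : IsSelfAdjoint B) : phaseGroup B 0 = 1 := by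
  rw [← complexCalc_one hB, phaseGroup]
  simp

theorem phaseGroup_mem_unitary {B : M} (hB : IsSelfAdjoint B) (t : ℝ) :
    phaseGroup B t ∈ unitary M := by
  rw [Unitary.mem_iff, star_phaseGroup, phaseGroup_mul, phaseGroup_mul]
  simp [phaseGroup_zero hB]

theorem norm_phaseGroup_conj {B : M} (hB : IsSelfAdjoint B) (t : ℝ) (X : M) :
    ‖phaseGroup B t * X * phaseGroup B (-t)‖ = ‖X‖ := by
  rw [CStarRing.norm_mul_mem_unitary _ (phaseGroup_mem_unitary hB _),
    CStarRing.norm_mem_unitary_mul _ (phaseGroup_mem_unitary hB _)]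

theorem norm_phaseGroup_le {B : M} (hB : IsSelfAdjoint B) (t : ℝ) : ‖phaseGroup B t‖ ≤ 1 := by
  have := CStarRing.norm_mem_unitary_mul (1 : M) (phaseGroup_mem_unitary hB t)
  rw [mul_one] at this
  rw [this]
  exact IsStarProjection.norm_le (1 : M) (.one _)

theorem eigenProj_phaseGroup_conj (B : M) {x y : ℝ} (hx : x ∈ specSet B) (hy : y ∈ specSet B)
    (t : ℝ) (X : M) :
    eigenProj B x * (phaseGroup B t * X * phaseGroup B (-t)) * eigenProj B y =
      Complex.exp ((2 * Real.pi * (t * (x - y)) : ℝ) * Complex.I) •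
        (eigenProj B x * X * eigenProj B y) := by
  have : eigenProj B x * (phaseGroup B t * X * phaseGroup B (-t)) * eigenProj B y =
      (eigenProj B x * phaseGroup B t) * X * (phaseGroup B (-t) * eigenProj B y) := by
    simp only [mul_assoc]
  rw [this, phaseGroup, phaseGroup, eigenProj_mul_complexCalc _ hx, complexCalc_mul_eigenProj _ hy,
    smul_mul_assoc, smul_mul_assoc, mul_smul_comm, smul_smul, ← Complex.exp_add]
  congr 2
  push_cast
  ring

theorem hasDerivAt_phaseGroup {B : M} (hB : IsSelfAdjoint B) (t : ℝ) :
    HasDerivAt (phaseGroup B) ((2 * Real.pi * Complex.I : ℂ) • (phaseGroup B t * B)) t := by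
  have h1 : ∀ x : ℝ, HasDerivAt (fun t : ℝ =>
      Complex.exp ((2 * Real.pi * (t * x) : ℝ) * Complex.I) • eigenProj B x)
      ((Complex.exp ((2 * Real.pi * (t * x) : ℝ) * Complex.I) * ((2 * Real.pi * x : ℝ) * Complex.I))
        • eigenProj B x) t := by
    intro x
    refine HasDerivAt.smul_const ?_ _
    refine HasDerivAt.cexp ?_
    refine HasDerivAt.mul_const ?_ _
    have : HasDerivAt (fun t : ℝ => 2 * Real.pi * (t * x)) (2 * Real.pi * (1 * x)) t :=
      ((hasDerivAt_id t).mul_const x).const_mul _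
    simpa using this.ofReal_comp
  have h2 := HasDerivAt.fun_sum fun x (_ : x ∈ specSet B) => h1 x
  refine h2.congr_deriv ?_
  have hB' : B = complexCalc (fun x => (x : ℂ)) B := by
    have := cfc_eq_sum (fun x => x) B
    rwa [cfc_id' ℝ B] at this
  conv_rhs => rw [phaseGroup]; rw (occs := .pos [2]) [hB']
  rw [complexCalc_mul, complexCalc, Finset.smul_sum]
  refine Finset.sum_congr rfl fun x _ => ?_
  rw [smul_smul]
  congr 1
  push_cast
  ring

theorem continuous_phaseGroup {B : M} (hB : IsSelfAdjoint B) : Continuous (phaseGroup B) :=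
  continuous_iff_continuousAt.2 fun t => (hasDerivAt_phaseGroup hB t).continuousAt

theorem phaseGroup_comm {B : M} (hB : IsSelfAdjoint B) (t : ℝ) :
    phaseGroup B t * B = B * phaseGroup B t := by
  refine eigenProj_ext hB fun x hx y hy => ?_
  have hBx : eigenProj B x * B = (x : ℂ) • eigenProj B x := by
    have := eigenProj_mul_cfc (fun x => x) B x
    rwa [cfc_id' ℝ B] at this
  have hBy : B * eigenProj B y = (y : ℂ) • eigenProj B y := by
    have := cfc_mul_eigenProj (fun x => x) B y
    rwa [cfc_id' ℝ B] at this
  have e1 : eigenProj B x * (phaseGroup B t * B) * eigenProj B y =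
    (eigenProj B x * phaseGroup B t) * (B * eigenProj B y) := by simp only [mul_assoc]
  have e2 : eigenProj B x * (B * phaseGroup B t) * eigenProj B y =
    (eigenProj B x * B) * (phaseGroup B t * eigenProj B y) := by simp only [mul_assoc]
  rw [e1, e2, hBx, hBy, phaseGroup, eigenProj_mul_complexCalc _ hx, complexCalc_mul_eigenProj _ hy]
  simp only [smul_mul_assoc, mul_smul_comm, eigenProj_mul_eigenProj]
  by_cases h : x = y
  · subst h
    exact smul_comm _ _ _
  · simp [h]

/-- Conjugation by the phase group moves `A` by at most the commutator with the generator. -/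
theorem norm_phaseGroup_conj_sub_le {B : M} (hB : IsSelfAdjoint B) (A : M) (t : ℝ) :
    ‖phaseGroup B t * A * phaseGroup B (-t) - A‖ ≤ 2 * Real.pi * ‖A * B - B * A‖ * |t| := by
  have hd : ∀ s : ℝ, HasDerivAt (fun s => phaseGroup B s * A * phaseGroup B (-s))
      ((-(2 * Real.pi * Complex.I) : ℂ) • (phaseGroup B s * (A * B - B * A) * phaseGroup B (-s)))
      s := by
    intro s
    have h1 := (hasDerivAt_phaseGroup hB s).mul_const A
    have h2 : HasDerivAt (fun s => phaseGroup B (-s)) _ s :=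
      (hasDerivAt_phaseGroup hB (-s)).scomp s (hasDerivAt_neg s)
    refine (h1.mul h2).congr_deriv ?_
    rw [phaseGroup_comm hB (-s)]
    simp only [smul_mul_assoc, mul_smul_comm, neg_smul, one_smul, smul_sub, mul_sub, sub_mul,
      mul_neg, mul_assoc]
    abel
  have := Convex.norm_image_sub_le_of_norm_hasDerivWithin_le (s := Set.univ) (x := 0) (y := t)
    (C := 2 * Real.pi * ‖A * B - B * A‖) (fun s _ => (hd s).hasDerivWithinAt) (fun s _ => ?_)
    convex_univ trivial trivial
  · simpa [phaseGroup_zero hB] using this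
  · rw [norm_smul, norm_phaseGroup_conj hB]
    simp [abs_of_pos Real.pi_pos]

theorem norm_commutator_phaseGroup_le {B : M} (hB : IsSelfAdjoint B) (A : M) (t : ℝ) :
    ‖A * phaseGroup B t - phaseGroup B t * A‖ ≤ 2 * Real.pi * ‖A * B - B * A‖ * |t| := by
  have : A * phaseGroup B t - phaseGroup B t * A =
      -((phaseGroup B t * A * phaseGroup B (-t) - A) * phaseGroup B t) := by
    rw [sub_mul, mul_assoc _ (phaseGroup B (-t)), phaseGroup_mul]
    simp [phaseGroup_zero hB]
  rw [this, norm_neg, CStarRing.norm_mul_mem_unitary _ (phaseGroup_mem_unitary hB _)]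
  exact norm_phaseGroup_conj_sub_le hB A t

end SpectralDecomposition

section Smoothing

open MeasureTheory
open scoped ContDiff FourierTransform

theorem exists_fourier_kernel {f : ℝ → ℝ} (hf : ContDiff ℝ ∞ f) (hc : HasCompactSupport f) :
    ∃ k : ℝ → ℂ, Continuous k ∧ Integrable k ∧ Integrable (fun t => |t| * ‖k t‖) ∧
      ∀ x, (f x : ℂ) = ∫ t, k t * Complex.exp ((2 * Real.pi * (t * x) : ℝ) * Complex.I) := by
  have hc' : HasCompactSupport (fun x => (f x : ℂ)) :=
    hc.comp_left (g := fun x : ℝ => (x : ℂ)) Complex.ofReal_zero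
  have hf' : ContDiff ℝ ∞ (fun x => (f x : ℂ)) := Complex.ofRealCLM.contDiff.comp hf
  let F : SchwartzMap ℝ ℂ := hc'.toSchwartzMap hf'
  let K : SchwartzMap ℝ ℂ := 𝓕 F
  refine ⟨K, K.continuous, K.integrable, ?_, fun x => ?_⟩
  · simpa using K.integrable_pow_mul volume 1
  · have h1 : (𝓕⁻ K : SchwartzMap ℝ ℂ) = F := FourierTransform.fourierInv_fourier_eq F
    have h2 : (f x : ℂ) = (𝓕⁻ K : SchwartzMap ℝ ℂ) x := by rw [h1]; rfl
    rw [h2, SchwartzMap.fourierInv_coe, Real.fourierInv_eq']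
    refine integral_congr_ae (Eventually.of_forall fun t => ?_)
    simp only [smul_eq_mul]
    rw [mul_comm]
    congr 4
    simp [mul_comm]

variable {M : Type*} [CStarAlgebra M] [FiniteDimensional ℂ M]

/-- `A` has no matrix coefficients between spectral subspaces of `B` at distance at least `w`. -/
def HasBandwidth (w : ℝ) (A B : M) : Prop :=
  ∀ f g : ℝ → ℝ, (∀ x y, f x ≠ 0 → g y ≠ 0 → w ≤ |x - y|) → cfc f B * A * cfc g B = 0

omit [FiniteDimensional ℂ M] in
theorem HasBandwidth.eigenProj_mul {w : ℝ} {A B : M} (h : HasBandwidth w A B) {x y : ℝ}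
    (hxy : w ≤ |x - y|) : eigenProj B x * A * eigenProj B y = 0 := by
  refine h _ _ fun x' y' hx' hy' => ?_
  have h1 : x' = x := by simpa using Set.mem_of_indicator_ne_zero hx'
  have h2 : y' = y := by simpa using Set.mem_of_indicator_ne_zero hy'
  rwa [h1, h2]

theorem norm_commutator_cfc_le {f : ℝ → ℝ} {k : ℝ → ℂ} (hk : Continuous k) (hki : Integrable k)
    (hk1 : Integrable (fun t => |t| * ‖k t‖))
    (hf : ∀ x, (f x : ℂ) = ∫ t, k t * Complex.exp ((2 * Real.pi * (t * x) : ℝ) * Complex.I))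
    {B : M} (hB : IsSelfAdjoint B) (A : M) :
    ‖A * cfc f B - cfc f B * A‖ ≤
      (∫ t, |t| * ‖k t‖) * (2 * Real.pi) * ‖A * B - B * A‖ := by
  have hinteg : Integrable (fun t => k t • phaseGroup B t) := by
    refine hki.norm.mono' (hk.smul (continuous_phaseGroup hB)).aestronglyMeasurable ?_
    refine Eventually.of_forall fun t => ?_
    rw [norm_smul]
    exact mul_le_of_le_one_right (norm_nonneg _)
      (norm_phaseGroup_le hB t)
  have hG : cfc f B = ∫ t, k t • phaseGroup B t := by
    have h1 : ∀ x : ℝ, Integrable (fun t : ℝ =>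
        (k t * Complex.exp ((2 * Real.pi * (t * x) : ℝ) * Complex.I)) • eigenProj B x) := by
      intro x
      refine Integrable.smul_const ?_ _
      refine hki.norm.mono' (by fun_prop) (Eventually.of_forall fun t => ?_)
      rw [norm_mul, Complex.norm_exp_ofReal_mul_I, mul_one]
    have h2 : (fun t => k t • phaseGroup B t) = fun t => ∑ x ∈ specSet B,
        (k t * Complex.exp ((2 * Real.pi * (t * x) : ℝ) * Complex.I)) • eigenProj B x := by
      ext t
      rw [phaseGroup, complexCalc, Finset.smul_sum]
      exact Finset.sum_congr rfl fun x _ => smul_smul _ _ _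
    rw [h2, integral_finsetSum _ fun x _ => h1 x, cfc_eq_sum f B]
    exact Finset.sum_congr rfl fun x _ => by rw [integral_smul_const, hf]
  rw [hG, ← integral_const_mul_of_integrable hinteg, ← integral_mul_const_of_integrable hinteg,
    ← integral_sub (hinteg.const_mul A) (hinteg.mul_const A), mul_assoc, ← integral_mul_const]
  refine norm_integral_le_of_norm_le (hk1.mul_const _) (Eventually.of_forall fun t => ?_)
  rw [mul_smul_comm, smul_mul_assoc, ← smul_sub, norm_smul]
  calc ‖k t‖ * ‖A * phaseGroup B t - phaseGroup B t * A‖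
      ≤ ‖k t‖ * (2 * Real.pi * ‖A * B - B * A‖ * |t|) := by
        gcongr
        exact norm_commutator_phaseGroup_le hB A t
    _ = _ := by ring

theorem exists_norm_commutator_cfc_le {G : ℝ → ℝ} (hG : ContDiff ℝ ∞ G)
    (hc : HasCompactSupport G) :
    ∃ C : ℝ, 0 ≤ C ∧ ∀ (M : Type) [CStarAlgebra M] [FiniteDimensional ℂ M] (A B : M) (b : ℝ),
      IsSelfAdjoint B → ‖A * cfc (fun x => G (x - b)) B - cfc (fun x => G (x - b)) B * A‖ ≤
        C * ‖A * B - B * A‖ := by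
  obtain ⟨k, hk, hki, hk1, hf⟩ := exists_fourier_kernel hG hc
  refine ⟨(∫ t, |t| * ‖k t‖) * (2 * Real.pi),
    mul_nonneg (integral_nonneg fun t => by positivity) (by positivity), ?_⟩
  intro M _ _ A B b hB
  have hn : ∀ t : ℝ, ‖k t * Complex.exp ((-(2 * Real.pi * (t * b)) : ℝ) * Complex.I)‖ = ‖k t‖ :=
    fun t => by rw [norm_mul, Complex.norm_exp_ofReal_mul_I, mul_one]
  have hcont : Continuous
      (fun t => k t * Complex.exp ((-(2 * Real.pi * (t * b)) : ℝ) * Complex.I)) := by fun_prop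
  have := norm_commutator_cfc_le (f := fun x => G (x - b))
    (k := fun t => k t * Complex.exp ((-(2 * Real.pi * (t * b)) : ℝ) * Complex.I)) hcont
    (hki.norm.mono' hcont.aestronglyMeasurable (Eventually.of_forall fun t => (hn t).le))
    (by simpa only [hn] using hk1) ?_ hB A
  · simpa only [hn] using this
  · intro x
    rw [hf]
    refine integral_congr_ae (Eventually.of_forall fun t => ?_)
    beta_reduce
    rw [mul_assoc (k t), ← Complex.exp_add]
    congr 2
    push_cast
    ring

/-- Averaging over the phase group makes `A` banded with respect to `B`. -/
theorem exists_hasBandwidth :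
    ∃ C : ℝ, 1 ≤ C ∧ ∀ (M : Type) [CStarAlgebra M] [FiniteDimensional ℂ M] (A B : M),
      IsSelfAdjoint A → IsSelfAdjoint B → ∃ A' : M, IsSelfAdjoint A' ∧ HasBandwidth (1 / 2) A' B ∧
        ‖A' - A‖ ≤ C * ‖A * B - B * A‖ ∧ ‖A' * B - B * A'‖ ≤ C * ‖A * B - B * A‖ ∧
        ‖A'‖ ≤ C * ‖A‖ := by
  let φ : ContDiffBump (0 : ℝ) := ⟨1 / 4, 1 / 2, by norm_num, by norm_num⟩
  obtain ⟨k, hk, hki, hk1, hf⟩ := exists_fourier_kernel (f := φ) φ.contDiff φ.hasCompactSupport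
  have hφ0 : ∫ t, k t = 1 := by
    have := hf 0
    rw [φ.one_of_mem_closedBall (by simp [φ.rIn_pos.le])] at this
    simpa using this.symm
  have hφ1 : ∀ x : ℝ, 1 / 2 ≤ |x| → φ x = 0 := fun x hx =>
    φ.zero_of_le_dist (by rwa [Real.dist_eq, sub_zero])
  have hK0 : 0 ≤ ∫ t, ‖k t‖ := integral_nonneg fun t => norm_nonneg _
  have hK1 : 0 ≤ (∫ t, |t| * ‖k t‖) * (2 * Real.pi) :=
    mul_nonneg (integral_nonneg fun t => by positivity) (by positivity)
  refine ⟨1 + (∫ t, ‖k t‖) + (∫ t, |t| * ‖k t‖) * (2 * Real.pi), by linarith, ?_⟩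
  intro M _ _ A B hA hB
  have hinteg : ∀ X : M, Integrable (fun t => k t • (phaseGroup B t * X * phaseGroup B (-t))) := by
    intro X
    have hcont : Continuous (fun t => phaseGroup B t * X * phaseGroup B (-t)) :=
      ((continuous_phaseGroup hB).mul continuous_const).mul
        ((continuous_phaseGroup hB).comp continuous_neg)
    refine (hki.norm.mul_const ‖X‖).mono' (hk.smul hcont).aestronglyMeasurable ?_
    refine Eventually.of_forall fun t => ?_
    rw [norm_smul, norm_phaseGroup_conj hB]
  have hnorm : ∀ X : M, ‖∫ t, k t • (phaseGroup B t * X * phaseGroup B (-t))‖ ≤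
      (∫ t, ‖k t‖) * ‖X‖ := by
    intro X
    rw [← integral_mul_const]
    refine norm_integral_le_of_norm_le (hki.norm.mul_const _) (Eventually.of_forall fun t => ?_)
    rw [norm_smul, norm_phaseGroup_conj hB]
  set T := ∫ t, k t • (phaseGroup B t * A * phaseGroup B (-t)) with hT
  have hTA : ‖T - A‖ ≤ (∫ t, |t| * ‖k t‖) * (2 * Real.pi) * ‖A * B - B * A‖ := by
    have : A = ∫ t, k t • A := by rw [integral_smul_const, hφ0, one_smul]
    rw [hT]
    nth_rewrite 2 [this]
    rw [← integral_sub (hinteg A) (hki.smul_const A), mul_assoc, ← integral_mul_const]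
    refine norm_integral_le_of_norm_le (hk1.mul_const _) (Eventually.of_forall fun t => ?_)
    rw [← smul_sub, norm_smul]
    calc ‖k t‖ * ‖phaseGroup B t * A * phaseGroup B (-t) - A‖
        ≤ ‖k t‖ * (2 * Real.pi * ‖A * B - B * A‖ * |t|) := by
          gcongr
          exact norm_phaseGroup_conj_sub_le hB A t
      _ = _ := by ring
  have hTB : ‖T * B - B * T‖ ≤ (∫ t, ‖k t‖) * ‖A * B - B * A‖ := by
    have : T * B - B * T =
        ∫ t, k t • (phaseGroup B t * (A * B - B * A) * phaseGroup B (-t)) := by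
      rw [hT, ← integral_mul_const_of_integrable (hinteg A), ← integral_const_mul_of_integrable (hinteg A),
        ← integral_sub ((hinteg A).mul_const B) ((hinteg A).const_mul B)]
      refine integral_congr_ae (Eventually.of_forall fun t => ?_)
      simp only [smul_mul_assoc, mul_smul_comm, ← smul_sub]
      rw [mul_assoc _ (phaseGroup B (-t)) B, phaseGroup_comm hB (-t), ← mul_assoc B, ← mul_assoc B,
        ← phaseGroup_comm hB t]
      simp only [mul_sub, sub_mul, mul_assoc]
    rw [this]
    exact hnorm _
  have hTe : ∀ x ∈ specSet B, ∀ y ∈ specSet B, eigenProj B x * T * eigenProj B y =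
      (φ (x - y) : ℂ) • (eigenProj B x * A * eigenProj B y) := by
    intro x hx y hy
    rw [hT, ← integral_const_mul_of_integrable (hinteg A),
      ← integral_mul_const_of_integrable ((hinteg A).const_mul _), hf, ← integral_smul_const]
    refine integral_congr_ae (Eventually.of_forall fun t => ?_)
    simp only [smul_mul_assoc, mul_smul_comm]
    rw [eigenProj_phaseGroup_conj B hx hy, smul_smul]
  have hTr : HasBandwidth (1 / 2) T B := by
    intro f g hfg
    refine eigenProj_ext hB fun x hx y hy => ?_
    have : eigenProj B x * (cfc f B * T * cfc g B) * eigenProj B y =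
        (eigenProj B x * cfc f B) * T * (cfc g B * eigenProj B y) := by simp only [mul_assoc]
    rw [this, eigenProj_mul_cfc, cfc_mul_eigenProj, smul_mul_assoc, smul_mul_assoc, mul_smul_comm,
      hTe x hx y hy, smul_smul, smul_smul]
    by_cases h1 : f x = 0
    · simp [h1]
    by_cases h2 : g y = 0
    · simp [h2]
    rw [hφ1 _ (hfg x y h1 h2)]
    simp
  have hhalf : ∀ X Y : M, ∀ c : ℝ, ‖X‖ ≤ c → ‖Y‖ ≤ c → ‖(1 / 2 : ℝ) • (X + Y)‖ ≤ c := by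
    intro X Y c hX hY
    rw [norm_smul, Real.norm_of_nonneg (by norm_num)]
    linarith [norm_add_le X Y]
  have hmono : ∀ r s : ℝ, 0 ≤ s → (r = ∫ t, ‖k t‖) ∨ (r = (∫ t, |t| * ‖k t‖) * (2 * Real.pi)) →
      r * s ≤ (1 + (∫ t, ‖k t‖) + (∫ t, |t| * ‖k t‖) * (2 * Real.pi)) * s := by
    intro r s hs hr
    refine mul_le_mul_of_nonneg_right ?_ hs
    rcases hr with h | h <;> linarith
  refine ⟨(1 / 2 : ℝ) • (T + star T), ?_, ?_, ?_, ?_, ?_⟩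
  · rw [IsSelfAdjoint, star_smul, star_add, star_star, add_comm, star_trivial]
  · intro f g hfg
    have h1 := hTr f g hfg
    have h2 := congrArg star (hTr g f fun x y hx hy => by
      rw [abs_sub_comm]; exact hfg y x hy hx)
    rw [star_mul, star_mul, (cfc_isSelfAdjoint f B).star_eq, (cfc_isSelfAdjoint g B).star_eq,
      star_zero, ← mul_assoc] at h2
    rw [mul_smul_comm, smul_mul_assoc, mul_add, add_mul, h1, h2, add_zero, smul_zero]
  · refine le_trans ?_ (hmono _ _ (norm_nonneg _) (Or.inr rfl))
    have : (1 / 2 : ℝ) • (T + star T) - A = (1 / 2 : ℝ) • ((T - A) + star (T - A)) := by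
      rw [star_sub, hA.star_eq]
      module
    rw [this]
    exact hhalf _ _ _ hTA (by rwa [norm_star])
  · refine le_trans ?_ (hmono _ _ (norm_nonneg _) (Or.inl rfl))
    have : (1 / 2 : ℝ) • (T + star T) * B - B * (1 / 2 : ℝ) • (T + star T) =
        (1 / 2 : ℝ) • ((T * B - B * T) + -star (T * B - B * T)) := by
      rw [star_sub, star_mul, star_mul, hB.star_eq, smul_mul_assoc, mul_smul_comm, ← smul_sub]
      congr 1
      noncomm_ring
    rw [this]
    exact hhalf _ _ _ hTB (by rwa [norm_neg, norm_star])
  · refine le_trans ?_ (hmono _ _ (norm_nonneg _) (Or.inl rfl))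
    exact hhalf _ _ _ (hnorm A) (by rw [norm_star]; exact hnorm A)

end Smoothing

section Steps

open scoped ContDiff

/-- A smooth step from `0` to `1` along the `i`-th sixth of the unit interval. -/
def smoothStep (i : ℕ) (x : ℝ) : ℝ := Real.smoothTransition (6 * x - i)

theorem smoothStep_eq_zero {i : ℕ} {x : ℝ} (h : 6 * x ≤ i) : smoothStep i x = 0 :=
  Real.smoothTransition.zero_of_nonpos (by linarith)

theorem smoothStep_eq_one {i : ℕ} {x : ℝ} (h : (i : ℝ) + 1 ≤ 6 * x) : smoothStep i x = 1 :=
  Real.smoothTransition.one_of_one_le (by linarith)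

theorem smoothStep_nonneg (i : ℕ) (x : ℝ) : 0 ≤ smoothStep i x := Real.smoothTransition.nonneg _

theorem smoothStep_le_one (i : ℕ) (x : ℝ) : smoothStep i x ≤ 1 := Real.smoothTransition.le_one _

theorem contDiff_smoothStep (i : ℕ) : ContDiff ℝ ∞ (smoothStep i) :=
  Real.smoothTransition.contDiff.comp ((contDiff_const.mul contDiff_id).sub contDiff_const)

theorem exists_norm_commutator_smoothStep_le :
    ∃ C : ℝ, 0 ≤ C ∧ ∀ (M : Type) [CStarAlgebra M] [FiniteDimensional ℂ M] (A B : M),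
      IsSelfAdjoint B → HasBandwidth (1 / 2) A B → ∀ i < 3, ∀ b : ℝ,
      ‖A * cfc (fun x => smoothStep i (x - b)) B - cfc (fun x => smoothStep i (x - b)) B * A‖ ≤
        C * ‖A * B - B * A‖ := by
  let φ : ContDiffBump (0 : ℝ) := ⟨2, 3, by norm_num, by norm_num⟩
  have hφ : ∀ x : ℝ, |x| ≤ 2 → φ x = 1 := fun x hx =>
    φ.one_of_mem_closedBall (by simpa [Real.dist_eq] using hx)
  choose C hC0 hC using fun i => exists_norm_commutator_cfc_le
    (G := fun x => smoothStep i x * φ x) ((contDiff_smoothStep i).mul φ.contDiff)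
    φ.hasCompactSupport.mul_left
  refine ⟨C 0 + C 1 + C 2, by linarith [hC0 0, hC0 1, hC0 2], ?_⟩
  intro M _ _ A B hB hAB i hi b
  have hCi : C i ≤ C 0 + C 1 + C 2 := by
    interval_cases i <;> linarith [hC0 0, hC0 1, hC0 2]
  refine le_trans ?_ (mul_le_mul_of_nonneg_right hCi (norm_nonneg _))
  refine le_trans ?_ (hC i M A B b hB)
  have hi' : (i : ℝ) ≤ 2 := by exact_mod_cast Nat.le_of_lt_succ hi
  set F := cfc (Set.indicator (Set.Ioo (b - 1 / 2) (b + 1)) fun _ => (1 : ℝ)) B with hF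
  set G := cfc (fun x => smoothStep i (x - b) * φ (x - b)) B with hG
  set g := cfc (fun x => smoothStep i (x - b)) B with hg
  have hFn : ‖F‖ ≤ 1 := by
    refine norm_cfc_le zero_le_one fun x _ => ?_
    refine (norm_indicator_le_norm_self _ _).trans (by simp)
  have key : A * g - g * A = F * (A * G - G * A) * F := by
    refine eigenProj_ext hB fun x hx y hy => ?_
    have e1 : eigenProj B x * (A * g - g * A) * eigenProj B y =
        eigenProj B x * A * (g * eigenProj B y) - (eigenProj B x * g) * A * eigenProj B y := by
      noncomm_ring
    have e2 : eigenProj B x * (F * (A * G - G * A) * F) * eigenProj B y =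
        (eigenProj B x * F) * A * (G * (F * eigenProj B y)) -
          (eigenProj B x * F) * G * A * (F * eigenProj B y) := by
      noncomm_ring
    rw [e1, e2, hF, hG, hg]
    simp only [eigenProj_mul_cfc, cfc_mul_eigenProj, smul_mul_assoc, mul_smul_comm]
    simp only [← sub_smul, smul_smul, ← mul_assoc]
    by_cases hxy : 1 / 2 ≤ |x - y|
    · simp [hAB.eigenProj_mul hxy]
    congr 1
    rw [not_le, abs_lt] at hxy
    by_cases h1 : x ∈ Set.Ioo (b - 1 / 2) (b + 1) ∧ y ∈ Set.Ioo (b - 1 / 2) (b + 1)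
    · obtain ⟨h1, h2⟩ := h1
      rw [Set.indicator_of_mem h1, Set.indicator_of_mem h2, hφ (x - b), hφ (y - b)]
      · simp
      · rw [abs_le]; constructor <;> linarith [h2.1, h2.2]
      · rw [abs_le]; constructor <;> linarith [h1.1, h1.2]
    have hzero : Set.indicator (Set.Ioo (b - 1 / 2) (b + 1)) (fun _ => (1 : ℝ)) x = 0 ∨
        Set.indicator (Set.Ioo (b - 1 / 2) (b + 1)) (fun _ => (1 : ℝ)) y = 0 :=
      (not_and_or.1 h1).imp (fun h => Set.indicator_of_notMem h _)
        (fun h => Set.indicator_of_notMem h _)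
    have hout : (x ≤ b ∧ y ≤ b) ∨ (b + 1 / 2 ≤ x ∧ b + 1 / 2 ≤ y) := by
      by_contra hcon
      refine h1 ⟨⟨?_, ?_⟩, ⟨?_, ?_⟩⟩ <;>
      · by_contra h
        rw [not_lt] at h
        first
          | exact hcon (Or.inl ⟨by linarith, by linarith⟩)
          | exact hcon (Or.inr ⟨by linarith, by linarith⟩)
    have hi0 : (0 : ℝ) ≤ i := Nat.cast_nonneg i
    have hs : smoothStep i (y - b) = smoothStep i (x - b) := by
      rcases hout with ⟨h3, h4⟩ | ⟨h3, h4⟩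
      · rw [smoothStep_eq_zero, smoothStep_eq_zero] <;> linarith
      · rw [smoothStep_eq_one, smoothStep_eq_one] <;> linarith
    rcases hzero with h | h <;> simp only [h, hs] <;> simp
  rw [key]
  calc ‖F * (A * G - G * A) * F‖ ≤ ‖F‖ * ‖A * G - G * A‖ * ‖F‖ := norm_mul₃_le
    _ ≤ 1 * ‖A * G - G * A‖ * 1 := by gcongr
    _ = _ := by ring

end Steps

section SpectralCuts

theorem norm_commutator_mul_le {M : Type*} [NormedRing M] (A X Y : M) :
    ‖A * (X * Y) - X * Y * A‖ ≤ ‖A * X - X * A‖ * ‖Y‖ + ‖X‖ * ‖A * Y - Y * A‖ := by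
  have : A * (X * Y) - X * Y * A = (A * X - X * A) * Y + X * (A * Y - Y * A) := by noncomm_ring
  rw [this]
  exact (norm_add_le _ _).trans (add_le_add (norm_mul_le _ _) (norm_mul_le _ _))

theorem norm_mul_le_of_le_one_left {M : Type*} [NormedRing M] {X : M} (hX : ‖X‖ ≤ 1) (Y : M) :
    ‖X * Y‖ ≤ ‖Y‖ :=
  (norm_mul_le _ _).trans (mul_le_of_le_one_left (norm_nonneg _) hX)

theorem norm_mul_le_of_le_one_right {M : Type*} [NormedRing M] {X : M} (hX : ‖X‖ ≤ 1) (Y : M) :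
    ‖Y * X‖ ≤ ‖Y‖ :=
  (norm_mul_le _ _).trans (mul_le_of_le_one_right (norm_nonneg _) hX)

variable {M : Type*} [CStarAlgebra M] [FiniteDimensional ℂ M]

theorem cfc_mul_of_mul_eq_smul {B E : M} (hB : IsSelfAdjoint B) {c : ℝ} (h : B * E = (c : ℂ) • E)
    (f : ℝ → ℝ) : cfc f B * E = (f c : ℂ) • E := by
  have h1 : ∀ x : ℝ, x ≠ c → eigenProj B x * E = 0 := by
    intro x hx
    have h2 : (eigenProj B x * B) * E = (c : ℂ) • (eigenProj B x * E) := by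
      rw [mul_assoc, h, mul_smul_comm]
    have h3 := eigenProj_mul_cfc (fun x => x) B x
    rw [cfc_id' ℝ B] at h3
    rw [h3, smul_mul_assoc, ← sub_eq_zero, ← sub_smul, smul_eq_zero, ← Complex.ofReal_sub] at h2
    exact h2.resolve_left (by exact_mod_cast sub_ne_zero.2 hx)
  calc cfc f B * E = ∑ x ∈ specSet B, (f x : ℂ) • (eigenProj B x * E) := by
        rw [cfc_eq_sum f B, Finset.sum_mul]
        simp only [smul_mul_assoc]
    _ = ∑ x ∈ specSet B, (f c : ℂ) • (eigenProj B x * E) := by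
        refine Finset.sum_congr rfl fun x _ => ?_
        by_cases hx : x = c
        · rw [hx]
        · rw [h1 x hx, smul_zero, smul_zero]
    _ = (f c : ℂ) • E := by
        rw [← Finset.smul_sum, ← Finset.sum_mul, sum_eigenProj hB, one_mul]

theorem isStarProjection_cfc_indicator (S : Set ℝ) (B : M) :
    IsStarProjection (cfc (Set.indicator S fun _ => (1 : ℝ)) B) := by
  refine ⟨?_, cfc_predicate _ _⟩
  rw [IsIdempotentElem, cfc_mul_cfc]
  congr 1
  ext x
  by_cases hx : x ∈ S <;> simp [hx]

/-- The spectral projection of `h` for the interval `(1 / 2, ∞)`. -/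
def upperProj (h : M) : M := cfc (Set.indicator (Set.Ioi (1 / 2 : ℝ)) fun _ => (1 : ℝ)) h

theorem upperProj_isStarProjection (h : M) : IsStarProjection (upperProj h) :=
  isStarProjection_cfc_indicator _ _

theorem abs_sq_sub_le_of_mem_spectrum {h : M} (hh : IsSelfAdjoint h) {x : ℝ}
    (hx : x ∈ spectrum ℝ h) : |x * x - x| ≤ ‖h * h - h‖ := by
  have h1 : cfc (fun x : ℝ => x * x - x) h = h * h - h := by
    rw [cfc_sub _ _ h (continuousOn_spectrum_real h _) (continuousOn_spectrum_real h _),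
      cfc_mul _ _ h (continuousOn_spectrum_real h _) (continuousOn_spectrum_real h _), cfc_id' ℝ h]
  rw [← h1]
  exact norm_apply_le_norm_cfc (fun x : ℝ => x * x - x) h hx (continuousOn_spectrum_real h _) hh

omit [FiniteDimensional ℂ M] in
theorem norm_sq_sub_le_of_norm_sub_le {h P : M} (hP : IsStarProjection P) {d : ℝ} (hd : d ≤ 3 / 50)
    (h1 : ‖h - P‖ ≤ d) : ‖h * h - h‖ ≤ 3 / 16 := by
  have hPn := IsStarProjection.norm_le P hP
  have hP1 := IsStarProjection.norm_le _ hP.one_sub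
  have e : h * h - h = (h - P) * (h - P) + P * (h - P) - (h - P) * (1 - P) + (P * P - P) := by
    noncomm_ring
  rw [e, hP.isIdempotentElem.eq, sub_self, add_zero]
  have h2 : ‖(h - P) * (h - P)‖ ≤ d * d :=
    (norm_mul_le _ _).trans (mul_le_mul h1 h1 (norm_nonneg _) ((norm_nonneg _).trans h1))
  have h3 : ‖P * (h - P)‖ ≤ d := (norm_mul_le_of_le_one_left hPn _).trans h1
  have h4 : ‖(h - P) * (1 - P)‖ ≤ d := (norm_mul_le_of_le_one_right hP1 _).trans h1
  have h5 := norm_sub_le ((h - P) * (h - P) + P * (h - P)) ((h - P) * (1 - P))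
  have h6 := norm_add_le ((h - P) * (h - P)) (P * (h - P))
  nlinarith [(norm_nonneg _).trans h1]

/-- A spectral projection at a gap almost commutes with whatever the element almost commutes with. -/
theorem norm_commutator_upperProj_le {A h : M} (hA : IsSelfAdjoint A) (hh : IsSelfAdjoint h)
    (hgap : ‖h * h - h‖ ≤ 3 / 16) :
    ‖A * upperProj h - upperProj h * A‖ ≤ 4 * ‖A * h - h * A‖ := by
  have hx : ∀ x ∈ spectrum ℝ h, |x * x - x| ≤ 3 / 16 := fun x hx =>
    (abs_sq_sub_le_of_mem_spectrum hh hx).trans hgap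
  set P := upperProj h with hP
  have hPp : IsStarProjection P := upperProj_isStarProjection h
  have hPn := IsStarProjection.norm_le P hPp
  have hP1 := IsStarProjection.norm_le _ hPp.one_sub
  set u := cfc (fun x : ℝ => if 1 / 2 < x then x⁻¹ else 0) h with hu
  have hun : ‖u‖ ≤ 4 / 3 := by
    refine norm_cfc_le (by norm_num) fun x hxs => ?_
    have h1 := abs_le.1 (hx x hxs)
    by_cases h2 : 1 / 2 < x
    · rw [if_pos h2, Real.norm_of_nonneg (by positivity)]
      rw [inv_le_comm₀ (by linarith) (by norm_num)]
      norm_num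
      nlinarith
    · rw [if_neg h2]
      norm_num
  have hcomp : 1 - P = cfc (fun x : ℝ => if 1 / 2 < x then 0 else 1) h := by
    rw [hP, upperProj, ← cfc_const_one ℝ h, cfc_sub_cfc]
    congr 1
    ext x
    by_cases h2 : 1 / 2 < x
    · rw [Set.indicator_of_mem (by exact h2), if_pos h2, sub_self]
    · rw [Set.indicator_of_notMem (by exact h2), if_neg h2, sub_zero]
  have hlow : ‖h * (1 - P)‖ ≤ 1 / 4 := by
    have : h * (1 - P) = cfc (fun x : ℝ => x * if 1 / 2 < x then 0 else 1) h := by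
      rw [hcomp, ← cfc_mul_cfc, cfc_id' ℝ h]
    rw [this]
    refine norm_cfc_le (by norm_num) fun x hxs => ?_
    have h1 := abs_le.1 (hx x hxs)
    by_cases h2 : 1 / 2 < x
    · rw [if_pos h2]
      norm_num
    · rw [if_neg h2, mul_one, Real.norm_eq_abs, abs_le]
      constructor <;> nlinarith
  have huh : u * h = P := by
    have : u * h = cfc (fun x : ℝ => (if 1 / 2 < x then x⁻¹ else 0) * x) h := by
      rw [← cfc_mul_cfc, cfc_id' ℝ h]
    rw [this, hP, upperProj]
    congr 1
    ext x
    by_cases h2 : 1 / 2 < x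
    · rw [Set.indicator_of_mem (by exact h2), if_pos h2, inv_mul_cancel₀ (by linarith)]
    · rw [Set.indicator_of_notMem (by exact h2), if_neg h2, zero_mul]
  have huP : u * P = u := by
    rw [hu, hP, upperProj, cfc_mul_cfc]
    congr 1
    ext x
    by_cases h2 : 1 / 2 < x
    · rw [Set.indicator_of_mem (by exact h2), mul_one]
    · rw [if_neg h2, zero_mul]
  have hhP : h * (1 - P) = (1 - P) * h := by
    have : Commute h P := by
      have := cfc_commute_cfc (fun x : ℝ => x) (Set.indicator (Set.Ioi (1 / 2 : ℝ)) fun _ => 1) h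
      rwa [cfc_id' ℝ h] at this
    rw [mul_sub, sub_mul, this.eq, mul_one, one_mul]
  have hid : (1 - P) * (1 - P) = 1 - P := hPp.one_sub.isIdempotentElem.eq
  set Z := P * A * (1 - P) with hZ
  have hZeq : Z = u * (Z * (h * (1 - P))) - u * (A * h - h * A) * (1 - P) := by
    have e1 : u * (Z * (h * (1 - P))) = u * A * h * (1 - P) := by
      calc u * (Z * (h * (1 - P))) = (u * P) * A * ((1 - P) * h * (1 - P)) := by
            rw [hZ]; simp only [mul_assoc]
        _ = u * A * (h * ((1 - P) * (1 - P))) := by rw [huP, ← hhP]; simp only [mul_assoc]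
        _ = _ := by rw [hid]; simp only [mul_assoc]
    rw [e1]
    calc Z = (u * h) * A * (1 - P) := by rw [huh]
      _ = _ := by noncomm_ring
  have hZn : ‖Z‖ ≤ 2 * ‖A * h - h * A‖ := by
    have h1 : ‖u * (Z * (h * (1 - P)))‖ ≤ 4 / 3 * (‖Z‖ * (1 / 4)) :=
      (norm_mul_le _ _).trans (mul_le_mul hun ((norm_mul_le _ _).trans
        (mul_le_mul_of_nonneg_left hlow (norm_nonneg _))) (norm_nonneg _) (by norm_num))
    have h2 : ‖u * (A * h - h * A) * (1 - P)‖ ≤ 4 / 3 * ‖A * h - h * A‖ :=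
      (norm_mul_le_of_le_one_right hP1 _).trans ((norm_mul_le _ _).trans
        (mul_le_mul_of_nonneg_right hun (norm_nonneg _)))
    have h3 : ‖Z‖ ≤ ‖u * (Z * (h * (1 - P)))‖ + ‖u * (A * h - h * A) * (1 - P)‖ := by
      conv_lhs => rw [hZeq]
      exact norm_sub_le _ _
    linarith
  have e : A * P - P * A = star Z - Z := by
    rw [hZ, star_mul, star_mul, hPp.one_sub.isSelfAdjoint.star_eq, hPp.isSelfAdjoint.star_eq,
      hA.star_eq]
    noncomm_ring
  rw [e]
  refine (norm_sub_le _ _).trans ?_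
  rw [norm_star]
  linarith

/-- The spectral projection of `B` for the interval `[b, ∞)`. -/
def rayProj (B : M) (b : ℝ) : M := cfc (Set.indicator (Set.Ici b) fun _ => (1 : ℝ)) B

theorem rayProj_isStarProjection (B : M) (b : ℝ) : IsStarProjection (rayProj B b) :=
  isStarProjection_cfc_indicator _ _

/-- `P` is a projection lying between the spectral projections of `B` for the rays starting at
`b + 1 / 2` and `b`. -/
structure IsCutAt (B : M) (b : ℝ) (P : M) : Prop where
  isStarProjection : IsStarProjection P
  mul_upper : P * rayProj B (b + 1 / 2) = rayProj B (b + 1 / 2)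
  mul_lower : P * rayProj B b = P

/-- The element `smoothStep i` of the spectral parameter of `B`, measured from `b`. -/
def stepCalc (i : ℕ) (B : M) (b : ℝ) : M := cfc (fun x => smoothStep i (x - b)) B

omit [FiniteDimensional ℂ M] in
theorem stepCalc_isSelfAdjoint (i : ℕ) (B : M) (b : ℝ) : IsSelfAdjoint (stepCalc i B b) :=
  cfc_predicate _ _

omit [FiniteDimensional ℂ M] in
theorem norm_stepCalc_le (i : ℕ) (B : M) (b : ℝ) : ‖stepCalc i B b‖ ≤ 1 :=
  norm_cfc_le zero_le_one fun _ _ => by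
    rw [Real.norm_of_nonneg (smoothStep_nonneg _ _)]
    exact smoothStep_le_one _ _

theorem one_sub_stepCalc (i : ℕ) {B : M} (hB : IsSelfAdjoint B) (b : ℝ) :
    1 - stepCalc i B b = cfc (fun x => 1 - smoothStep i (x - b)) B := by
  rw [stepCalc, ← cfc_const_one ℝ B, cfc_sub_cfc]

theorem norm_one_sub_stepCalc_le (i : ℕ) {B : M} (hB : IsSelfAdjoint B) (b : ℝ) :
    ‖1 - stepCalc i B b‖ ≤ 1 := by
  rw [one_sub_stepCalc i hB]
  refine norm_cfc_le zero_le_one fun x _ => ?_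
  rw [Real.norm_of_nonneg] <;> linarith [smoothStep_nonneg i (x - b), smoothStep_le_one i (x - b)]

theorem stepCalc_mul_rayProj {i : ℕ} (hi : i < 3) (B : M) (b : ℝ) :
    stepCalc i B b * rayProj B (b + 1 / 2) = rayProj B (b + 1 / 2) := by
  have hi' : (i : ℝ) ≤ 2 := by exact_mod_cast Nat.le_of_lt_succ hi
  rw [stepCalc, rayProj, cfc_mul_cfc]
  congr 1
  ext x
  by_cases hx : x ∈ Set.Ici (b + 1 / 2)
  · rw [Set.indicator_of_mem hx, mul_one]
    exact smoothStep_eq_one (by linarith [Set.mem_Ici.1 hx])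
  · rw [Set.indicator_of_notMem hx, mul_zero]

theorem stepCalc_mul_rayProj_self (i : ℕ) (B : M) (b : ℝ) :
    stepCalc i B b * rayProj B b = stepCalc i B b := by
  rw [stepCalc, rayProj, cfc_mul_cfc]
  congr 1
  ext x
  by_cases hx : x ∈ Set.Ici b
  · rw [Set.indicator_of_mem hx, mul_one]
  · rw [Set.indicator_of_notMem hx, mul_zero, smoothStep_eq_zero]
    linarith [not_le.1 (fun h : b ≤ x => hx h), (Nat.cast_nonneg i : (0 : ℝ) ≤ i)]

omit [FiniteDimensional ℂ M] in
theorem norm_sandwich_sub_le {s P : M} (hs : IsSelfAdjoint s) (hs1 : ‖s‖ ≤ 1)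
    (hP : IsStarProjection P) {d : ℝ} (h : ‖s * P‖ ≤ d) :
    ‖(1 - s) * P * (1 - s) - P‖ ≤ 3 * d := by
  have e : (1 - s) * P * (1 - s) - P = s * P * s - s * P - star (s * P) := by
    rw [star_mul, hs.star_eq, hP.isSelfAdjoint.star_eq]
    noncomm_ring
  rw [e]
  have h1 := norm_sub_le (s * P * s - s * P) (star (s * P))
  have h2 := norm_sub_le (s * P * s) (s * P)
  have h3 := norm_mul_le_of_le_one_right hs1 (s * P)
  rw [norm_star] at h1
  linarith

/-- A projection which is approximately a cut can be replaced by an exact one. -/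
theorem exists_isCutAt {A B P : M} (hA : IsSelfAdjoint A) (hB : IsSelfAdjoint B)
    (hP : IsStarProjection P) (b : ℝ) (h2 : ‖stepCalc 2 B b * (1 - P)‖ ≤ 1 / 100)
    (h0 : ‖(1 - stepCalc 0 B b) * P‖ ≤ 1 / 100) :
    ∃ P', IsCutAt B b P' ∧ ‖A * P' - P' * A‖ ≤ 16 * (‖A * P - P * A‖ +
      ‖A * stepCalc 0 B b - stepCalc 0 B b * A‖ + ‖A * stepCalc 2 B b - stepCalc 2 B b * A‖) := by
  set s := stepCalc 0 B b with hs
  set t := stepCalc 2 B b with ht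
  have hsa : IsSelfAdjoint s := stepCalc_isSelfAdjoint _ _ _
  have hta : IsSelfAdjoint t := stepCalc_isSelfAdjoint _ _ _
  have hs1 : ‖s‖ ≤ 1 := norm_stepCalc_le _ _ _
  have ht1 : ‖t‖ ≤ 1 := norm_stepCalc_le _ _ _
  have hs2 : ‖1 - s‖ ≤ 1 := norm_one_sub_stepCalc_le _ hB _
  have ht2 : ‖1 - t‖ ≤ 1 := norm_one_sub_stepCalc_le _ hB _
  have hPn := IsStarProjection.norm_le _ hP.one_sub
  set W := (1 - t) * (1 - P) * (1 - t) with hW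
  set h := s * (1 - W) * s with hh
  have h1sa : IsSelfAdjoint (1 : M) := .one M
  have hWsa : IsSelfAdjoint W := by
    rw [IsSelfAdjoint, hW, star_mul, star_mul, (h1sa.sub hta).star_eq,
      hP.one_sub.isSelfAdjoint.star_eq, mul_assoc]
  have hsa' : IsSelfAdjoint h := by
    rw [IsSelfAdjoint, hh, star_mul, star_mul, hsa.star_eq, (h1sa.sub hWsa).star_eq, mul_assoc]
  have hWP : ‖W - (1 - P)‖ ≤ 3 * (1 / 100) := norm_sandwich_sub_le hta ht1 hP.one_sub h2
  have hWn : ‖W‖ ≤ 1 := (norm_mul_le_of_le_one_right ht2 _).trans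
    ((norm_mul_le_of_le_one_left ht2 _).trans hPn)
  have hone : ‖(1 : M)‖ ≤ 1 := IsStarProjection.norm_le _ (.one M)
  have hWn' : ‖1 - W‖ ≤ 2 := (norm_sub_le _ _).trans (by linarith)
  have hhP : ‖h - P‖ ≤ 3 / 50 := by
    have e : h - P = -(s * (W - (1 - P)) * s) + ((1 - (1 - s)) * P * (1 - (1 - s)) - P) := by
      rw [hh]; noncomm_ring
    have e1 := norm_sandwich_sub_le (h1sa.sub hsa) hs2 hP h0
    have e2 := (norm_mul_le_of_le_one_right hs1 (s * (W - (1 - P)))).trans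
      (norm_mul_le_of_le_one_left hs1 _)
    rw [e]
    refine (norm_add_le _ _).trans ?_
    rw [norm_neg]
    linarith
  have hR : h * rayProj B (b + 1 / 2) = ((1 : ℝ) : ℂ) • rayProj B (b + 1 / 2) := by
    have hsR := stepCalc_mul_rayProj (i := 0) (by norm_num) B b
    have htR := stepCalc_mul_rayProj (i := 2) (by norm_num) B b
    have htR' : (1 - t) * rayProj B (b + 1 / 2) = 0 := by rw [sub_mul, one_mul, htR, sub_self]
    rw [Complex.ofReal_one, one_smul, hh, mul_assoc, hsR, mul_assoc, sub_mul, one_mul, hW, mul_assoc,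
      htR', mul_zero, sub_zero, hsR]
  have hR0 : h * (1 - rayProj B b) = ((0 : ℝ) : ℂ) • (1 - rayProj B b) := by
    have : s * (1 - rayProj B b) = 0 := by
      rw [mul_sub, mul_one, stepCalc_mul_rayProj_self, sub_self]
    rw [Complex.ofReal_zero, zero_smul, hh, mul_assoc, this, mul_zero]
  refine ⟨upperProj h, ⟨upperProj_isStarProjection h, ?_, ?_⟩, ?_⟩
  · rw [upperProj, cfc_mul_of_mul_eq_smul hsa' hR, Set.indicator_of_mem (by norm_num)]
    simp
  · have := cfc_mul_of_mul_eq_smul hsa' hR0 (Set.indicator (Set.Ioi (1 / 2 : ℝ)) fun _ => (1 : ℝ))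
    rw [Set.indicator_of_notMem (by norm_num), Complex.ofReal_zero, zero_smul, mul_sub, mul_one,
      sub_eq_zero] at this
    exact this.symm
  · refine (norm_commutator_upperProj_le hA hsa'
      (norm_sq_sub_le_of_norm_sub_le hP le_rfl hhP)).trans ?_
    have hc : ∀ X : M, ‖A * (1 - X) - (1 - X) * A‖ = ‖A * X - X * A‖ := by
      intro X
      rw [← norm_neg]
      congr 1
      noncomm_ring
    have k1 := norm_commutator_mul_le A (s * (1 - W)) s
    have k2 := norm_commutator_mul_le A s (1 - W)
    have k3 := norm_commutator_mul_le A ((1 - t) * (1 - P)) (1 - t)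
    have k4 := norm_commutator_mul_le A (1 - t) (1 - P)
    rw [← hW] at k3
    rw [← hh] at k1
    rw [hc W] at k2
    rw [hc t] at k3
    rw [hc t, hc P] at k4
    have n1 := norm_mul_le_of_le_one_left hs1 (1 - W)
    have n2 := (norm_mul_le_of_le_one_left ht2 (1 - P)).trans hPn
    have m1 := mul_le_mul_of_nonneg_left hs1 (norm_nonneg (A * (s * (1 - W)) - s * (1 - W) * A))
    have m2 := mul_le_mul_of_nonneg_right (n1.trans hWn') (norm_nonneg (A * s - s * A))
    have m3 := mul_le_mul_of_nonneg_left hWn' (norm_nonneg (A * s - s * A))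
    have m4 := mul_le_mul_of_nonneg_right hs1 (norm_nonneg (A * W - W * A))
    have m5 := mul_le_mul_of_nonneg_left ht2
      (norm_nonneg (A * ((1 - t) * (1 - P)) - (1 - t) * (1 - P) * A))
    have m6 := mul_le_mul_of_nonneg_right n2 (norm_nonneg (A * t - t * A))
    have m7 := mul_le_mul_of_nonneg_left hPn (norm_nonneg (A * t - t * A))
    have m8 := mul_le_mul_of_nonneg_right ht2 (norm_nonneg (A * P - P * A))
    linarith [norm_nonneg (A * P - P * A), norm_nonneg (A * t - t * A)]

end SpectralCuts

section Assembly

theorem norm_sum_le_of_orthogonal {M : Type*} [CStarAlgebra M] {m : ℕ} {Q X : ℕ → M} {κ : ℝ}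
    (hκ : 0 ≤ κ) (hQ : ∀ k, IsStarProjection (Q k)) (hsum : ∑ k ∈ Finset.range m, Q k = 1)
    (hQX : ∀ k, Q k * X k = X k) (hX : ∀ k l, k ≠ l → X k * star (X l) = 0)
    (hn : ∀ k, ‖X k‖ ≤ κ) : ‖∑ k ∈ Finset.range m, X k‖ ≤ κ := by
  let _ := CStarAlgebra.spectralOrder M
  have _ := CStarAlgebra.spectralOrderedRing M
  set S := ∑ k ∈ Finset.range m, X k with hS
  have h1 : S * star S = ∑ k ∈ Finset.range m, X k * star (X k) := by
    rw [hS, star_sum, Finset.sum_mul_sum]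
    refine Finset.sum_congr rfl fun k hk => ?_
    rw [Finset.sum_eq_single k]
    · exact fun l _ hl => hX k l hl.symm
    · exact fun h => absurd hk h
  have h2 : ∀ k, X k * star (X k) ≤ (κ ^ 2) • Q k := by
    intro k
    have e : X k * star (X k) = Q k * (X k * star (X k)) * star (Q k) := by
      conv_lhs => rw [← hQX k]
      rw [star_mul]
      simp only [mul_assoc]
    have hQ0 : 0 ≤ Q k := (hQ k).nonneg
    rw [e]
    refine (CStarAlgebra.star_right_conjugate_le_norm_smul
      (hb := IsSelfAdjoint.mul_star_self (X k))).trans ?_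
    rw [(hQ k).isSelfAdjoint.star_eq, (hQ k).isIdempotentElem.eq, CStarRing.norm_self_mul_star]
    refine smul_le_smul_of_nonneg_right ?_ hQ0
    rw [sq]
    exact mul_self_le_mul_self (norm_nonneg _) (hn k)
  have h3 : S * star S ≤ algebraMap ℝ M (κ ^ 2) := by
    rw [h1, Algebra.algebraMap_eq_smul_one, ← hsum, Finset.smul_sum]
    exact Finset.sum_le_sum fun k _ => h2 k
  have h4 := (CStarAlgebra.norm_le_iff_le_algebraMap (S * star S) (sq_nonneg κ)
    (mul_star_self_nonneg S)).2 h3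
  rw [CStarRing.norm_self_mul_star, ← sq] at h4
  exact (sq_le_sq₀ (norm_nonneg _) hκ).1 h4

/-- Compressing a banded element to the differences of a decreasing chain of projections. -/
theorem exists_commute_of_chain {M : Type*} [CStarAlgebra M] {A : M} (hA : IsSelfAdjoint A) {m : ℕ}
    {p : ℕ → M} {κ : ℝ} (hκ : 0 ≤ κ) (hp : ∀ k, IsStarProjection (p k)) (hp0 : p 0 = 1)
    (hpm : p m = 0) (hpp : ∀ k, p k * p (k + 1) = p (k + 1))
    (hband : ∀ k, (1 - p k) * A * p (k + 1) = 0) (hc : ∀ k, ‖A * p k - p k * A‖ ≤ κ) :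
    ∃ A' : M, IsSelfAdjoint A' ∧ (∀ k, Commute A' (p k)) ∧ ‖A - A'‖ ≤ 2 * κ := by
  have hle : ∀ i j, i ≤ j → p i * p j = p j := by
    intro i j hij
    induction j, hij using Nat.le_induction with
    | base => exact (hp i).isIdempotentElem.eq
    | succ j _ ih => rw [← hpp j, ← mul_assoc, ih]
  have hle' : ∀ i j, i ≤ j → p j * p i = p j := by
    intro i j hij
    have := congrArg star (hle i j hij)
    rwa [star_mul, (hp i).isSelfAdjoint.star_eq, (hp j).isSelfAdjoint.star_eq] at this
  set Q : ℕ → M := fun k => p k - p (k + 1) with hQ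
  have hQp : ∀ k, IsStarProjection (Q k) := fun k =>
    (hp (k + 1)).sub_of_mul_eq_right (hp k) (hpp k)
  have hQr : ∀ k j, k + 1 ≤ j → Q k * p j = 0 := fun k j h => by
    rw [hQ]; simp only
    rw [sub_mul, hle _ _ h, hle _ _ (by omega), sub_self]
  have hQl : ∀ k j, j ≤ k → Q k * p j = Q k := fun k j h => by
    rw [hQ]; simp only
    rw [sub_mul, hle' _ _ h, hle' _ _ (by omega)]
  have hQr' : ∀ k j, k + 1 ≤ j → p j * Q k = 0 := fun k j h => by
    have := congrArg star (hQr k j h)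
    rwa [star_mul, (hp j).isSelfAdjoint.star_eq, (hQp k).isSelfAdjoint.star_eq, star_zero] at this
  have hQl' : ∀ k j, j ≤ k → p j * Q k = Q k := fun k j h => by
    have := congrArg star (hQl k j h)
    rwa [star_mul, (hp j).isSelfAdjoint.star_eq, (hQp k).isSelfAdjoint.star_eq] at this
  have hQQ : ∀ k l, k ≠ l → Q k * Q l = 0 := by
    intro k l hkl
    rcases lt_or_gt_of_ne hkl with h | h
    · rw [hQ]; simp only
      rw [mul_sub]
      have h1 := hQr k l h
      have h2 := hQr k (l + 1) (by omega)
      simp only [hQ] at h1 h2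
      rw [h1, h2, sub_self]
    · have h1 := hQl k l h.le
      have h2 := hQl k (l + 1) h
      change Q k * (p l - p (l + 1)) = 0
      rw [mul_sub, h1, h2, sub_self]
  have hQs : ∑ k ∈ Finset.range m, Q k = 1 := by
    rw [hQ, Finset.sum_range_sub', hp0, hpm, sub_zero]
  have hband' : ∀ k, p (k + 1) * A * (1 - p k) = 0 := by
    intro k
    have := congrArg star (hband k)
    rwa [star_mul, star_mul, (hp _).isSelfAdjoint.star_eq, hA.star_eq,
      (hp k).one_sub.isSelfAdjoint.star_eq, star_zero, ← mul_assoc] at this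
  set A' := ∑ k ∈ Finset.range m, Q k * A * Q k with hA'
  set X := ∑ k ∈ Finset.range m, Q k * A * p (k + 1) with hX
  set Y := ∑ k ∈ Finset.range m, Q k * A * (1 - p k) with hY
  have hsplit : A = A' + (X + Y) := by
    rw [hA', hX, hY, ← Finset.sum_add_distrib, ← Finset.sum_add_distrib]
    calc A = (∑ k ∈ Finset.range m, Q k) * A := by rw [hQs, one_mul]
      _ = _ := by
        rw [Finset.sum_mul]
        refine Finset.sum_congr rfl fun k _ => ?_
        simp only [hQ]
        noncomm_ring
  have hXk : ∀ k, Q k * A * p (k + 1) = Q k * A * Q (k + 1) := by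
    intro k
    have : Q k * A * p (k + 2) = 0 := by
      have e : Q k = Q k * (1 - p (k + 1)) := by
        rw [mul_sub, hQr k (k + 1) le_rfl, mul_one, sub_zero]
      rw [e, mul_assoc (Q k), mul_assoc (Q k), hband (k + 1), mul_zero]
    change _ = Q k * A * (p (k + 1) - p (k + 2))
    rw [mul_sub, this, sub_zero]
  have hstar : ∀ k l, star (Q k * A * Q l) = Q l * A * Q k := by
    intro k l
    rw [star_mul, star_mul, (hQp k).isSelfAdjoint.star_eq, (hQp l).isSelfAdjoint.star_eq, hA.star_eq,
      mul_assoc]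
  have hXn : ‖X‖ ≤ κ := by
    refine norm_sum_le_of_orthogonal hκ hQp hQs (fun k => ?_) (fun k l hkl => ?_) fun k => ?_
    · rw [← mul_assoc, ← mul_assoc, (hQp k).isIdempotentElem.eq]
    · rw [hXk, hXk, hstar]
      have : Q (k + 1) * Q (l + 1) = 0 := hQQ _ _ (by omega)
      calc Q k * A * Q (k + 1) * (Q (l + 1) * A * Q l)
          = Q k * A * (Q (k + 1) * Q (l + 1)) * A * Q l := by simp only [mul_assoc]
        _ = 0 := by rw [this]; simp
    · have e : Q k * A * p (k + 1) = Q k * (A * p (k + 1) - p (k + 1) * A) := by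
        rw [mul_sub, ← mul_assoc (Q k) (p (k + 1)), hQr k (k + 1) le_rfl]
        simp [mul_assoc]
      rw [e]
      exact (norm_mul_le_of_le_one_left (IsStarProjection.norm_le _ (hQp k)) _).trans (hc _)
  have hYk : ∀ k, Q k * A * (1 - p k) = Q k * A * (p (k - 1) - p k) := by
    intro k
    rcases Nat.eq_zero_or_pos k with rfl | hk
    · simp [hp0]
    · obtain ⟨j, rfl⟩ : ∃ j, k = j + 1 := ⟨k - 1, by omega⟩
      have : Q (j + 1) * A * (1 - p j) = 0 := by
        have e : Q (j + 1) = Q (j + 1) * p (j + 1) := (hQl _ _ le_rfl).symm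
        rw [e, mul_assoc (Q _), mul_assoc (Q _), hband' j, mul_zero]
      rw [Nat.add_sub_cancel]
      have e2 : (1 : M) - p (j + 1) = (1 - p j) + (p j - p (j + 1)) := by abel
      rw [e2, mul_add, this, zero_add]
  have hRR : ∀ k l, k < l → (p (k - 1) - p k) * (p (l - 1) - p l) = 0 := by
    intro k l hkl
    rw [sub_mul, mul_sub, mul_sub, hle _ _ (by omega), hle _ _ (by omega), hle _ _ (by omega),
      hle _ _ (by omega), sub_self]
  have hRsa : ∀ k, star (p (k - 1) - p k) = p (k - 1) - p k := fun k => by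
    rw [star_sub, (hp _).isSelfAdjoint.star_eq, (hp _).isSelfAdjoint.star_eq]
  have hRR' : ∀ k l, k ≠ l → (p (k - 1) - p k) * (p (l - 1) - p l) = 0 := by
    intro k l hkl
    rcases lt_or_gt_of_ne hkl with h | h
    · exact hRR k l h
    · have := congrArg star (hRR l k h)
      rwa [star_mul, hRsa, hRsa, star_zero] at this
  have hYn : ‖Y‖ ≤ κ := by
    refine norm_sum_le_of_orthogonal hκ hQp hQs (fun k => ?_) (fun k l hkl => ?_) fun k => ?_
    · rw [← mul_assoc, ← mul_assoc, (hQp k).isIdempotentElem.eq]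
    · rw [hYk, hYk, star_mul, hRsa]
      calc Q k * A * (p (k - 1) - p k) * ((p (l - 1) - p l) * star (Q l * A))
          = Q k * A * ((p (k - 1) - p k) * (p (l - 1) - p l)) * star (Q l * A) := by
            simp only [mul_assoc]
        _ = 0 := by rw [hRR' k l hkl]; simp
    · have e : Q k * A * (1 - p k) = -(Q k * (A * p k - p k * A) * (1 - p k)) := by
        have e1 : Q k * (A * p k - p k * A) * (1 - p k) =
            Q k * A * (p k * (1 - p k)) - (Q k * p k) * A * (1 - p k) := by noncomm_ring
        rw [e1, (hp k).mul_one_sub_self, hQl k k le_rfl, mul_zero, zero_sub, neg_neg]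
      rw [e, norm_neg]
      exact (norm_mul_le_of_le_one_right (IsStarProjection.norm_le _ (hp k).one_sub) _).trans
        ((norm_mul_le_of_le_one_left (IsStarProjection.norm_le _ (hQp k)) _).trans (hc _))
  refine ⟨A', ?_, fun j => ?_, ?_⟩
  · rw [IsSelfAdjoint, hA', star_sum]
    exact Finset.sum_congr rfl fun k _ => hstar k k
  · refine Commute.sum_left _ _ _ fun k _ => ?_
    rw [commute_iff_eq]
    by_cases hkj : j ≤ k
    · rw [mul_assoc _ (Q k), hQl k j hkj, ← mul_assoc (p j), ← mul_assoc (p j), hQl' k j hkj]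
    · rw [mul_assoc _ (Q k), hQr k j (by omega), ← mul_assoc (p j), ← mul_assoc (p j),
        hQr' k j (by omega)]
      simp
  · have : A - A' = X + Y := sub_eq_of_eq_add' hsplit
    rw [this]
    exact (norm_add_le _ _).trans (by linarith)

theorem sum_indicator_Ici_le {x : ℝ} (hx : 0 ≤ x) (m : ℕ) :
    ∑ k ∈ Finset.range m, Set.indicator (Set.Ici ((k : ℝ) + 1)) (fun _ => (1 : ℝ)) x ≤ x := by
  have : ∑ k ∈ Finset.range m, Set.indicator (Set.Ici ((k : ℝ) + 1)) (fun _ => (1 : ℝ)) x ≤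
      min x m := by
    induction m with
    | zero => simpa using hx
    | succ m ih =>
      rw [Finset.sum_range_succ]
      have h1 := ih.trans (min_le_left _ _)
      have h2 := ih.trans (min_le_right _ _)
      push_cast
      by_cases h : x ∈ Set.Ici ((m : ℝ) + 1)
      · rw [Set.indicator_of_mem h]
        exact le_min (by linarith [Set.mem_Ici.1 h]) (by linarith)
      · rw [Set.indicator_of_notMem h]
        exact le_min (by linarith) (by linarith)
  exact this.trans (min_le_left _ _)

theorem le_sum_indicator_Ici {x : ℝ} (m : ℕ) (hx : x ≤ m) :
    x - 3 / 2 ≤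
      ∑ k ∈ Finset.range m, Set.indicator (Set.Ici ((k : ℝ) + 1 + 1 / 2)) (fun _ => (1 : ℝ)) x := by
  have : min x (m + 3 / 2) - 3 / 2 ≤
      ∑ k ∈ Finset.range m, Set.indicator (Set.Ici ((k : ℝ) + 1 + 1 / 2)) (fun _ => (1 : ℝ)) x := by
    clear hx
    induction m with
    | zero => simp
    | succ m ih =>
      rw [Finset.sum_range_succ]
      push_cast
      by_cases h : x ∈ Set.Ici ((m : ℝ) + 1 + 1 / 2)
      · rw [Set.indicator_of_mem h]
        rw [min_eq_right (by linarith [Set.mem_Ici.1 h])] at ih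
        linarith [min_le_right x ((m : ℝ) + 1 + 3 / 2)]
      · rw [Set.indicator_of_notMem h]
        have h' : x < (m : ℝ) + 1 + 1 / 2 := not_le.1 h
        rw [min_eq_left (by linarith)] at ih
        linarith [min_le_left x ((m : ℝ) + 1 + 3 / 2)]
  rwa [min_eq_left (by linarith)] at this

variable {M : Type*} [CStarAlgebra M] [FiniteDimensional ℂ M]

/-- Cuts at all integers which almost commute with a banded `A` give a commuting approximation. -/
theorem exists_commute_of_cuts {A B : M} (hA : IsSelfAdjoint A) (hB : IsSelfAdjoint B)
    (hAB : HasBandwidth (1 / 2) A B) {κ : ℝ} (P : ℤ → M) (hP : ∀ i : ℤ, IsCutAt B i (P i))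
    (hc : ∀ i, ‖A * P i - P i * A‖ ≤ κ) :
    ∃ A' B' : M, IsSelfAdjoint A' ∧ IsSelfAdjoint B' ∧ A' * B' = B' * A' ∧ ‖A - A'‖ ≤ 2 * κ ∧
      ‖B - B'‖ ≤ 2 := by
  have hκ : 0 ≤ κ := (norm_nonneg _).trans (hc 0)
  obtain ⟨N, hN⟩ := exists_nat_ge (‖B‖ + 1)
  have hspec : ∀ x ∈ spectrum ℝ B, |x| ≤ N - 1 := by
    intro x hx
    have := norm_apply_le_norm_cfc (fun x : ℝ => x) B hx (continuousOn_spectrum_real B _) hB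
    rw [cfc_id' ℝ B, Real.norm_eq_abs] at this
    linarith
  set p : ℕ → M := fun k => P ((k : ℤ) - N) with hp
  have hcast : ∀ k : ℕ, (((k : ℤ) - N : ℤ) : ℝ) = (k : ℝ) - N := fun k => by push_cast; rfl
  have hcut : ∀ k : ℕ, IsCutAt B ((k : ℝ) - N) (p k) := fun k => hcast k ▸ hP _
  have hproj : ∀ k, IsStarProjection (p k) := fun k => (hcut k).isStarProjection
  have hmulray : ∀ c d : ℝ, c ≤ d → rayProj B c * rayProj B d = rayProj B d := by
    intro c d hcd
    rw [rayProj, rayProj, cfc_mul_cfc]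
    congr 1
    ext x
    by_cases h : x ∈ Set.Ici d
    · rw [Set.indicator_of_mem h, Set.indicator_of_mem (Set.Ici_subset_Ici.2 hcd h), mul_one]
    · rw [Set.indicator_of_notMem h, mul_zero]
  have hlow' : ∀ k : ℕ, rayProj B ((k : ℝ) - N) * p k = p k := by
    intro k
    have := congrArg star (hcut k).mul_lower
    rwa [star_mul, (hproj k).isSelfAdjoint.star_eq,
      (rayProj_isStarProjection B _).isSelfAdjoint.star_eq] at this
  have hpp : ∀ k, p k * p (k + 1) = p (k + 1) := by
    intro k
    have h1 : p k * rayProj B (((k + 1 : ℕ) : ℝ) - N) = rayProj B (((k + 1 : ℕ) : ℝ) - N) := by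
      rw [← hmulray ((k : ℝ) - N + 1 / 2) (((k + 1 : ℕ) : ℝ) - N) (by push_cast; linarith),
        ← mul_assoc, (hcut k).mul_upper]
    rw [← hlow' (k + 1), ← mul_assoc, h1]
  have hp0 : p 0 = 1 := by
    have h1 : rayProj B (((0 : ℕ) : ℝ) - N + 1 / 2) = 1 := by
      rw [rayProj, ← cfc_const_one ℝ B]
      refine cfc_congr fun x hx => Set.indicator_of_mem ?_ _
      rw [Set.mem_Ici]
      push_cast
      linarith [(abs_le.1 (hspec x hx)).1]
    have := (hcut 0).mul_upper
    rwa [h1, mul_one] at this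
  have hpm : p (2 * N) = 0 := by
    have h1 : rayProj B (((2 * N : ℕ) : ℝ) - N) = 0 := by
      rw [rayProj, ← cfc_const_zero ℝ B]
      refine cfc_congr fun x hx => Set.indicator_of_notMem ?_ _
      rw [Set.mem_Ici, not_le]
      push_cast
      linarith [(abs_le.1 (hspec x hx)).2]
    have := (hcut (2 * N)).mul_lower
    rwa [h1, mul_zero, eq_comm] at this
  have hband : ∀ k, (1 - p k) * A * p (k + 1) = 0 := by
    intro k
    have h1 : (1 - p k) = (1 - p k) * (1 - rayProj B ((k : ℝ) - N + 1 / 2)) := by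
      rw [sub_mul (1 : M), one_mul, mul_sub (p k), (hcut k).mul_upper, mul_one]
      abel
    have h2 : (1 - rayProj B ((k : ℝ) - N + 1 / 2)) =
        cfc (Set.indicator (Set.Iio ((k : ℝ) - N + 1 / 2)) fun _ => (1 : ℝ)) B := by
      rw [rayProj, ← cfc_const_one ℝ B, cfc_sub_cfc]
      congr 1
      ext x
      by_cases h : x < (k : ℝ) - N + 1 / 2
      · simp only [Set.indicator, Set.mem_Ici, Set.mem_Iio, if_pos h, if_neg (not_le.2 h), sub_zero]
      · simp only [Set.indicator, Set.mem_Ici, Set.mem_Iio, if_neg h, if_pos (not_lt.1 h), sub_self]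
    have h3 := hAB (Set.indicator (Set.Iio ((k : ℝ) - N + 1 / 2)) fun _ => (1 : ℝ))
      (Set.indicator (Set.Ici (((k + 1 : ℕ) : ℝ) - N)) fun _ => (1 : ℝ)) (fun x y hx hy => by
        have hx' : x ∈ Set.Iio ((k : ℝ) - N + 1 / 2) := Set.mem_of_indicator_ne_zero hx
        have hy' : y ∈ Set.Ici (((k + 1 : ℕ) : ℝ) - N) := Set.mem_of_indicator_ne_zero hy
        rw [Set.mem_Iio] at hx'
        rw [Set.mem_Ici] at hy'
        push_cast at hy'
        rw [abs_sub_comm]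
        exact le_trans (by linarith) (le_abs_self _))
    rw [← rayProj, ← h2] at h3
    calc (1 - p k) * A * p (k + 1)
        = (1 - p k) * (1 - rayProj B ((k : ℝ) - N + 1 / 2)) * A *
            (rayProj B (((k + 1 : ℕ) : ℝ) - N) * p (k + 1)) := by rw [← h1, hlow' (k + 1)]
      _ = (1 - p k) * ((1 - rayProj B ((k : ℝ) - N + 1 / 2)) * A *
            rayProj B (((k + 1 : ℕ) : ℝ) - N)) * p (k + 1) := by simp only [mul_assoc]
      _ = 0 := by rw [h3, mul_zero, zero_mul]
  obtain ⟨A', hA', hcomm, hAA'⟩ := exists_commute_of_chain hA hκ hproj hp0 hpm hpp hband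
    fun k => hc _
  let _ := CStarAlgebra.spectralOrder M
  have _ := CStarAlgebra.spectralOrderedRing M
  refine ⟨A', ∑ k ∈ Finset.range (2 * N), p (k + 1) - (N : ℂ) • (1 : M), hA', ?_, ?_, hAA', ?_⟩
  · refine IsSelfAdjoint.sub ?_ ?_
    · rw [IsSelfAdjoint, star_sum]
      exact Finset.sum_congr rfl fun k _ => (hproj _).isSelfAdjoint
    · rw [IsSelfAdjoint, star_smul, star_one]
      simp
  · have : Commute A' (∑ k ∈ Finset.range (2 * N), p (k + 1) - (N : ℂ) • (1 : M)) :=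
      (Commute.sum_right _ _ _ fun k _ => hcomm _).sub_right ((Commute.one_right _).smul_right _)
    exact this
  · have hshift : ∀ k : ℕ, ((k + 1 : ℕ) : ℝ) - N = (k : ℝ) + 1 - N := fun k => by push_cast; rfl
    have hup : ∑ k ∈ Finset.range (2 * N), p (k + 1) ≤ cfc (fun x : ℝ => x + N) B := by
      calc ∑ k ∈ Finset.range (2 * N), p (k + 1)
          ≤ ∑ k ∈ Finset.range (2 * N), rayProj B (((k + 1 : ℕ) : ℝ) - N) :=
            Finset.sum_le_sum fun k _ => ((hproj (k + 1)).le_iff_mul_eq_left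
              (rayProj_isStarProjection B _)).2 (hcut (k + 1)).mul_lower
        _ = cfc (∑ k ∈ Finset.range (2 * N),
              Set.indicator (Set.Ici (((k + 1 : ℕ) : ℝ) - N)) fun _ => (1 : ℝ)) B :=
            (cfc_sum _ B _ fun k _ => continuousOn_spectrum_real B _).symm
        _ ≤ _ := by
            refine cfc_mono (fun x hx => ?_) (continuousOn_spectrum_real B _)
              (continuousOn_spectrum_real B _)
            have hx' := abs_le.1 (hspec x hx)
            refine le_trans (le_of_eq ?_)
              (sum_indicator_Ici_le (x := x + N) (by linarith [hx'.1]) (2 * N))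
            rw [Finset.sum_apply]
            refine Finset.sum_congr rfl fun k _ => ?_
            rw [hshift]
            simp only [Set.indicator, Set.mem_Ici, sub_le_iff_le_add]
    have hdown : cfc (fun x : ℝ => x + N - 3 / 2) B ≤ ∑ k ∈ Finset.range (2 * N), p (k + 1) := by
      calc cfc (fun x : ℝ => x + N - 3 / 2) B
          ≤ cfc (∑ k ∈ Finset.range (2 * N),
              Set.indicator (Set.Ici (((k + 1 : ℕ) : ℝ) - N + 1 / 2)) fun _ => (1 : ℝ)) B := by
            refine cfc_mono (fun x hx => ?_) (continuousOn_spectrum_real B _)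
              (continuousOn_spectrum_real B _)
            have hx' := abs_le.1 (hspec x hx)
            refine le_trans (le_sum_indicator_Ici (x := x + N) (2 * N)
              (by push_cast; linarith [hx'.2])) (le_of_eq ?_)
            rw [Finset.sum_apply]
            refine Finset.sum_congr rfl fun k _ => ?_
            rw [hshift]
            simp only [Set.indicator, Set.mem_Ici]
            congr 1
            exact propext ⟨fun h => by linarith, fun h => by linarith⟩
        _ = ∑ k ∈ Finset.range (2 * N), rayProj B (((k + 1 : ℕ) : ℝ) - N + 1 / 2) :=
            cfc_sum _ B _ fun k _ => continuousOn_spectrum_real B _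
        _ ≤ _ := Finset.sum_le_sum fun k _ => ((rayProj_isStarProjection B _).le_iff_mul_eq_right
              (hproj (k + 1))).2 (hcut (k + 1)).mul_upper
    have hBc : cfc (fun x : ℝ => x + N) B = B + (N : ℂ) • 1 := by
      rw [cfc_add B (fun x : ℝ => x) (fun _ => (N : ℝ)) (continuousOn_spectrum_real B _)
        (continuousOn_spectrum_real B _), cfc_id' ℝ B, cfc_const _ B,
        Algebra.algebraMap_eq_smul_one, ← Complex.coe_smul]
      simp
    have hBc' : cfc (fun x : ℝ => x + N - 3 / 2) B = B + (N : ℂ) • 1 - (3 / 2 : ℝ) • 1 := by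
      rw [cfc_sub (fun x : ℝ => x + N) (fun _ => 3 / 2) B (continuousOn_spectrum_real B _) (continuousOn_spectrum_real B _), hBc,
        cfc_const _ B, Algebra.algebraMap_eq_smul_one]
    rw [hBc] at hup
    rw [hBc'] at hdown
    have e : B - (∑ k ∈ Finset.range (2 * N), p (k + 1) - (N : ℂ) • (1 : M)) =
        B + (N : ℂ) • 1 - ∑ k ∈ Finset.range (2 * N), p (k + 1) := by abel
    rw [e]
    have h0 := sub_nonneg.2 hup
    have h1 : B + (N : ℂ) • 1 - ∑ k ∈ Finset.range (2 * N), p (k + 1) ≤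
        algebraMap ℝ M (3 / 2) := by
      rw [Algebra.algebraMap_eq_smul_one]
      exact sub_le_comm.1 hdown
    have := (CStarAlgebra.norm_le_iff_le_algebraMap _ (by norm_num) h0).2 h1
    linarith

end Assembly

section Bootstrap

section UpperProj

variable {M : Type*} [CStarAlgebra M] [FiniteDimensional ℂ M]

theorem norm_one_sub_upperProj_mul_le {G G' t : M} (hG' : IsSelfAdjoint G') (ht : ‖t‖ ≤ 1)
    (hGt : G * t = t) : ‖(1 - upperProj G') * t‖ ≤ 2 * ‖G - G'‖ := by
  set u := cfc (fun x : ℝ => if 1 / 2 < x then 0 else (1 - x)⁻¹) G' with hu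
  have hun : ‖u‖ ≤ 2 := by
    refine norm_cfc_le (by norm_num) fun x _ => ?_
    by_cases h2 : 1 / 2 < x
    · rw [if_pos h2, norm_zero]
      norm_num
    · have h3 : (1 : ℝ) / 2 ≤ 1 - x := by linarith [not_lt.1 h2]
      rw [if_neg h2, Real.norm_of_nonneg (by rw [inv_nonneg]; linarith)]
      calc (1 - x)⁻¹ ≤ (1 / 2)⁻¹ := inv_anti₀ (by norm_num) h3
        _ = 2 := by norm_num
  have h1 : 1 - upperProj G' = u * (1 - G') := by
    have e : (1 - G') = cfc (fun x : ℝ => 1 - x) G' := by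
      rw [← cfc_sub_cfc (fun _ => 1) (fun x => x), cfc_const_one ℝ G', cfc_id' ℝ G']
    rw [e, hu, cfc_mul_cfc, upperProj, ← cfc_const_one ℝ G', cfc_sub_cfc]
    congr 1
    ext x
    by_cases h2 : 1 / 2 < x
    · rw [Set.indicator_of_mem (Set.mem_Ioi.2 h2), if_pos h2, sub_self, zero_mul]
    · rw [Set.indicator_of_notMem (mt Set.mem_Ioi.1 h2), if_neg h2, inv_mul_cancel₀, sub_zero]
      linarith [not_lt.1 h2]
  have h2 : (1 - upperProj G') * t = u * ((G - G') * t) := by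
    rw [h1, mul_assoc, sub_mul, sub_mul, hGt, one_mul]
  rw [h2]
  exact (norm_mul_le _ _).trans (mul_le_mul hun (norm_mul_le_of_le_one_right ht _)
    (norm_nonneg _) zero_le_two)

theorem norm_upperProj_mul_le {G G' t : M} (hG' : IsSelfAdjoint G') (ht : ‖t‖ ≤ 1)
    (hGt : G * t = 0) : ‖upperProj G' * t‖ ≤ 2 * ‖G - G'‖ := by
  set u := cfc (fun x : ℝ => if 1 / 2 < x then x⁻¹ else 0) G' with hu
  have hun : ‖u‖ ≤ 2 := by
    refine norm_cfc_le (by norm_num) fun x _ => ?_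
    by_cases h2 : 1 / 2 < x
    · rw [if_pos h2, Real.norm_of_nonneg (by rw [inv_nonneg]; linarith)]
      calc x⁻¹ ≤ (1 / 2)⁻¹ := inv_anti₀ (by norm_num) h2.le
        _ = 2 := by norm_num
    · rw [if_neg h2, norm_zero]
      norm_num
  have h1 : upperProj G' = u * G' := by
    have e : u * G' = u * cfc (fun x : ℝ => x) G' := by rw [cfc_id' ℝ G']
    rw [e, hu, cfc_mul_cfc, upperProj]
    congr 1
    ext x
    by_cases h2 : 1 / 2 < x
    · rw [Set.indicator_of_mem (Set.mem_Ioi.2 h2), if_pos h2, inv_mul_cancel₀]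
      linarith
    · rw [Set.indicator_of_notMem (mt Set.mem_Ioi.1 h2), if_neg h2, zero_mul]
  have h2 : upperProj G' * t = u * ((G' - G) * t) := by
    rw [h1, mul_assoc, sub_mul, hGt, sub_zero]
  rw [h2, norm_sub_rev G]
  exact (norm_mul_le _ _).trans (mul_le_mul hun (norm_mul_le_of_le_one_right ht _)
    (norm_nonneg _) zero_le_two)

theorem stepCalc_mul_stepCalc_succ (i : ℕ) (B : M) (b : ℝ) :
    stepCalc i B b * stepCalc (i + 1) B b = stepCalc (i + 1) B b := by
  rw [stepCalc, stepCalc, cfc_mul_cfc]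
  congr 1
  ext x
  rcases le_total (6 * (x - b)) ((i + 1 : ℕ) : ℝ) with h | h
  · rw [smoothStep_eq_zero h, mul_zero]
  · rw [smoothStep_eq_one (by exact_mod_cast h), one_mul]

theorem stepCalc_succ_mul_one_sub_stepCalc (i : ℕ) (B : M) (b : ℝ) :
    stepCalc (i + 1) B b * (1 - stepCalc i B b) = 0 := by
  have := congrArg star (stepCalc_mul_stepCalc_succ i B b)
  rw [star_mul, (stepCalc_isSelfAdjoint _ _ _).star_eq,
    (stepCalc_isSelfAdjoint _ _ _).star_eq] at this
  rw [mul_sub, mul_one, this, sub_self]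

end UpperProj

theorem norm_mul_comm_of_isSelfAdjoint {M : Type*} [CStarAlgebra M] {x y : M}
    (hx : IsSelfAdjoint x) (hy : IsSelfAdjoint y) : ‖x * y‖ = ‖y * x‖ := by
  rw [← norm_star, star_mul, hx.star_eq, hy.star_eq]

/-- If `A` is banded with respect to `B` and almost commutes with it, then `B` can be cut at every
point by a projection whose commutator with `A` is bounded by a universal constant. -/
theorem exists_isCutAt_of_hasBandwidth :
    ∃ η > 0, ∀ (M : Type) [CStarAlgebra M] [Nontrivial M] [FiniteDimensional ℂ M] (A B : M),
      IsSelfAdjoint A → IsSelfAdjoint B → HasBandwidth (1 / 2) A B → ‖A * B - B * A‖ ≤ η →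
      ∀ b : ℝ, ∃ P, IsCutAt B b P ∧ ‖A * P - P * A‖ ≤ 96 := by
  obtain ⟨C, hC1, hC⟩ := exists_hasBandwidth
  obtain ⟨D, hD0, hD⟩ := exists_norm_commutator_smoothStep_le
  obtain ⟨η₀, hη₀, hcore⟩ := exists_projection_of_almost_commute (c := 1 / 20000) (by norm_num) C
  set K := (1 + D) ^ 2 * C with hK
  have hK0 : 0 < K := by positivity
  refine ⟨min (1 / 20000) η₀ / K, by positivity, ?_⟩
  intro M _ _ _ A B hA hB hAB hδ b
  set δ := ‖A * B - B * A‖ with hδd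
  have hδ0 : 0 ≤ δ := norm_nonneg _
  have hKδ : K * δ ≤ min (1 / 20000) η₀ := by rwa [le_div_iff₀ hK0, mul_comm] at hδ
  have hKc : K * δ ≤ 1 / 20000 := hKδ.trans (min_le_left _ _)
  have hDδ : D * δ ≤ 1 / 20000 := by
    refine le_trans (mul_le_mul_of_nonneg_right ?_ hδ0) hKc
    nlinarith [mul_le_mul_of_nonneg_left hC1 (sq_nonneg (1 + D)), sq_nonneg D]
  have hCDδ : C * (D * δ) ≤ 1 / 20000 := by
    rw [← mul_assoc]
    refine le_trans (mul_le_mul_of_nonneg_right ?_ hδ0) hKc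
    nlinarith [sq_nonneg D]
  have hDCDδ : D * (C * (D * δ)) ≤ K * δ := by
    have : D * (C * (D * δ)) = (D ^ 2 * C) * δ := by ring
    rw [this]
    refine mul_le_mul_of_nonneg_right (mul_le_mul_of_nonneg_right ?_ (by linarith)) hδ0
    nlinarith
  set G := stepCalc 1 B b with hG
  have hGsa : IsSelfAdjoint G := stepCalc_isSelfAdjoint _ _ _
  have hAG : ‖A * G - G * A‖ ≤ D * δ := hD M A B hB hAB 1 (by norm_num) b
  have hGA : ‖G * A - A * G‖ ≤ D * δ := by rwa [norm_sub_rev]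
  obtain ⟨T, hT, hTA, hTG, hTc, hTn⟩ := hC M G A hGsa hA
  have hTG' : ‖T - G‖ ≤ C * (D * δ) := hTG.trans (mul_le_mul_of_nonneg_left hGA (by linarith))
  have hTc' : ‖T * A - A * T‖ ≤ C * (D * δ) :=
    hTc.trans (mul_le_mul_of_nonneg_left hGA (by linarith))
  have hTn' : ‖T‖ ≤ C :=
    hTn.trans (mul_le_of_le_one_right (by linarith) (norm_stepCalc_le 1 B b))
  have hstep : ∀ i < 3, ∀ a : ℝ, ‖T * stepCalc i A a - stepCalc i A a * T‖ ≤ K * δ := fun i hi a =>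
    ((hD M T A hA hTA i hi a).trans (mul_le_mul_of_nonneg_left hTc' hD0)).trans hDCDδ
  have hcuts : ∀ j : ℤ, ∃ P, IsCutAt A j P ∧ ‖T * P - P * T‖ ≤ 48 / 20000 := by
    intro j
    obtain ⟨q, hq, hqT, hq1, hq0⟩ := hcore M (stepCalc 1 A j) T (stepCalc 2 A j)
      (1 - stepCalc 0 A j) (stepCalc_isSelfAdjoint _ _ _) hT ((norm_stepCalc_le _ _ _).trans hC1)
      hTn' (norm_stepCalc_le _ _ _) (norm_one_sub_stepCalc_le _ hA _)
      (stepCalc_mul_stepCalc_succ 1 A j) (stepCalc_succ_mul_one_sub_stepCalc 0 A j)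
      (by
        rw [norm_sub_rev]
        exact (hstep 1 (by norm_num) j).trans (hKδ.trans (min_le_right _ _)))
    have hsa0 : IsSelfAdjoint (1 - stepCalc 0 A j) :=
      (IsSelfAdjoint.one M).sub (stepCalc_isSelfAdjoint _ _ _)
    obtain ⟨P, hP, hPT⟩ := exists_isCutAt hT hA hq j
      (by
        rw [norm_mul_comm_of_isSelfAdjoint (stepCalc_isSelfAdjoint _ _ _) hq.one_sub.isSelfAdjoint]
        linarith)
      (by
        rw [norm_mul_comm_of_isSelfAdjoint hsa0 hq.isSelfAdjoint]
        linarith)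
    rw [norm_sub_rev] at hqT
    exact ⟨P, hP, by linarith [hstep 0 (by norm_num) j, hstep 2 (by norm_num) j]⟩
  choose P hP hPT using hcuts
  obtain ⟨G', A', hG', hA', hcomm, hTG2, hAA'⟩ := exists_commute_of_cuts hT hA hTA P hP hPT
  have hGG' : ‖G - G'‖ ≤ 97 / 20000 := by
    calc ‖G - G'‖ ≤ ‖G - T‖ + ‖T - G'‖ := norm_sub_le_norm_sub_add_norm_sub _ _ _
      _ ≤ 97 / 20000 := by
        rw [norm_sub_rev G]
        linarith
  have hP0 := upperProj_isStarProjection G'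
  have hP0A : ‖A * upperProj G' - upperProj G' * A‖ ≤ 4 := by
    have h1 : Commute (upperProj G') A' := hG'.commute_cfc hcomm _
    have := norm_commutator_le_of_commute (g := A) (IsStarProjection.norm_le _ hP0) h1
    rw [norm_sub_rev]
    linarith
  have hsa0 : IsSelfAdjoint (1 - stepCalc 0 B b) :=
    (IsSelfAdjoint.one M).sub (stepCalc_isSelfAdjoint _ _ _)
  obtain ⟨Q, hQ, hQA⟩ := exists_isCutAt hA hB hP0 b
    (by
      rw [norm_mul_comm_of_isSelfAdjoint (stepCalc_isSelfAdjoint _ _ _) hP0.one_sub.isSelfAdjoint]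
      have := norm_one_sub_upperProj_mul_le hG' (norm_stepCalc_le 2 B b)
        (stepCalc_mul_stepCalc_succ 1 B b)
      linarith)
    (by
      rw [norm_mul_comm_of_isSelfAdjoint hsa0 hP0.isSelfAdjoint]
      have := norm_upperProj_mul_le hG' (norm_one_sub_stepCalc_le 0 hB b)
        (stepCalc_succ_mul_one_sub_stepCalc 0 B b)
      linarith)
  exact ⟨Q, hQ, by linarith [hD M A B hB hAB 0 (by norm_num) b, hD M A B hB hAB 2 (by norm_num) b,
    show ‖A * stepCalc 0 B b - stepCalc 0 B b * A‖ ≤ D * δ from hD M A B hB hAB 0 (by norm_num) b,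
    show ‖A * stepCalc 2 B b - stepCalc 2 B b * A‖ ≤ D * δ from hD M A B hB hAB 2 (by norm_num) b]⟩

/-- Self-adjoint elements of arbitrary norm with a sufficiently small commutator are within a
universal distance of commuting ones. -/
theorem exists_commute_of_norm_commutator_le :
    ∃ η > 0, ∀ (M : Type) [CStarAlgebra M] [Nontrivial M] [FiniteDimensional ℂ M] (A B : M),
      IsSelfAdjoint A → IsSelfAdjoint B → ‖A * B - B * A‖ ≤ η →
      ∃ A' B' : M, IsSelfAdjoint A' ∧ IsSelfAdjoint B' ∧ A' * B' = B' * A' ∧ ‖A - A'‖ ≤ 193 ∧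
        ‖B - B'‖ ≤ 193 := by
  obtain ⟨C, hC1, hC⟩ := exists_hasBandwidth
  obtain ⟨η, hη, hcut⟩ := exists_isCutAt_of_hasBandwidth
  have hC0 : 0 < C := by linarith
  refine ⟨min 1 η / C, by positivity, ?_⟩
  intro M _ _ _ A B hA hB hδ
  rw [le_div_iff₀ hC0, mul_comm] at hδ
  obtain ⟨A₁, hA₁, hband, hd, hc, -⟩ := hC M A B hA hB
  choose P hP hPA using fun i : ℤ =>
    hcut M A₁ B hA₁ hB hband (hc.trans (hδ.trans (min_le_right _ _))) i
  obtain ⟨A', B', hA', hB', hcomm, h1, h2⟩ := exists_commute_of_cuts hA₁ hB hband P hP hPA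
  refine ⟨A', B', hA', hB', hcomm, ?_, by linarith⟩
  calc ‖A - A'‖ ≤ ‖A - A₁‖ + ‖A₁ - A'‖ := norm_sub_le_norm_sub_add_norm_sub _ _ _
    _ ≤ 193 := by
      rw [norm_sub_rev A]
      linarith [hδ.trans (min_le_left _ _)]

end Bootstrap

section Quantitative

theorem exists_isSelfAdjoint_norm_le_one {M : Type*} [CStarAlgebra M] {A A' : M} (hA : ‖A‖ ≤ 1)
    (hA' : IsSelfAdjoint A') :
    ∃ c : ℝ, IsSelfAdjoint (c • A') ∧ ‖c • A'‖ ≤ 1 ∧ ‖A - c • A'‖ ≤ 2 * ‖A - A'‖ := by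
  set m := max 1 ‖A'‖ with hm
  have hm1 : 1 ≤ m := le_max_left _ _
  have hm0 : 0 < m := by linarith
  have hmA : ‖A'‖ ≤ m := le_max_right _ _
  have hmd : m - 1 ≤ ‖A - A'‖ := by
    rw [sub_le_iff_le_add]
    refine max_le (by linarith [norm_nonneg (A - A')]) ?_
    have := norm_sub_norm_le A' A
    rw [norm_sub_rev] at this
    linarith
  refine ⟨m⁻¹, (IsSelfAdjoint.all _).smul hA', ?_, ?_⟩
  · rw [norm_smul, Real.norm_of_nonneg (by positivity), inv_mul_le_iff₀ hm0, mul_one]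
    exact hmA
  · have h1 : ‖A' - m⁻¹ • A'‖ ≤ m - 1 := by
      have e : A' - m⁻¹ • A' = (1 - m⁻¹) • A' := by rw [sub_smul, one_smul]
      have h2 : 0 ≤ 1 - m⁻¹ := sub_nonneg.2 (inv_le_one_of_one_le₀ hm1)
      rw [e, norm_smul, Real.norm_of_nonneg h2]
      calc (1 - m⁻¹) * ‖A'‖ ≤ (1 - m⁻¹) * m := mul_le_mul_of_nonneg_left hmA h2
        _ = m - 1 := by field_simp
    calc ‖A - m⁻¹ • A'‖ ≤ ‖A - A'‖ + ‖A' - m⁻¹ • A'‖ := norm_sub_le_norm_sub_add_norm_sub _ _ _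
      _ ≤ 2 * ‖A - A'‖ := by linarith

/-- Lin's theorem with the rate `O(√δ)` in finite-dimensional C⋆-algebras. -/
theorem exists_commute_contraction :
    ∃ C > 0, ∀ (M : Type) [CStarAlgebra M] [Nontrivial M] [FiniteDimensional ℂ M] (δ : ℝ)
      (A B : M), 0 < δ → IsSelfAdjoint A → IsSelfAdjoint B → ‖A‖ ≤ 1 → ‖B‖ ≤ 1 →
      ‖A * B - B * A‖ ≤ δ →
      ∃ A' B' : M, IsSelfAdjoint A' ∧ IsSelfAdjoint B' ∧ ‖A'‖ ≤ 1 ∧ ‖B'‖ ≤ 1 ∧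
        A' * B' = B' * A' ∧ ‖A - A'‖ ≤ C * √δ ∧ ‖B - B'‖ ≤ C * √δ := by
  obtain ⟨η, hη, hS⟩ := exists_commute_of_norm_commutator_le
  refine ⟨386 / √η, by positivity, ?_⟩
  intro M _ _ _ δ A B hδ hA hB hA1 hB1 hAB
  set r := √δ / √η with hr
  have hr0 : 0 < r := by positivity
  have hrr : r * r * η = δ := by
    rw [hr, div_mul_div_comm, Real.mul_self_sqrt hδ.le, Real.mul_self_sqrt hη.le,
      div_mul_cancel₀ _ hη.ne']
  obtain ⟨A', B', hA', hB', hc, h1, h2⟩ := hS M (r⁻¹ • A) (r⁻¹ • B)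
    ((IsSelfAdjoint.all _).smul hA) ((IsSelfAdjoint.all _).smul hB) (by
      rw [smul_mul_smul_comm, smul_mul_smul_comm, ← smul_sub, norm_smul,
        Real.norm_of_nonneg (by positivity), ← mul_inv, inv_mul_le_iff₀ (by positivity), hrr]
      exact hAB)
  have hscale : ∀ X X' : M, ‖r⁻¹ • X - X'‖ ≤ 193 → 2 * ‖X - r • X'‖ ≤ 386 / √η * √δ := by
    intro X X' h
    have e : X - r • X' = r • (r⁻¹ • X - X') := by
      rw [smul_sub, smul_smul, mul_inv_cancel₀ hr0.ne', one_smul]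
    rw [e, norm_smul, Real.norm_of_nonneg hr0.le]
    calc 2 * (r * ‖r⁻¹ • X - X'‖) ≤ 2 * (r * 193) := by gcongr
      _ = 386 / √η * √δ := by rw [hr]; ring
  obtain ⟨a, ha, ha1, haA⟩ := exists_isSelfAdjoint_norm_le_one (A' := r • A') hA1
    ((IsSelfAdjoint.all _).smul hA')
  obtain ⟨b, hb, hb1, hbB⟩ := exists_isSelfAdjoint_norm_le_one (A' := r • B') hB1
    ((IsSelfAdjoint.all _).smul hB')
  refine ⟨a • r • A', b • r • B', ha, hb, ha1, hb1, ?_, haA.trans (hscale _ _ h1),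
    hbB.trans (hscale _ _ h2)⟩
  have hc' : Commute A' B' := hc
  exact ((hc'.smul_left r).smul_left a).smul_right r |>.smul_right b

theorem tendsto_mul_sqrt_div_rpow (C : ℝ) {s : ℝ} (hs : s < 1 / 2) :
    Tendsto (fun δ : ℝ => C * √δ / δ ^ s) (𝓝[>] 0) (𝓝 0) := by
  have h1 : Tendsto (fun δ : ℝ => C * δ ^ (1 / 2 - s)) (𝓝[>] 0) (𝓝 0) := by
    have h2 : ContinuousAt (fun δ : ℝ => C * δ ^ (1 / 2 - s)) 0 :=
      continuousAt_const.mul (Real.continuousAt_rpow_const _ _ (Or.inr (by linarith)))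
    have h3 := h2.tendsto
    rw [Real.zero_rpow (by linarith), mul_zero] at h3
    exact h3.mono_left nhdsWithin_le_nhds
  refine h1.congr' ?_
  filter_upwards [self_mem_nhdsWithin] with δ hδ
  rw [Real.rpow_sub hδ, Real.sqrt_eq_rpow, mul_div_assoc]

end Quantitative

/-- Theorem (`thm:QuantitativeSquare`, quantitative Lin's theorem): there is a
dimension-independent function `ε` with `ε(δ) = E(1/δ)·δ^{1/6}` (so
`ε(δ)/δ^{1/6−α} → 0` as `δ → 0⁺` for every `α ∈ (0, 1/6)`) such that any
δ-representation of the square by matrices is within `ε(δ)` of an exact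
representation of the square. -/
theorem square_quantitative :
    ∃ ε : ℝ → ℝ,
      (∀ δ > (0 : ℝ), 0 < ε δ) ∧
      (∀ α ∈ Set.Ioo (0 : ℝ) (1/6),
        Filter.Tendsto (fun δ : ℝ => ε δ / δ ^ ((1:ℝ)/6 - α))
          (nhdsWithin 0 (Set.Ioi 0)) (nhds 0)) ∧
      (∀ (n : ℕ), 1 ≤ n → ∀ δ : ℝ, 0 < δ →
        ∀ H₁ H₂ : Matrix (Fin n) (Fin n) ℂ,
          H₁.IsHermitian → H₂.IsHermitian →
          AC.opNorm H₁ ≤ 1 → AC.opNorm H₂ ≤ 1 →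
          AC.opNorm (H₁ * H₂ - H₂ * H₁) ≤ δ →
          ∃ K₁ K₂ : Matrix (Fin n) (Fin n) ℂ,
            K₁.IsHermitian ∧ K₂.IsHermitian ∧
            AC.opNorm K₁ ≤ 1 ∧ AC.opNorm K₂ ≤ 1 ∧
            K₁ * K₂ = K₂ * K₁ ∧
            AC.opNorm (H₁ - K₁) ≤ ε δ ∧ AC.opNorm (H₂ - K₂) ≤ ε δ) := by
  obtain ⟨C, hC, h⟩ := exists_commute_contraction
  refine ⟨fun δ => C * √δ, fun δ hδ => mul_pos hC (Real.sqrt_pos.2 hδ),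
    fun α hα => tendsto_mul_sqrt_div_rpow C (by linarith [hα.1]), ?_⟩
  intro n hn δ hδ H₁ H₂ hH₁ hH₂ h1 h2 h12
  have _ : Nonempty (Fin n) := ⟨⟨0, hn⟩⟩
  set Φ := Matrix.toEuclideanCLM (𝕜 := ℂ) (n := Fin n)
  have _ : FiniteDimensional ℂ (EuclideanSpace ℂ (Fin n) →L[ℂ] EuclideanSpace ℂ (Fin n)) :=
    Module.Finite.of_surjective Φ.toAlgEquiv.toLinearMap Φ.surjective
  have hsa : ∀ H : Matrix (Fin n) (Fin n) ℂ, H.IsHermitian → IsSelfAdjoint (Φ H) := fun H hH =>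
    IsSelfAdjoint.map (show IsSelfAdjoint H from hH) Φ
  obtain ⟨A, B, hA, hB, hA1, hB1, hAB, hdA, hdB⟩ := h
    (EuclideanSpace ℂ (Fin n) →L[ℂ] EuclideanSpace ℂ (Fin n)) δ (Φ H₁) (Φ H₂) hδ (hsa _ hH₁)
    (hsa _ hH₂) h1 h2 (by
      rw [← map_mul, ← map_mul, ← map_sub]
      exact h12)
  obtain ⟨K₁, rfl⟩ := Φ.surjective A
  obtain ⟨K₂, rfl⟩ := Φ.surjective B
  have hherm : ∀ K : Matrix (Fin n) (Fin n) ℂ, IsSelfAdjoint (Φ K) → K.IsHermitian := fun K hK =>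
    Φ.injective ((map_star Φ K).trans hK)
  refine ⟨K₁, K₂, hherm _ hA, hherm _ hB, hA1, hB1, Φ.injective ?_, ?_, ?_⟩
  · rw [map_mul, map_mul, hAB]
  · rw [AC.opNorm, map_sub]
    exact hdA
  · rw [AC.opNorm, map_sub]
    exact hdB
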